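/- Let μ₀ ∈ SP and assume there exists at most one vaguely continuous subprobability solution to (NLFPK) with initial condition μ₀. Then there exists at most one weakly continuous solution (Γ_t)_{t∈[0,T]} to (SP-CE) with initial condition Γ₀ = δ_{μ₀}. If moreover μ₀ ∈ P, then, in the case of existence, Γ_t(P) = 1 for each t ∈ [0,T]. -/

import Mathlib

open MeasureTheory Topology Filter

noncomputable section

/-- Euclidean space `ℝ^d`. -/
abbrev Rd (d : ℕ) := Fin d → ℝ

/-- The space of subprobability measures on `ℝ^d`. -/
def SP (d : ℕ) : Type := {μ : Measure (Rd d) // μ Set.univ ≤ 1}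

/-- The vague topology on `SP d`: the initial topology of the maps `μ ↦ ∫ g dμ` for
`g : ℝ^d → ℝ` continuous with compact support. -/
instance (d : ℕ) : TopologicalSpace (SP d) :=
  ⨅ g : {g : Rd d → ℝ // Continuous g ∧ HasCompactSupport g},
    TopologicalSpace.induced (fun μ : SP d => ∫ x, g.1 x ∂μ.1) inferInstance

instance (d : ℕ) : MeasurableSpace (SP d) := borel (SP d)
instance (d : ℕ) : BorelSpace (SP d) := ⟨rfl⟩

/-- First-order partial derivative `∂_i f`. -/
def pd {n : ℕ} (f : (Fin n → ℝ) → ℝ) (i : Fin n) (x : Fin n → ℝ) : ℝ :=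
  fderiv ℝ f x (Pi.single i 1)

/-- Second-order partial derivative `∂²_{ij} f`. -/
def pd2 {n : ℕ} (f : (Fin n → ℝ) → ℝ) (i j : Fin n) (x : Fin n → ℝ) : ℝ :=
  fderiv ℝ (fun y => pd f j y) x (Pi.single i 1)

/-- Twice continuously differentiable with compact support. -/
def IsC2c {n : ℕ} (φ : (Fin n → ℝ) → ℝ) : Prop :=
  ContDiff ℝ 2 φ ∧ HasCompactSupport φ

/-- Twice continuously differentiable, bounded, with bounded first and second order
partial derivatives. -/
def IsC2b {n : ℕ} (f : (Fin n → ℝ) → ℝ) : Prop :=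
  ContDiff ℝ 2 f ∧ ∃ M : ℝ, ∀ x, |f x| ≤ M ∧ (∀ i, |pd f i x| ≤ M) ∧ ∀ i j, |pd2 f i j x| ≤ M

/-- Borel coefficients, with `a` symmetric and positive semidefinite (`S⁺_d`-valued). -/
def GoodCoeffs (d : ℕ) (a : ℝ → SP d → Rd d → Fin d → Fin d → ℝ)
    (b : ℝ → SP d → Rd d → Fin d → ℝ) : Prop :=
  (∀ i j, Measurable fun p : ℝ × SP d × Rd d => a p.1 p.2.1 p.2.2 i j) ∧
  (∀ i, Measurable fun p : ℝ × SP d × Rd d => b p.1 p.2.1 p.2.2 i) ∧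
  (∀ t μ x i j, a t μ x i j = a t μ x j i) ∧
  (∀ t μ x (v : Fin d → ℝ), 0 ≤ ∑ i, ∑ j, v i * a t μ x i j * v j)

/-- The Kolmogorov operator `L_{t,μ}φ = ∑ a_ij ∂²_ij φ + ∑ b_i ∂_i φ`. -/
def Lop {d : ℕ} (a : ℝ → SP d → Rd d → Fin d → Fin d → ℝ)
    (b : ℝ → SP d → Rd d → Fin d → ℝ) (t : ℝ) (μ : SP d) (φ : Rd d → ℝ) (x : Rd d) : ℝ :=
  (∑ i, ∑ j, a t μ x i j * pd2 φ i j x) + ∑ i, b t μ x i * pd φ i x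

/-- Global integrability condition for (NLFPK). -/
def NLFPKIntegrable (d : ℕ) (T : ℝ) (a : ℝ → SP d → Rd d → Fin d → Fin d → ℝ)
    (b : ℝ → SP d → Rd d → Fin d → ℝ) (μ : ℝ → SP d) : Prop :=
  ∀ i j, ∫⁻ t in Set.Ioc (0:ℝ) T,
      ∫⁻ x, ENNReal.ofReal (|a t (μ t) x i j| + |b t (μ t) x i|) ∂(μ t).1 < ⊤

/-- The weak form of the nonlinear FPK equation, tested against `φ` at time `t`. -/
def NLFPKEq (d : ℕ) (a : ℝ → SP d → Rd d → Fin d → Fin d → ℝ)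
    (b : ℝ → SP d → Rd d → Fin d → ℝ) (μ : ℝ → SP d) (φ : Rd d → ℝ) (t : ℝ) : Prop :=
  ∫ x, φ x ∂(μ t).1 - ∫ x, φ x ∂(μ 0).1 = ∫ s in (0:ℝ)..t, ∫ x, Lop a b s (μ s) φ x ∂(μ s).1

/-- Subprobability solution to (NLFPK): a vaguely continuous, globally integrable curve
in `SP` satisfying the weak equation for all test functions in `C²_c(ℝ^d)`. -/
def IsSubprobSolution (d : ℕ) (T : ℝ) (a : ℝ → SP d → Rd d → Fin d → Fin d → ℝ)
    (b : ℝ → SP d → Rd d → Fin d → ℝ) (μ : ℝ → SP d) : Prop :=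
  ContinuousOn μ (Set.Icc 0 T) ∧ NLFPKIntegrable d T a b μ ∧
  ∀ φ : Rd d → ℝ, IsC2c φ → ∀ t ∈ Set.Icc (0:ℝ) T, NLFPKEq d a b μ φ t

/-- Weak continuity (in duality with bounded continuous functions) of a curve in `SP`. -/
def WeaklyContinuousOn {d : ℕ} (μ : ℝ → SP d) (s : Set ℝ) : Prop :=
  ∀ f : Rd d → ℝ, Continuous f → (∃ M, ∀ x, |f x| ≤ M) →
    ContinuousOn (fun t => ∫ x, f x ∂(μ t).1) s

/-- Probability solution to (NLFPK): a weakly continuous solution consisting of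
probability measures. -/
def IsProbSolution (d : ℕ) (T : ℝ) (a : ℝ → SP d → Rd d → Fin d → Fin d → ℝ)
    (b : ℝ → SP d → Rd d → Fin d → ℝ) (μ : ℝ → SP d) : Prop :=
  IsSubprobSolution d T a b μ ∧ (∀ t ∈ Set.Icc (0:ℝ) T, (μ t).1 Set.univ = 1) ∧
  WeaklyContinuousOn μ (Set.Icc 0 T)

/-- `φ` and `ψ` are uniformly `ε`-close, together with their first and second order
partial derivatives (closeness in the `C²_b` norm). -/
def C2Close {n : ℕ} (φ ψ : (Fin n → ℝ) → ℝ) (ε : ℝ) : Prop :=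
  (∀ x, |φ x - ψ x| ≤ ε) ∧ (∀ i x, |pd φ i x - pd ψ i x| ≤ ε) ∧
  ∀ i j x, |pd2 φ i j x - pd2 ψ i j x| ≤ ε

/-- A countable family `g i ∈ C²_c(ℝ^d) \ {0}` which is dense in `C²_c(ℝ^d)` with respect
to the `C²_b` norm. -/
def GFamily (d : ℕ) (g : ℕ → Rd d → ℝ) : Prop :=
  (∀ i, IsC2c (g i)) ∧ (∀ i, g i ≠ 0) ∧
  ∀ φ : Rd d → ℝ, IsC2c φ → ∀ ε : ℝ, 0 < ε → ∃ i, C2Close (g i) φ ε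

/-- The global chart `G : SP → ℝ^∞`, `G(μ) = (μ(g_i))_i`. -/
def Gmap {d : ℕ} (g : ℕ → Rd d → ℝ) (μ : SP d) : ℕ → ℝ := fun i => ∫ x, g i x ∂μ.1

/-- `F(μ) = f(μ(g_1),…,μ(g_n))`, a typical element of `FC²_b(G)`. -/
def Fof {d : ℕ} (g : ℕ → Rd d → ℝ) {n : ℕ} (f : (Fin n → ℝ) → ℝ) (μ : SP d) : ℝ :=
  f fun k : Fin n => ∫ x, g k x ∂μ.1

/-- The action `𝐋_t F(μ) = ⟨∇^{SP} F(μ), b(t,μ) + a(t,μ)∇⟩_{L²(μ)}` of the linearized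
operator on `F(μ) = f(μ(g_1),…,μ(g_n)) ∈ FC²_b(G)`. -/
def bL {d : ℕ} (a : ℝ → SP d → Rd d → Fin d → Fin d → ℝ)
    (b : ℝ → SP d → Rd d → Fin d → ℝ) (g : ℕ → Rd d → ℝ) {n : ℕ}
    (f : (Fin n → ℝ) → ℝ) (t : ℝ) (μ : SP d) : ℝ :=
  ∑ k : Fin n, pd f k (fun l : Fin n => ∫ x, g l x ∂μ.1) * ∫ x, Lop a b t μ (g k) x ∂μ.1

/-- Weak continuity of a curve of Borel measures on `SP`. -/
def WeaklyContinuousMeasOn {d : ℕ} (Γ : ℝ → Measure (SP d)) (s : Set ℝ) : Prop :=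
  ∀ F : SP d → ℝ, Continuous F → (∃ M, ∀ μ, |F μ| ≤ M) →
    ContinuousOn (fun t => ∫ μ, F μ ∂(Γ t)) s

/-- Weakly continuous solution to the linearized continuity equation (SP-CE) on `P(SP)`. -/
def IsSPCESolution (d : ℕ) (T : ℝ) (a : ℝ → SP d → Rd d → Fin d → Fin d → ℝ)
    (b : ℝ → SP d → Rd d → Fin d → ℝ) (g : ℕ → Rd d → ℝ)
    (Γ : ℝ → Measure (SP d)) : Prop :=
  (∀ t ∈ Set.Icc (0:ℝ) T, IsProbabilityMeasure (Γ t)) ∧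
  WeaklyContinuousMeasOn Γ (Set.Icc 0 T) ∧
  (∫⁻ t in Set.Ioc (0:ℝ) T, ∫⁻ μ : SP d,
      (∫⁻ x, ENNReal.ofReal ((∑ i, |b t μ x i|) + ∑ i, ∑ j, |a t μ x i j|) ∂μ.1) ∂(Γ t) < ⊤) ∧
  ∀ (n : ℕ) (f : (Fin n → ℝ) → ℝ), IsC2b f → ∀ t ∈ Set.Icc (0:ℝ) T,
    ∫ μ, Fof g f μ ∂(Γ t) - ∫ μ, Fof g f μ ∂(Γ 0) =
      ∫ s in (0:ℝ)..t, ∫ μ, bL a b g f s μ ∂(Γ s)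

/-- A no-arbitrage form of the Hahn-Banach theorem: for a convex cone `𝒦` of pairs `(G, r)` whose
members with `0 ≤ G` satisfy `0 ≤ r`, some positive functional `Λ` satisfies `Λ G ≤ r` on `𝒦`. -/
theorem exists_positive_functional_le {Ω : Type*} [TopologicalSpace Ω] [CompactSpace Ω]
    (𝒦 : Set (C(Ω, ℝ) × ℝ)) (hadd : ∀ p ∈ 𝒦, ∀ q ∈ 𝒦, p + q ∈ 𝒦)
    (hsmul : ∀ c : ℝ, 0 ≤ c → ∀ p ∈ 𝒦, c • p ∈ 𝒦)
    (hone : ((1 : C(Ω, ℝ)), (1 : ℝ)) ∈ 𝒦)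
    (hpos : ∀ p ∈ 𝒦, 0 ≤ p.1 → 0 ≤ p.2) :
    ∃ Λ : C(Ω, ℝ) →ₗ[ℝ] ℝ, (∀ F, 0 ≤ F → 0 ≤ Λ F) ∧ ∀ p ∈ 𝒦, Λ p.1 ≤ p.2 := by
  have hzero : (0 : C(Ω, ℝ) × ℝ) ∈ 𝒦 := by simpa using hsmul 0 le_rfl _ hone
  let s : PointedCone ℝ (C(Ω, ℝ) × ℝ) :=
    { carrier := {x | ∃ p ∈ 𝒦, 0 ≤ x.1 + p.1 ∧ p.2 ≤ x.2}
      add_mem' := by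
        rintro x y ⟨p, hp, h1, h2⟩ ⟨q, hq, h3, h4⟩
        refine ⟨p + q, hadd p hp q hq, ?_, add_le_add h2 h4⟩
        have := add_nonneg h1 h3
        simp only [Prod.fst_add]
        convert this using 1
        abel
      zero_mem' := ⟨0, hzero, by simp, by simp⟩
      smul_mem' := by
        rintro ⟨c, hc⟩ x ⟨p, hp, h1, h2⟩
        refine ⟨c • p, hsmul c hc p hp, ?_, ?_⟩
        · have : 0 ≤ c • (x.1 + p.1) := smul_nonneg hc h1
          simpa [smul_add] using this
        · exact mul_le_mul_of_nonneg_left h2 hc }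
  let f : (C(Ω, ℝ) × ℝ) →ₗ.[ℝ] ℝ :=
    ⟨LinearMap.ker (LinearMap.fst ℝ C(Ω, ℝ) ℝ), (LinearMap.snd ℝ C(Ω, ℝ) ℝ).domRestrict _⟩
  obtain ⟨g, hg, hgs⟩ := riesz_extension s f
    (by
      rintro ⟨⟨F, r⟩, hF⟩ ⟨p, hp, h1, h2⟩
      have hF : F = 0 := hF
      subst hF
      exact (hpos p hp (by simpa using h1)).trans h2)
    (by
      rintro ⟨F, r⟩
      refine ⟨⟨(0, ‖F‖ - r), LinearMap.mem_ker.2 rfl⟩, ‖F‖ • ((1 : C(Ω, ℝ)), (1 : ℝ)),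
        hsmul _ (norm_nonneg _) _ hone, ?_, ?_⟩
      · intro ω
        have := (abs_le.1 (F.norm_coe_le_norm ω)).1
        simp
        linarith
      · simp)
  have hg2 : ∀ r : ℝ, g (0, r) = r := fun r => hg ⟨(0, r), LinearMap.mem_ker.2 rfl⟩
  refine ⟨g ∘ₗ LinearMap.inl ℝ _ _, fun F hF => ?_, fun p hp => ?_⟩
  · exact hgs (F, 0) ⟨0, hzero, by simpa using hF, by simp⟩
  · have h := hgs (-p.1, p.2) ⟨p, hp, by simp, le_rfl⟩
    have e : ((-p.1, p.2) : C(Ω, ℝ) × ℝ) = (0, p.2) - (p.1, 0) := by simp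
    rw [e, map_sub, hg2] at h
    simpa using h

/-- Dynamic programming: if each one-step infimal convolution with the cost `c k` loses at most
`θ k` when passing from `ν k` to `ν (k + 1)`, then the integrated version of a pointwise
nonnegative sum over chains is nonnegative. -/
theorem sum_integral_nonneg_of_one_step {X : Type*} [TopologicalSpace X] [CompactSpace X]
    [Nonempty X] [MeasurableSpace X] [BorelSpace X] (ν : ℕ → Measure X)
    [∀ k, IsProbabilityMeasure (ν k)] (c : ℕ → C(X × X, ℝ)) (θ : ℕ → ℝ) (N : ℕ)
    (hstep : ∀ k < N, ∀ V : C(X, ℝ),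
      ∫ x, sInf ((fun y => V y + c k (x, y)) '' Set.univ) ∂(ν k) ≤ ∫ y, V y ∂(ν (k + 1)) + θ k)
    (f : ℕ → C(X, ℝ))
    (hf : ∀ γ : ℕ → X, 0 ≤ ∑ k ∈ Finset.range (N + 1), f k (γ k) +
      ∑ k ∈ Finset.range N, c k (γ k, γ (k + 1))) :
    0 ≤ ∑ k ∈ Finset.range (N + 1), ∫ x, f k x ∂(ν k) + ∑ k ∈ Finset.range N, θ k := by
  have hint : ∀ (k : ℕ) (F : C(X, ℝ)), Integrable F (ν k) := fun k F =>
    F.continuous.integrable_of_hasCompactSupport (HasCompactSupport.of_compactSpace F)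
  induction N generalizing f with
  | zero =>
    simp only [zero_add, Finset.range_one, Finset.sum_singleton, Finset.range_zero,
      Finset.sum_empty, add_zero] at hf ⊢
    exact integral_nonneg fun x => hf fun _ => x
  | succ N ih =>
    have hcont : Continuous fun x => sInf ((fun y => f (N + 1) y + c N (x, y)) '' Set.univ) :=
      isCompact_univ.continuous_sInf (f := fun x y => f (N + 1) y + c N (x, y))
        (by fun_prop)
    let Q : C(X, ℝ) := ⟨_, hcont⟩
    have key := ih (fun k hk => hstep k (hk.trans (Nat.lt_succ_self N)))
      (Function.update f N (f N + Q)) (by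
        intro γ
        obtain ⟨y, -, hy⟩ := isCompact_univ.exists_sInf_image_eq (Set.univ_nonempty (α := X))
          (f := fun y => f (N + 1) y + c N (γ N, y)) (by fun_prop)
        have := hf (Function.update γ (N + 1) y)
        rw [Finset.sum_range_succ, Finset.sum_range_succ, Finset.sum_range_succ] at this
        rw [Finset.sum_range_succ]
        have e1 : ∑ k ∈ Finset.range N, (Function.update f N (f N + Q)) k (γ k) =
            ∑ k ∈ Finset.range N, f k (Function.update γ (N + 1) y k) := by
          refine Finset.sum_congr rfl fun k hk => ?_
          have hk := Finset.mem_range.1 hk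
          rw [Function.update_of_ne (by omega), Function.update_of_ne (by omega)]
        have e2 : ∑ k ∈ Finset.range N, c k (Function.update γ (N + 1) y k,
            Function.update γ (N + 1) y (k + 1)) =
            ∑ k ∈ Finset.range N, c k (γ k, γ (k + 1)) := by
          refine Finset.sum_congr rfl fun k hk => ?_
          have hk := Finset.mem_range.1 hk
          rw [Function.update_of_ne (by omega), Function.update_of_ne (by omega)]
        have e3 : Q (γ N) = f (N + 1) y + c N (γ N, y) := hy
        rw [e2] at this
        simp only [Function.update_self, ne_eq, Nat.left_eq_add, one_ne_zero, not_false_eq_true,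
          Function.update_of_ne] at this
        simp only [Function.update_self, ContinuousMap.add_apply]
        rw [e1, e3]
        linarith)
    have hN := hstep N (Nat.lt_succ_self N) (f (N + 1))
    rw [Finset.sum_range_succ] at key
    rw [Finset.sum_range_succ, Finset.sum_range_succ, Finset.sum_range_succ]
    have e1 : ∑ k ∈ Finset.range N, ∫ x, (Function.update f N (f N + Q)) k x ∂(ν k) =
        ∑ k ∈ Finset.range N, ∫ x, f k x ∂(ν k) := by
      refine Finset.sum_congr rfl fun k hk => ?_
      have hk := Finset.mem_range.1 hk
      rw [Function.update_of_ne (by omega)]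
    rw [e1] at key
    simp only [Function.update_self, ContinuousMap.add_apply] at key
    rw [integral_add (hint N (f N)) (hint N Q)] at key
    have : ∫ x, Q x ∂(ν N) ≤ ∫ y, f (N + 1) y ∂(ν (N + 1)) + θ N := hN
    linarith

open scoped CompactlySupported

/-- The Riesz-Markov-Kakutani theorem for positive normalized functionals on `C(Ω, ℝ)`, `Ω`
compact. -/
theorem exists_probabilityMeasure_integral_eq {Ω : Type*} [TopologicalSpace Ω] [CompactSpace Ω]
    [T2Space Ω] [MeasurableSpace Ω] [BorelSpace Ω] (Λ : C(Ω, ℝ) →ₗ[ℝ] ℝ)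
    (hpos : ∀ F, 0 ≤ F → 0 ≤ Λ F) (hone : Λ 1 = 1) :
    ∃ η : Measure Ω, IsProbabilityMeasure η ∧ ∀ F : C(Ω, ℝ), ∫ ω, F ω ∂η = Λ F := by
  let Λ' : CompactlySupportedContinuousMap Ω ℝ →ₚ[ℝ] ℝ :=
    { toFun := fun F => Λ F.toContinuousMap
      map_add' := fun F G => Λ.map_add _ _
      map_smul' := fun c F => Λ.map_smul _ _
      monotone' := fun F G h => by
        have : 0 ≤ Λ (G.toContinuousMap - F.toContinuousMap) :=
          hpos _ fun x => sub_nonneg.2 (h x)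
        rw [map_sub] at this
        simpa using this }
  have key : ∀ F : C(Ω, ℝ), ∫ ω, F ω ∂(RealRMK.rieszMeasure Λ') = Λ F := fun F =>
    RealRMK.integral_rieszMeasure Λ' (CompactlySupportedContinuousMap.continuousMapEquiv F)
  refine ⟨RealRMK.rieszMeasure Λ', ⟨?_⟩, key⟩
  have h := key 1
  simp only [ContinuousMap.one_apply, integral_const, smul_eq_mul, mul_one, hone] at h
  rw [Measure.real, ENNReal.toReal_eq_one_iff] at h
  exact h

/-- Weak limits of positive normalized functionals on a compact space are probability measures. -/
theorem exists_probabilityMeasure_of_eventually_le {Ω : Type*} [TopologicalSpace Ω]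
    [CompactSpace Ω] [T2Space Ω] [MeasurableSpace Ω] [BorelSpace Ω] (Λ : ℕ → C(Ω, ℝ) →ₗ[ℝ] ℝ)
    (hpos : ∀ p F, 0 ≤ F → 0 ≤ Λ p F) (hone : ∀ p, Λ p 1 = 1) :
    ∃ η : Measure Ω, IsProbabilityMeasure η ∧
      ∀ (F : C(Ω, ℝ)) (c : ℝ), (∀ᶠ p in atTop, Λ p F ≤ c) → ∫ ω, F ω ∂η ≤ c := by
  have hmono : ∀ p F G, F ≤ G → Λ p F ≤ Λ p G := fun p F G h => by
    have := hpos p (G - F) (sub_nonneg.2 h)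
    rw [map_sub] at this
    linarith
  have hbd : ∀ p F, Λ p F ∈ Set.Icc (-‖F‖) ‖F‖ := fun p F => by
    constructor
    · have := hmono p (-(‖F‖ • (1 : C(Ω, ℝ)))) F fun x => by
        simpa using (abs_le.1 (F.norm_coe_le_norm x)).1
      simpa [hone] using this
    · have := hmono p F (‖F‖ • (1 : C(Ω, ℝ))) fun x => by
        simpa using (abs_le.1 (F.norm_coe_le_norm x)).2
      simpa [hone] using this
  have hlim : ∀ F, ∃ l, Tendsto (fun p => Λ p F) (hyperfilter ℕ : Filter ℕ) (𝓝 l) := fun F => by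
    obtain ⟨l, -, hl⟩ := isCompact_Icc.ultrafilter_le_nhds
      ((hyperfilter ℕ).map fun p => Λ p F) (by
        rw [Ultrafilter.coe_map, le_principal_iff, mem_map]
        exact Eventually.of_forall fun p => hbd p F)
    exact ⟨l, hl⟩
  choose L hL using hlim
  let L' : C(Ω, ℝ) →ₗ[ℝ] ℝ :=
    { toFun := L
      map_add' := fun F G => tendsto_nhds_unique (hL _) (by
        simpa only [map_add] using (hL F).add (hL G))
      map_smul' := fun c F => tendsto_nhds_unique (hL _) (by
        simpa only [map_smul, RingHom.id_apply] using (hL F).const_smul c) }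
  obtain ⟨η, hη, h⟩ := exists_probabilityMeasure_integral_eq L'
    (fun F hF => ge_of_tendsto' (hL F) fun p => hpos p F hF)
    (tendsto_nhds_unique (hL 1) (by simpa only [hone] using tendsto_const_nhds))
  refine ⟨η, hη, fun F c hc => ?_⟩
  rw [h F]
  exact le_of_tendsto (hL F) (hc.filter_mono (Nat.hyperfilter_le_atTop))

/-- A function that is Lipschitz with respect to a weighted `ℓ¹` distance can be uniformly
approximated by smooth functions whose partial derivatives are bounded by the weights. -/
theorem exists_contDiff_approx_of_weighted_lipschitz {A : Type*} [Fintype A] [DecidableEq A]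
    (l : A → ℝ) (u : (A → ℝ) → ℝ)
    (hu : ∀ z z', |u z - u z'| ≤ ∑ α, l α * |z α - z' α|) {ε : ℝ} (hε : 0 < ε) :
    ∃ v : (A → ℝ) → ℝ, ContDiff ℝ 2 v ∧ (∀ z, |v z - u z| ≤ ε) ∧
      ∀ α z, |fderiv ℝ v z (Pi.single α 1)| ≤ l α := by
  have hcont : Continuous u := by
    rw [continuous_iff_continuousAt]
    intro z
    have hc : Continuous fun z' : A → ℝ => ∑ α, l α * |z' α - z α| := by fun_prop
    have h0 : Tendsto (fun z' : A → ℝ => ∑ α, l α * |z' α - z α|) (𝓝 z) (𝓝 0) := by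
      simpa using hc.tendsto z
    exact tendsto_iff_dist_tendsto_zero.2 (squeeze_zero (fun _ => dist_nonneg)
      (fun z' => (Real.dist_eq _ _).le.trans (hu z' z)) h0)
  have hδ : ∃ δ > 0, ∀ z z' : A → ℝ, dist z z' < δ → |u z - u z'| ≤ ε := by
    have hc : Continuous fun w : A → ℝ => ∑ α, l α * |w α| := by fun_prop
    obtain ⟨δ, hδ, h⟩ := Metric.continuousAt_iff.1 (hc.continuousAt (x := 0)) ε hε
    refine ⟨δ, hδ, fun z z' hz => (hu z z').trans ?_⟩
    have := h (x := z - z') (by rwa [dist_zero_right, ← dist_eq_norm])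
    simp only [Pi.sub_apply, Pi.zero_apply, abs_zero, mul_zero, Finset.sum_const_zero,
      Real.dist_eq, sub_zero] at this
    exact ((le_abs_self _).trans this.le)
  obtain ⟨δ, hδ, hosc⟩ := hδ
  let φ : ContDiffBump (0 : A → ℝ) := ⟨δ / 2, δ, by positivity, by linarith⟩
  let v : (A → ℝ) → ℝ := convolution (φ.normed volume) u (ContinuousLinearMap.lsmul ℝ ℝ) volume
  have hex : ∀ z, Integrable (fun w => φ.normed volume w • u (z - w)) volume := fun z =>
    (φ.continuous_normed.smul (by fun_prop)).integrable_of_hasCompactSupport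
      (φ.hasCompactSupport_normed.smul_right)
  have hvz : ∀ z, v z = ∫ w, φ.normed volume w • u (z - w) := fun z => rfl
  have hsmooth : ContDiff ℝ 2 v :=
    φ.hasCompactSupport_normed.contDiff_convolution_left _ φ.contDiff_normed
      hcont.locallyIntegrable
  have hlip : ∀ z z', |v z - v z'| ≤ ∑ α, l α * |z α - z' α| := fun z z' => by
    rw [hvz, hvz, ← integral_sub (hex z) (hex z'), ← Real.norm_eq_abs]
    refine (norm_integral_le_of_norm_le
      (g := fun w => φ.normed volume w * ∑ α, l α * |z α - z' α|)
      ((φ.continuous_normed.integrable_of_hasCompactSupport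
        φ.hasCompactSupport_normed).mul_const _) (Eventually.of_forall fun w => ?_)).trans ?_
    · simp only [smul_eq_mul, ← mul_sub, norm_mul, Real.norm_eq_abs,
        abs_of_nonneg (φ.nonneg_normed w)]
      refine mul_le_mul_of_nonneg_left ?_ (φ.nonneg_normed w)
      simpa using hu (z - w) (z' - w)
    · rw [integral_mul_const, φ.integral_normed, one_mul]
  refine ⟨v, hsmooth, fun z => ?_, fun α z => ?_⟩
  · rw [← Real.dist_eq]
    refine φ.dist_normed_convolution_le hcont.aestronglyMeasurable fun w hw => ?_
    rw [Real.dist_eq]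
    exact hosc w z hw
  · have hd : HasDerivAt (fun τ : ℝ => v (z + τ • Pi.single α 1))
        (fderiv ℝ v z (Pi.single α 1)) 0 := by
      have h1 : HasFDerivAt v (fderiv ℝ v z) (z + (0 : ℝ) • Pi.single α (1 : ℝ)) := by
        simpa using (hsmooth.differentiable (by norm_num) z).hasFDerivAt
      have h2 : HasDerivAt (fun τ : ℝ => z + τ • (Pi.single α (1 : ℝ) : A → ℝ))
          (Pi.single α 1) 0 := by
        simpa using ((hasDerivAt_id (0 : ℝ)).smul_const (Pi.single α (1 : ℝ) : A → ℝ)).const_add z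
      exact h1.comp_hasDerivAt 0 h2
    have hl : 0 ≤ l α := by
      have := (abs_nonneg _).trans (hu (Pi.single α 1) 0)
      rwa [Finset.sum_eq_single α (fun β _ hβ => by simp [hβ]) (by simp), Pi.single_eq_same,
        Pi.zero_apply, sub_zero, abs_one, mul_one] at this
    rw [← hd.deriv, ← Real.norm_eq_abs]
    refine norm_deriv_le_of_lip' hl (Eventually.of_forall fun τ => ?_)
    rw [Real.norm_eq_abs, Real.norm_eq_abs]
    refine (hlip _ _).trans ?_
    rw [Finset.sum_eq_single α (fun β _ hβ => by simp [hβ]) (by simp)]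
    simp

open scoped ProbabilityTheory

/-- Continuous functions on compact spaces are integrable for finite measures. -/
theorem integrable_continuousMap {X : Type*} [TopologicalSpace X] [CompactSpace X]
    [MeasurableSpace X] [BorelSpace X] (F : C(X, ℝ)) (μ : Measure X) [IsFiniteMeasure μ] :
    Integrable F μ :=
  F.continuous.integrable_of_hasCompactSupport (HasCompactSupport.of_compactSpace F)

/-- The occupation measure `κ_t(dx) dt` on `(0, T] × X`. -/
def occupationMeasure {X : Type} [MeasurableSpace X] (T : ℝ)
    (κ : ProbabilityTheory.Kernel ℝ X) : Measure (ℝ × X) :=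
  (volume.restrict (Set.Ioc 0 T)).compProd κ

instance {X : Type} [MeasurableSpace X] (T : ℝ) (κ : ProbabilityTheory.Kernel ℝ X)
    [ProbabilityTheory.IsMarkovKernel κ] : IsFiniteMeasure (occupationMeasure T κ) := by
  unfold occupationMeasure; infer_instance

/-- A set of pairs `(F, H)` of a test function `F` and a time-dependent function `H` such that
`d/dt ∫ F dκ_t = ∫ H(t, x) dκ_t(x)`, stable under composition with smooth functions via the
chain rule. -/
structure IsTestFamily {X : Type} [TopologicalSpace X] [MeasurableSpace X] (T : ℝ)
    (κ : ProbabilityTheory.Kernel ℝ X) (𝒟 : Set (C(X, ℝ) × (ℝ × X → ℝ))) : Prop where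
  continuous_integral : ∀ F : C(X, ℝ), Continuous fun t => ∫ x, F x ∂(κ t)
  measurable : ∀ p ∈ 𝒟, Measurable p.2
  integrable : ∀ p ∈ 𝒟, Integrable p.2 (occupationMeasure T κ)
  weak_eq : ∀ p ∈ 𝒟, ∀ s t, 0 ≤ s → s ≤ t → t ≤ T → ∫ x, p.1 x ∂(κ t) - ∫ x, p.1 x ∂(κ s) =
    ∫ z in Set.Ioc s t ×ˢ Set.univ, p.2 z ∂(occupationMeasure T κ)
  comp : ∀ (A : Type) [Fintype A] [DecidableEq A] (p : A → C(X, ℝ) × (ℝ × X → ℝ)),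
    (∀ α, p α ∈ 𝒟) → ∀ u : (A → ℝ) → ℝ, ContDiff ℝ 2 u →
      ∃ q ∈ 𝒟, (∀ x, q.1 x = u fun α => (p α).1 x) ∧
        ∀ z, q.2 z = ∑ α, fderiv ℝ u (fun β => (p β).1 z.2) (Pi.single α 1) * (p α).2 z

/-- The error made when the increment of `p.1` over `[s, t]` is replaced by the initial velocity
`q.1`. -/
def stepError {X : Type} [TopologicalSpace X] [MeasurableSpace X] (T : ℝ)
    (κ : ProbabilityTheory.Kernel ℝ X) (p q : C(X, ℝ) × (ℝ × X → ℝ)) (s t : ℝ) : ℝ :=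
  ∫ z in Set.Ioc s t ×ˢ Set.univ, (|p.2 z - q.1 z.2| + (t - s) * |q.2 z|) ∂(occupationMeasure T κ)

section Abstract

set_option linter.unusedSectionVars false

variable {X : Type} [TopologicalSpace X] [CompactSpace X] [MeasurableSpace X] [BorelSpace X]
  {T : ℝ} {κ : ProbabilityTheory.Kernel ℝ X} [ProbabilityTheory.IsMarkovKernel κ]

theorem setIntegral_occupationMeasure {f : ℝ × X → ℝ} (hf : Integrable f (occupationMeasure T κ))
    {s t : ℝ} (hs : 0 ≤ s) (ht : t ≤ T) :
    ∫ z in Set.Ioc s t ×ˢ Set.univ, f z ∂(occupationMeasure T κ) =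
      ∫ r in Set.Ioc s t, ∫ x, f (r, x) ∂(κ r) := by
  rw [occupationMeasure, Measure.setIntegral_compProd measurableSet_Ioc MeasurableSet.univ
    hf.integrableOn, Measure.restrict_restrict_of_subset (Set.Ioc_subset_Ioc hs ht)]
  simp

theorem setIntegral_occupationMeasure_add {f : ℝ × X → ℝ}
    (hf : Integrable f (occupationMeasure T κ)) {s r t : ℝ} (hsr : s ≤ r) (hrt : r ≤ t) :
    ∫ z in Set.Ioc s t ×ˢ Set.univ, f z ∂(occupationMeasure T κ) =
      ∫ z in Set.Ioc s r ×ˢ Set.univ, f z ∂(occupationMeasure T κ) +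
      ∫ z in Set.Ioc r t ×ˢ Set.univ, f z ∂(occupationMeasure T κ) := by
  rw [← Set.Ioc_union_Ioc_eq_Ioc hsr hrt, Set.union_prod]
  exact setIntegral_union (Set.disjoint_left.2 fun z h1 h2 => absurd h1.1.2 (not_le.2 h2.1.1))
    (measurableSet_Ioc.prod MeasurableSet.univ) hf.integrableOn hf.integrableOn

theorem continuous_integral_prod (hκ : ∀ F : C(X, ℝ), Continuous fun t => ∫ x, F x ∂(κ t)) :
    Continuous fun q : C(X, ℝ) × ℝ => ∫ x, q.1 x ∂(κ q.2) := by
  refine continuous_prod_of_continuous_lipschitzWith _ 1 hκ fun t =>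
    LipschitzWith.of_dist_le_mul fun F G => ?_
  simp only [NNReal.coe_one, one_mul]
  rw [Real.dist_eq, ← integral_sub (integrable_continuousMap F _) (integrable_continuousMap G _),
    ← Real.norm_eq_abs]
  refine (norm_integral_le_of_norm_le_const (C := dist F G)
    (Eventually.of_forall fun x => ?_)).trans (by simp)
  rw [← dist_eq_norm]
  exact ContinuousMap.dist_apply_le_dist x

theorem mul_le_setIntegral_occupationMeasure [SecondCountableTopology X] (F : C(X, ℝ))
    (hκ : ∀ F : C(X, ℝ), Continuous fun t => ∫ x, F x ∂(κ t)) {s t : ℝ} (hs : 0 ≤ s)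
    (hst : s ≤ t) (ht : t ≤ T) {c : ℝ} (hc : ∀ r ∈ Set.Ioc s t, c ≤ ∫ x, F x ∂(κ r)) :
    (t - s) * c ≤ ∫ z in Set.Ioc s t ×ˢ Set.univ, F z.2 ∂(occupationMeasure T κ) := by
  have hint : Integrable (fun z : ℝ × X => F z.2) (occupationMeasure T κ) :=
    Integrable.of_bound (F.continuous.measurable.comp measurable_snd).aestronglyMeasurable ‖F‖
      (Eventually.of_forall fun z => F.norm_coe_le_norm z.2)
  rw [setIntegral_occupationMeasure hint hs ht]
  have : (t - s) * c = ∫ r in Set.Ioc s t, c := by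
    rw [setIntegral_const, Real.volume_real_Ioc_of_le hst, smul_eq_mul]
  rw [this]
  exact setIntegral_mono_on (integrable_const _)
    ((hκ F).continuousOn.integrableOn_Icc.mono_set Set.Ioc_subset_Icc_self)
    measurableSet_Ioc hc

variable {𝒟 : Set (C(X, ℝ) × (ℝ × X → ℝ))}

/-- Local almost-monotonicity implies almost-monotonicity. -/
theorem le_add_mul_of_local {Ψ : ℝ → ℝ} {s t δ ε : ℝ} (hδ : 0 < δ)
    (h : ∀ r r', s ≤ r → r ≤ r' → r' ≤ t → r' - r ≤ δ → Ψ r ≤ Ψ r' + ε * (r' - r))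
    (hst : s ≤ t) : Ψ s ≤ Ψ t + ε * (t - s) := by
  have key : ∀ n : ℕ, ∀ r r', s ≤ r → r ≤ r' → r' ≤ t → r' - r ≤ n * δ →
      Ψ r ≤ Ψ r' + ε * (r' - r) := by
    intro n
    induction n with
    | zero =>
      intro r r' h1 h2 h3 h4
      exact h r r' h1 h2 h3 (by simp at h4; linarith)
    | succ n ih =>
      intro r r' h1 h2 h3 h4
      rcases le_total (r' - r) δ with h5 | h5
      · exact h r r' h1 h2 h3 h5
      · push_cast at h4
        have a1 := h r (r + δ) h1 (by linarith) (by linarith) (by linarith)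
        have a2 := ih (r + δ) r' (by linarith) (by linarith) h3 (by linarith)
        linarith
  obtain ⟨n, hn⟩ := exists_nat_ge ((t - s) / δ)
  exact key n s t le_rfl hst le_rfl ((div_le_iff₀ hδ).1 hn)

namespace IsTestFamily

theorem add_smul_mem (h𝒟 : IsTestFamily T κ 𝒟) {p q : C(X, ℝ) × (ℝ × X → ℝ)} (hp : p ∈ 𝒟)
    (hq : q ∈ 𝒟) (c : ℝ) : p + c • q ∈ 𝒟 := by
  let L : (Bool → ℝ) →L[ℝ] ℝ :=
    ContinuousLinearMap.proj true + c • ContinuousLinearMap.proj false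
  obtain ⟨r, hr, h1, h2⟩ := h𝒟.comp Bool (fun i => if i then p else q)
    (by intro i; cases i <;> simpa) L L.contDiff
  convert hr using 1
  ext z
  · simp [h1, L]
  · rw [h2]
    simp only [ContinuousLinearMap.fderiv]
    simp [L]

theorem integrable_stepError (h𝒟 : IsTestFamily T κ 𝒟) [SecondCountableTopology X]
    {p q : C(X, ℝ) × (ℝ × X → ℝ)} (hp : p ∈ 𝒟) (hq : q ∈ 𝒟) (c : ℝ) :
    Integrable (fun z => |p.2 z - q.1 z.2| + c * |q.2 z|) (occupationMeasure T κ) := by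
  have hint : Integrable (fun z : ℝ × X => q.1 z.2) (occupationMeasure T κ) :=
    Integrable.of_bound (q.1.continuous.measurable.comp measurable_snd).aestronglyMeasurable ‖q.1‖
      (Eventually.of_forall fun z => q.1.norm_coe_le_norm z.2)
  exact ((h𝒟.integrable p hp).sub hint).abs.add ((h𝒟.integrable q hq).abs.const_mul c)

end IsTestFamily
end Abstract

section Abstract

variable {X : Type} [TopologicalSpace X] [CompactSpace X] [SecondCountableTopology X]
  [MeasurableSpace X] [BorelSpace X]
  {T : ℝ} {κ : ProbabilityTheory.Kernel ℝ X} [ProbabilityTheory.IsMarkovKernel κ]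
variable {𝒟 : Set (C(X, ℝ) × (ℝ × X → ℝ))}

namespace IsTestFamily

/-- The one-step estimate tested against smooth functions. -/
theorem integral_comp_le (h𝒟 : IsTestFamily T κ 𝒟) {A : Type} [Fintype A] [DecidableEq A]
    {E F : A → C(X, ℝ) × (ℝ × X → ℝ)} (hE : ∀ α, E α ∈ 𝒟) (hF : ∀ α, F α ∈ 𝒟) {l : A → ℝ}
    {u : (A → ℝ) → ℝ} (hu : ContDiff ℝ 2 u)
    (hul : ∀ α z, |fderiv ℝ u z (Pi.single α 1)| ≤ l α)
    {s t : ℝ} (hs : 0 ≤ s) (hst : s ≤ t) (ht : t ≤ T) :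
    ∫ x, u (fun α => (E α).1 x + (t - s) * (F α).1 x) ∂(κ s) ≤
      ∫ x, u (fun α => (E α).1 x) ∂(κ t) + ∑ α, l α * stepError T κ (E α) (F α) s t := by
  have hl : ∀ α, 0 ≤ l α := fun α => (abs_nonneg _).trans (hul α 0)
  let G : C(ℝ × X, ℝ) := ⟨fun y => ∑ α,
    fderiv ℝ u (fun β => (E β).1 y.2 + y.1 * (F β).1 y.2) (Pi.single α 1) * (F α).1 y.2, by
      have h1 : Continuous (fderiv ℝ u) := hu.continuous_fderiv (by norm_num)
      refine continuous_finsetSum _ fun α _ => Continuous.mul ?_ (by fun_prop)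
      exact (h1.comp (by fun_prop)).clm_apply continuous_const⟩
  let Φ : ℝ → C(X, ℝ) := fun τ => ⟨fun x => u fun α => (E α).1 x + τ * (F α).1 x,
    hu.continuous.comp (by fun_prop)⟩
  have hΦ : ∀ τ, ∃ q ∈ 𝒟, q.1 = Φ τ ∧ ∀ z, q.2 z = ∑ α,
      fderiv ℝ u (fun β => (E β).1 z.2 + τ * (F β).1 z.2) (Pi.single α 1) *
        ((E α).2 z + τ * (F α).2 z) := fun τ => by
    obtain ⟨q, hq, h1, h2⟩ := h𝒟.comp A (fun α => E α + τ • F α)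
      (fun α => h𝒟.add_smul_mem (hE α) (hF α) τ) u hu
    exact ⟨q, hq, by ext x; simp [h1, Φ], fun z => by simp [h2]⟩
  have hGd : ∀ x τ, HasDerivAt (fun σ => Φ σ x) (G (τ, x)) τ := fun x τ => by
    have h1 := (hu.differentiable (by norm_num)
      (fun α => (E α).1 x + τ * (F α).1 x)).hasFDerivAt
    have h2 : HasDerivAt (fun σ : ℝ => fun α => (E α).1 x + σ * (F α).1 x)
        (fun α => (F α).1 x) τ := by
      rw [hasDerivAt_pi]
      intro α
      simpa using ((hasDerivAt_id τ).mul_const ((F α).1 x)).const_add ((E α).1 x)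
    refine (h1.comp_hasDerivAt τ h2).congr_deriv ?_
    have : (fun α => (F α).1 x) = ∑ α, (F α).1 x • (Pi.single α (1 : ℝ) : A → ℝ) := by
      ext β
      simp [Finset.sum_apply, Pi.single_apply]
    rw [this, map_sum]
    simp only [map_smul, smul_eq_mul]
    exact Finset.sum_congr rfl fun α _ => mul_comm _ _
  let e : ℝ × X → ℝ := fun z => ∑ α, l α *
    (|(E α).2 z - (F α).1 z.2| + (t - s) * |(F α).2 z|)
  have heint : Integrable e (occupationMeasure T κ) :=
    integrable_finsetSum _ fun α _ =>
      (h𝒟.integrable_stepError (hE α) (hF α) (t - s)).const_mul (l α)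
  let M : ℝ → ℝ := fun r => ∫ z in Set.Ioc s r ×ˢ Set.univ, e z ∂(occupationMeasure T κ)
  have hMs : M s = 0 := by simp [M]
  have hMt : M t = ∑ α, l α * stepError T κ (E α) (F α) s t := by
    simp only [M, e]
    rw [integral_finsetSum _ fun α _ =>
      ((h𝒟.integrable_stepError (hE α) (hF α) (t - s)).const_mul (l α)).integrableOn]
    simp only [integral_const_mul]
    rfl
  let D : ℝ → ℝ := fun r => ∫ x, Φ (t - r) x ∂(κ r)
  have hlocal : ∀ ε > 0, ∃ δ > 0, ∀ r r', s ≤ r → r ≤ r' → r' ≤ t → r' - r ≤ δ →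
      D r + M r ≤ D r' + M r' + ε * (r' - r) := by
    intro ε hε
    have hGc : Continuous fun τ => G.curry τ := G.curry.continuous
    obtain ⟨δ₁, hδ₁, h1⟩ := Metric.uniformContinuousOn_iff.1
      ((isCompact_Icc (a := (0 : ℝ)) (b := t - s)).uniformContinuousOn_of_continuous
        hGc.continuousOn) (ε / 2) (by positivity)
    have hJ : Continuous fun y : ℝ × ℝ => ∫ x, G (y.1, x) ∂(κ y.2) :=
      (continuous_integral_prod h𝒟.continuous_integral).comp
        ((hGc.comp continuous_fst).prodMk continuous_snd)
    obtain ⟨δ₂, hδ₂, h2⟩ := Metric.uniformContinuousOn_iff.1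
      (((isCompact_Icc (a := (0 : ℝ)) (b := t - s)).prod
        (isCompact_Icc (a := s) (b := t))).uniformContinuousOn_of_continuous
        hJ.continuousOn) (ε / 2) (by positivity)
    refine ⟨min δ₁ δ₂ / 2, by positivity, fun r r' hr hrr hr' hd => ?_⟩
    have hδ₁' : r' - r < δ₁ := by linarith [min_le_left δ₁ δ₂, lt_min hδ₁ hδ₂]
    have hδ₂' : r' - r < δ₂ := by linarith [min_le_right δ₁ δ₂, lt_min hδ₁ hδ₂]
    obtain ⟨q, hq, hq1, hq2⟩ := hΦ (t - r)
    have hw := h𝒟.weak_eq q hq r r' (by linarith) hrr (by linarith)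
    rw [hq1] at hw
    have hMadd : M r' = M r + ∫ z in Set.Ioc r r' ×ˢ Set.univ, e z ∂(occupationMeasure T κ) :=
      setIntegral_occupationMeasure_add heint hr hrr
    have hGint : Integrable (fun z : ℝ × X => G (t - r, z.2)) (occupationMeasure T κ) :=
      Integrable.of_bound ((G.curry (t - r)).continuous.measurable.comp
        measurable_snd).aestronglyMeasurable ‖G.curry (t - r)‖
        (Eventually.of_forall fun z => (G.curry (t - r)).norm_coe_le_norm z.2)
    have hlow : (∫ z in Set.Ioc r r' ×ˢ Set.univ, G (t - r, z.2) ∂(occupationMeasure T κ)) -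
        ∫ z in Set.Ioc r r' ×ˢ Set.univ, e z ∂(occupationMeasure T κ) ≤
        ∫ z in Set.Ioc r r' ×ˢ Set.univ, q.2 z ∂(occupationMeasure T κ) := by
      rw [← integral_sub hGint.integrableOn heint.integrableOn]
      refine setIntegral_mono (hGint.sub heint).integrableOn (h𝒟.integrable q hq).integrableOn
        fun z => ?_
      simp only [hq2, e, G, ContinuousMap.coe_mk, ← Finset.sum_sub_distrib]
      refine Finset.sum_le_sum fun α _ => ?_
      set y := fderiv ℝ u (fun β => (E β).1 z.2 + (t - r) * (F β).1 z.2) (Pi.single α 1)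
      have hy : |y| ≤ l α := hul α _
      have a1 : |y * ((E α).2 z - (F α).1 z.2)| ≤ l α * |(E α).2 z - (F α).1 z.2| := by
        rw [abs_mul]
        exact mul_le_mul_of_nonneg_right hy (abs_nonneg _)
      have a2 : |y * ((t - r) * (F α).2 z)| ≤ l α * ((t - s) * |(F α).2 z|) := by
        rw [abs_mul, abs_mul, abs_of_nonneg (show 0 ≤ t - r by linarith)]
        gcongr
        · exact mul_nonneg (by linarith) (abs_nonneg _)
        · exact hl α
      have b1 := (abs_le.1 a1).1
      have b2 := (abs_le.1 a2).1
      linarith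
    have hJlow : (r' - r) * ((∫ x, G (t - r, x) ∂(κ r')) - ε / 2) ≤
        ∫ z in Set.Ioc r r' ×ˢ Set.univ, G (t - r, z.2) ∂(occupationMeasure T κ) := by
      refine mul_le_setIntegral_occupationMeasure (G.curry (t - r)) h𝒟.continuous_integral
        (by linarith) hrr (by linarith) fun ρ hρ => ?_
      have := h2 (t - r, r') ⟨⟨by linarith, by linarith⟩, ⟨by linarith, by linarith⟩⟩
        (t - r, ρ) ⟨⟨by linarith, by linarith⟩, ⟨by linarith [hρ.1], by linarith [hρ.2]⟩⟩ (by
          rw [Prod.dist_eq, dist_self, Real.dist_eq, abs_of_nonneg (by linarith [hρ.2])]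
          exact max_lt hδ₂ (by linarith [hρ.1]))
      rw [Real.dist_eq] at this
      have := (abs_lt.1 this).2
      simp only [ContinuousMap.curry_apply]
      linarith
    have hup : ∫ x, Φ (t - r) x ∂(κ r') ≤
        (∫ x, Φ (t - r') x ∂(κ r')) + (r' - r) * ((∫ x, G (t - r, x) ∂(κ r')) + ε / 2) := by
      have hb : ∀ x, Φ (t - r) x ≤ Φ (t - r') x + (r' - r) * (G.curry (t - r) x + ε / 2) := by
        intro x
        have := (convex_Icc (t - r') (t - r)).image_sub_le_mul_sub_of_deriv_le
          (f := fun σ => Φ σ x) (C := G (t - r, x) + ε / 2)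
          (fun σ _ => (hGd x σ).continuousAt.continuousWithinAt)
          (fun σ _ => (hGd x σ).differentiableAt.differentiableWithinAt)
          (fun σ hσ => by
            rw [interior_Icc] at hσ
            rw [(hGd x σ).deriv]
            have h3 := h1 σ ⟨by linarith [hσ.1], by linarith [hσ.2]⟩ (t - r)
              ⟨by linarith, by linarith⟩ (by
                rw [Real.dist_eq, abs_sub_comm, abs_of_nonneg (by linarith [hσ.2])]
                linarith [hσ.1])
            have h4 := (ContinuousMap.dist_apply_le_dist x).trans_lt h3
            rw [Real.dist_eq] at h4
            have h5 := (abs_lt.1 h4).2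
            simp only [ContinuousMap.curry_apply] at h5
            linarith)
          (t - r') ⟨le_rfl, by linarith⟩ (t - r) ⟨by linarith, le_rfl⟩ (by linarith)
        simp only [ContinuousMap.curry_apply]
        linarith
      have hi := integrable_continuousMap (G.curry (t - r)) (κ r')
      refine (integral_mono (integrable_continuousMap _ _)
        ((integrable_continuousMap (Φ (t - r')) (κ r')).add
          ((hi.add (integrable_const (ε / 2))).const_mul (r' - r))) hb).trans (le_of_eq ?_)
      rw [integral_add' (integrable_continuousMap _ _)
        ((hi.add (integrable_const (ε / 2))).const_mul (r' - r)), integral_const_mul,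
        integral_add' hi (integrable_const _)]
      simp
    simp only [D]
    rw [hMadd]
    linarith
  have hfin : D s + M s ≤ D t + M t := by
    refine le_of_forall_pos_le_add fun ε hε => ?_
    obtain ⟨δ, hδ, h⟩ := hlocal (ε / (t - s + 1)) (by have := sub_nonneg.2 hst; positivity)
    refine (le_add_mul_of_local (Ψ := fun r => D r + M r) hδ h hst).trans ?_
    have hts := sub_nonneg.2 hst
    have : ε / (t - s + 1) * (t - s) ≤ ε := by
      rw [div_mul_eq_mul_div, div_le_iff₀ (by linarith)]
      nlinarith
    linarith
  rw [hMs, hMt, add_zero] at hfin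
  simpa [D, Φ] using hfin

end IsTestFamily
end Abstract

section Abstract

variable {X : Type} [TopologicalSpace X] [CompactSpace X] [SecondCountableTopology X]
  [MeasurableSpace X] [BorelSpace X]
  {T : ℝ} {κ : ProbabilityTheory.Kernel ℝ X} [ProbabilityTheory.IsMarkovKernel κ]
variable {𝒟 : Set (C(X, ℝ) × (ℝ × X → ℝ))}

namespace IsTestFamily

/-- The one-step estimate for infimal convolutions. -/
theorem integral_sInf_le (h𝒟 : IsTestFamily T κ 𝒟) [Nonempty X] {A : Type} [Fintype A]
    [DecidableEq A] {E F : A → C(X, ℝ) × (ℝ × X → ℝ)} (hE : ∀ α, E α ∈ 𝒟) (hF : ∀ α, F α ∈ 𝒟)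
    {l : A → ℝ} (hl : ∀ α, 0 ≤ l α) (V : C(X, ℝ))
    {s t : ℝ} (hs : 0 ≤ s) (hst : s ≤ t) (ht : t ≤ T) :
    ∫ x, sInf ((fun y => V y + ∑ α, l α * |(E α).1 y - (E α).1 x - (t - s) * (F α).1 x|) ''
      Set.univ) ∂(κ s) ≤
      ∫ y, V y ∂(κ t) + ∑ α, l α * stepError T κ (E α) (F α) s t := by
  let u : (A → ℝ) → ℝ := fun z =>
    sInf ((fun y => V y + ∑ α, l α * |(E α).1 y - z α|) '' Set.univ)
  have hcont : ∀ z : A → ℝ, Continuous fun y => V y + ∑ α, l α * |(E α).1 y - z α| :=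
    fun z => by fun_prop
  have hbdd : ∀ z : A → ℝ,
      BddBelow ((fun y => V y + ∑ α, l α * |(E α).1 y - z α|) '' Set.univ) := fun z =>
    (isCompact_univ.image (hcont z)).bddBelow
  have hule : ∀ z y, u z ≤ V y + ∑ α, l α * |(E α).1 y - z α| := fun z y =>
    csInf_le (hbdd z) ⟨y, trivial, rfl⟩
  have hu1 : ∀ z z', u z ≤ u z' + ∑ α, l α * |z α - z' α| := fun z z' => by
    obtain ⟨y, -, hy⟩ := isCompact_univ.exists_sInf_image_eq (Set.univ_nonempty (α := X))
      (hcont z').continuousOn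
    have hy : u z' = V y + ∑ α, l α * |(E α).1 y - z' α| := hy
    rw [hy, add_assoc, ← Finset.sum_add_distrib]
    refine (hule z y).trans (add_le_add_right (Finset.sum_le_sum fun α _ => ?_) _)
    rw [← mul_add]
    refine mul_le_mul_of_nonneg_left ?_ (hl α)
    have := abs_sub_le ((E α).1 y) (z' α) (z α)
    rw [abs_sub_comm (z' α)] at this
    linarith
  have hu : ∀ z z', |u z - u z'| ≤ ∑ α, l α * |z α - z' α| := fun z z' => by
    have h1 := hu1 z z'
    have h2 := hu1 z' z
    have : ∑ α, l α * |z' α - z α| = ∑ α, l α * |z α - z' α| :=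
      Finset.sum_congr rfl fun α _ => by rw [abs_sub_comm]
    rw [abs_le]
    constructor <;> linarith
  refine le_of_forall_pos_le_add fun ε hε => ?_
  obtain ⟨v, hv, hvu, hvd⟩ := exists_contDiff_approx_of_weighted_lipschitz l u hu (half_pos hε)
  have key := h𝒟.integral_comp_le hE hF hv hvd hs hst ht
  let P : C(X, ℝ) := ⟨fun x => v fun α => (E α).1 x + (t - s) * (F α).1 x,
    hv.continuous.comp (by fun_prop)⟩
  let Q : C(X, ℝ) := ⟨fun x => v fun α => (E α).1 x, hv.continuous.comp (by fun_prop)⟩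
  have hQ : ∫ x, Q x ∂(κ t) ≤ ∫ y, V y ∂(κ t) + ε / 2 := by
    have := integral_mono (μ := κ t) (integrable_continuousMap Q _)
      ((integrable_continuousMap V _).add (integrable_const (ε / 2))) fun x => by
        have h1 := (abs_le.1 (hvu fun α => (E α).1 x)).2
        have h2 := hule (fun α => (E α).1 x) x
        simp only [sub_self, abs_zero, mul_zero, Finset.sum_const_zero, add_zero] at h2
        simp only [Q, ContinuousMap.coe_mk, Pi.add_apply]
        linarith
    rw [integral_add' (integrable_continuousMap V _) (integrable_const _)] at this
    simpa using this
  have hP : ∫ x, u (fun α => (E α).1 x + (t - s) * (F α).1 x) ∂(κ s) ≤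
      ∫ x, P x ∂(κ s) + ε / 2 := by
    have hb : ∀ x, u (fun α => (E α).1 x + (t - s) * (F α).1 x) ≤
        P x + ε / 2 := by
      intro x
      have h1 := (abs_le.1 (hvu fun α => (E α).1 x + (t - s) * (F α).1 x)).1
      simp only [P, ContinuousMap.coe_mk]
      linarith
    have hcu : Continuous fun x => u fun α => (E α).1 x + (t - s) * (F α).1 x :=
      isCompact_univ.continuous_sInf
        (f := fun x y => V y + ∑ α, l α * |(E α).1 y - ((E α).1 x + (t - s) * (F α).1 x)|)
        (by fun_prop)
    have := integral_mono (μ := κ s) (integrable_continuousMap ⟨_, hcu⟩ _)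
      ((integrable_continuousMap P _).add (integrable_const (ε / 2))) hb
    rw [integral_add' (integrable_continuousMap P _) (integrable_const _)] at this
    simpa using this
  have e1 : ∀ x, sInf ((fun y => V y + ∑ α, l α * |(E α).1 y - (E α).1 x -
      (t - s) * (F α).1 x|) '' Set.univ) = u (fun α => (E α).1 x + (t - s) * (F α).1 x) := by
    intro x
    simp only [u, sub_sub]
  simp only [e1]
  have hP' : ∫ x, P x ∂(κ s) ≤ ∫ x, Q x ∂(κ t) + _ := key
  linarith

end IsTestFamily
end Abstract

section Abstract
set_option linter.unusedSectionVars false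

variable {X : Type} [TopologicalSpace X] [CompactSpace X] [SecondCountableTopology X]
  [MeasurableSpace X] [BorelSpace X]
  {T : ℝ} {κ : ProbabilityTheory.Kernel ℝ X} [ProbabilityTheory.IsMarkovKernel κ]
variable {𝒟 : Set (C(X, ℝ) × (ℝ × X → ℝ))}

/-- The deviation `|P(y) - P(x) - h Q(x)|` as a function of `(x, y)`. -/
def stepCost (P Q : C(X, ℝ)) (h : ℝ) : C(X × X, ℝ) :=
  ⟨fun z => |P z.2 - P z.1 - h * Q z.1|, by fun_prop⟩

/-- Evaluation of paths at an index. -/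
def evalMap {ι : Type} (i : ι) : C(ι → X, X) := ⟨fun ω => ω i, continuous_apply i⟩

/-- Evaluation of paths at a pair of indices. -/
def evalPair {ι : Type} (i j : ι) : C(ι → X, X × X) := (evalMap i).prodMk (evalMap j)

theorem stepCost_comp_evalPair {ι : Type} (P Q : C(X, ℝ)) (h : ℝ) (i j : ι) (ω : ι → X) :
    (stepCost P Q h).comp (evalPair i j) ω = |P (ω j) - P (ω i) - h * Q (ω i)| := rfl

namespace IsTestFamily

/-- There is a positive functional on paths with prescribed marginals along a grid, whose one-step
increments obey the one-step error bounds. -/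
theorem exists_grid_functional (h𝒟 : IsTestFamily T κ 𝒟) [Nonempty X] {ι : Type} {τ : ℕ → ι}
    (hτ : Function.Injective τ) {N : ℕ} {t : ℕ → ℝ} (ht : Monotone t) (ht0 : 0 ≤ t 0)
    (htN : t N ≤ T) :
    ∃ Λ : C(ι → X, ℝ) →ₗ[ℝ] ℝ, (∀ F, 0 ≤ F → 0 ≤ Λ F) ∧ Λ 1 = 1 ∧
      (∀ k ≤ N, ∀ f : C(X, ℝ), Λ (f.comp (evalMap (τ k))) = ∫ x, f x ∂(κ (t k))) ∧
      ∀ k < N, ∀ p ∈ 𝒟, ∀ q ∈ 𝒟,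
        Λ ((stepCost p.1 q.1 (t (k + 1) - t k)).comp (evalPair (τ k) (τ (k + 1)))) ≤
          stepError T κ p q (t k) (t (k + 1)) := by
  classical
  let A := {pq : (C(X, ℝ) × (ℝ × X → ℝ)) × (C(X, ℝ) × (ℝ × X → ℝ)) // pq.1 ∈ 𝒟 ∧ pq.2 ∈ 𝒟}
  let c : ℕ → A → C(X × X, ℝ) := fun k α => stepCost α.1.1.1 α.1.2.1 (t (k + 1) - t k)
  let C : ℕ → A → C(ι → X, ℝ) := fun k α => (c k α).comp (evalPair (τ k) (τ (k + 1)))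
  let θ : ℕ → A → ℝ := fun k α => stepError T κ α.1.1 α.1.2 (t k) (t (k + 1))
  let G : (ℕ → C(X, ℝ)) → (ℕ → A →₀ ℝ) → C(ι → X, ℝ) × ℝ := fun f l =>
    (∑ k ∈ Finset.range (N + 1), (f k).comp (evalMap (τ k)) +
      ∑ k ∈ Finset.range N, Finsupp.linearCombination ℝ (C k) (l k),
     ∑ k ∈ Finset.range (N + 1), ∫ x, f k x ∂(κ (t k)) +
      ∑ k ∈ Finset.range N, Finsupp.linearCombination ℝ (θ k) (l k))
  let 𝒦 : Set (C(ι → X, ℝ) × ℝ) := {P | ∃ f l, (∀ k α, 0 ≤ l k α) ∧ P = G f l}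
  have hGadd : ∀ f f' l l', G f l + G f' l' = G (f + f') (l + l') := by
    intro f f' l l'
    ext ω
    · simp [G, Finset.sum_add_distrib]
      abel
    · simp only [G, Prod.snd_add, Pi.add_apply, map_add, Finset.sum_add_distrib,
        ContinuousMap.add_apply]
      rw [Finset.sum_congr rfl fun k _ => integral_add (integrable_continuousMap (f k) (κ (t k)))
        (integrable_continuousMap (f' k) (κ (t k))), Finset.sum_add_distrib]
      abel
  have hGsmul : ∀ (a : ℝ) f l, a • G f l = G (a • f) (a • l) := by
    intro a f l
    ext ω
    · simp [G, Finset.mul_sum, mul_add]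
    · simp [G, Finset.mul_sum, mul_add, integral_const_mul]
  have hmarg : ∀ k ≤ N, ∀ f : C(X, ℝ),
      G (Pi.single k f) 0 = (f.comp (evalMap (τ k)), ∫ x, f x ∂(κ (t k))) := by
    intro k hk f
    have hk' : k ∈ Finset.range (N + 1) := Finset.mem_range.2 (by omega)
    ext ω
    · simp only [G, Pi.zero_apply, map_zero, Finset.sum_const_zero, add_zero]
      rw [Finset.sum_eq_single_of_mem k hk' fun j _ hj => by
        rw [Pi.single_eq_of_ne hj]; rfl, Pi.single_eq_same]
    · simp only [G, Pi.zero_apply, map_zero, Finset.sum_const_zero, add_zero]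
      rw [Finset.sum_eq_single_of_mem k hk' fun j _ hj => by
        rw [Pi.single_eq_of_ne hj]; simp, Pi.single_eq_same]
  have h𝒦marg : ∀ k ≤ N, ∀ f : C(X, ℝ),
      (f.comp (evalMap (τ k)), ∫ x, f x ∂(κ (t k))) ∈ 𝒦 := fun k hk f =>
    ⟨Pi.single k f, 0, fun _ _ => le_rfl, (hmarg k hk f).symm⟩
  have hone : ((1 : C(ι → X, ℝ)), (1 : ℝ)) ∈ 𝒦 := by
    convert h𝒦marg 0 (Nat.zero_le _) 1 using 1
    ext ω <;> simp
  obtain ⟨Λ, hpos, hle⟩ := exists_positive_functional_le 𝒦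
    (by
      rintro _ ⟨f, l, hl, rfl⟩ _ ⟨f', l', hl', rfl⟩
      exact ⟨_, _, fun k α => add_nonneg (hl k α) (hl' k α), hGadd f f' l l'⟩)
    (by
      rintro a ha _ ⟨f, l, hl, rfl⟩
      exact ⟨_, _, fun k α => mul_nonneg ha (hl k α), hGsmul a f l⟩)
    hone
    (by
      rintro _ ⟨f, l, hl, rfl⟩ hP
      refine sum_integral_nonneg_of_one_step (fun k => κ (t k))
        (fun k => Finsupp.linearCombination ℝ (c k) (l k))
        (fun k => Finsupp.linearCombination ℝ (θ k) (l k)) N (fun k hk V => ?_) f fun γ => ?_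
      · have key := h𝒟.integral_sInf_le (A := (l k).support) (E := fun α => α.1.1.1)
          (F := fun α => α.1.1.2) (fun α => α.1.2.1) (fun α => α.1.2.2)
          (l := fun α => l k α) (fun α => hl k α) V (ht0.trans (ht (Nat.zero_le k)))
          (ht (Nat.le_succ k)) ((ht (show k + 1 ≤ N from hk)).trans htN)
        have e1 : ∀ x y, Finsupp.linearCombination ℝ (c k) (l k) (x, y) =
            ∑ α : (l k).support, l k α * |α.1.1.1.1 y - α.1.1.1.1 x -
              (t (k + 1) - t k) * α.1.1.2.1 x| := by
          intro x y
          rw [Finset.sum_coe_sort (l k).support fun α : A => l k α * |α.1.1.1 y - α.1.1.1 x -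
              (t (k + 1) - t k) * α.1.2.1 x|, Finsupp.linearCombination_apply, Finsupp.sum]
          simp [c, stepCost]
        have e2 : Finsupp.linearCombination ℝ (θ k) (l k) =
            ∑ α : (l k).support, l k α * stepError T κ α.1.1.1 α.1.1.2 (t k) (t (k + 1)) := by
          rw [Finset.sum_coe_sort (l k).support fun α : A => l k α *
            stepError T κ α.1.1 α.1.2 (t k) (t (k + 1)), Finsupp.linearCombination_apply,
            Finsupp.sum]
          simp [θ]
        simp only [e1, e2]
        exact key
      · let ω : ι → X := Function.extend τ γ fun _ => Classical.arbitrary X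
        have hω : ∀ k, evalMap (τ k) ω = γ k := fun k => by
          have : evalMap (τ k) ω = ω (τ k) := rfl
          rw [this]
          exact hτ.extend_apply γ _ k
        have hP' : (0 : ℝ) ≤ (G f l).1 ω := hP ω
        simp only [G, ContinuousMap.add_apply, ContinuousMap.sum_apply,
          ContinuousMap.comp_apply, hω] at hP'
        refine hP'.trans_eq ?_
        congr 1
        refine Finset.sum_congr rfl fun k _ => ?_
        rw [Finsupp.linearCombination_apply, Finsupp.linearCombination_apply, Finsupp.sum,
          Finsupp.sum, ContinuousMap.sum_apply, ContinuousMap.sum_apply]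
        refine Finset.sum_congr rfl fun α _ => ?_
        have hp : evalPair (τ k) (τ (k + 1)) ω = (γ k, γ (k + 1)) :=
          Prod.ext (hω k) (hω (k + 1))
        simp only [C, ContinuousMap.smul_apply, ContinuousMap.comp_apply, hp])
  have hmargΛ : ∀ k ≤ N, ∀ f : C(X, ℝ),
      Λ (f.comp (evalMap (τ k))) = ∫ x, f x ∂(κ (t k)) := by
    intro k hk f
    refine le_antisymm (hle _ (h𝒦marg k hk f)) ?_
    have := hle _ (h𝒦marg k hk (-f))
    have e : (-f).comp (evalMap (τ k)) = -(f.comp (evalMap (τ k))) := rfl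
    simp only [e, map_neg, ContinuousMap.neg_apply, integral_neg] at this
    linarith
  refine ⟨Λ, hpos, ?_, hmargΛ, fun k hk p hp q hq => ?_⟩
  · have := hmargΛ 0 (Nat.zero_le _) 1
    simpa using this
  · have hmem : (C k ⟨(p, q), hp, hq⟩, θ k ⟨(p, q), hp, hq⟩) ∈ 𝒦 := by
      refine ⟨0, Pi.single k (Finsupp.single ⟨(p, q), hp, hq⟩ 1), fun j α => ?_, ?_⟩
      · rcases eq_or_ne j k with rfl | hj
        · rw [Pi.single_eq_same, Finsupp.single_apply]
          split_ifs <;> norm_num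
        · rw [Pi.single_eq_of_ne hj]
          rfl
      · have hk' : k ∈ Finset.range N := Finset.mem_range.2 hk
        ext ω
        · simp only [G, Pi.zero_apply, ContinuousMap.zero_comp, Finset.sum_const_zero, zero_add]
          rw [Finset.sum_eq_single_of_mem k hk' fun j _ hj => by
            rw [Pi.single_eq_of_ne hj, map_zero], Pi.single_eq_same,
            Finsupp.linearCombination_single, one_smul]
        · simp only [G, Pi.zero_apply, ContinuousMap.zero_apply, integral_zero,
            Finset.sum_const_zero, zero_add]
          rw [Finset.sum_eq_single_of_mem k hk' fun j _ hj => by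
            rw [Pi.single_eq_of_ne hj, map_zero], Pi.single_eq_same,
            Finsupp.linearCombination_single, one_smul]
    exact hle _ hmem

end IsTestFamily
end Abstract

section Abstract
set_option linter.unusedSectionVars false

variable {X : Type} [TopologicalSpace X] [CompactSpace X] [SecondCountableTopology X]
  [MeasurableSpace X] [BorelSpace X]
  {T : ℝ} {κ : ProbabilityTheory.Kernel ℝ X} [ProbabilityTheory.IsMarkovKernel κ]
variable {𝒟 : Set (C(X, ℝ) × (ℝ × X → ℝ))}

/-- The error bound for a coarse step from `s` to `t`. -/
def coarseError (T : ℝ) (κ : ProbabilityTheory.Kernel ℝ X) (p q : C(X, ℝ) × (ℝ × X → ℝ))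
    (s t : ℝ) : ℝ :=
  ∫ z in Set.Ioc s t ×ˢ Set.univ, |p.2 z - q.1 z.2| ∂(occupationMeasure T κ) +
    2 * (t - s) * ∫ z in Set.Ioc s t ×ˢ Set.univ, |q.2 z| ∂(occupationMeasure T κ)

namespace IsTestFamily

theorem zero_mem (h𝒟 : IsTestFamily T κ 𝒟) : (0 : C(X, ℝ) × (ℝ × X → ℝ)) ∈ 𝒟 := by
  obtain ⟨q, hq, h1, h2⟩ := h𝒟.comp Empty (fun i => i.elim) (by simp) (fun _ => 0)
    contDiff_const
  convert hq using 1
  ext z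
  · simp [h1]
  · simp [h2]

theorem functional_coarse_le (h𝒟 : IsTestFamily T κ 𝒟) {ι : Type} {τ : ℕ → ι} {N : ℕ} {h : ℝ}
    (hh : 0 ≤ h) {Λ : C(ι → X, ℝ) →ₗ[ℝ] ℝ} (hpos : ∀ F, 0 ≤ F → 0 ≤ Λ F)
    (hΛ : ∀ k < N, ∀ p ∈ 𝒟, ∀ q ∈ 𝒟,
      Λ ((stepCost p.1 q.1 h).comp (evalPair (τ k) (τ (k + 1)))) ≤
        stepError T κ p q (k * h) ((k + 1 : ℕ) * h))
    {p q : C(X, ℝ) × (ℝ × X → ℝ)} (hp : p ∈ 𝒟) (hq : q ∈ 𝒟) {k j : ℕ} (hj : 1 ≤ j)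
    (hkj : k + j ≤ N) :
    Λ ((stepCost p.1 q.1 (j * h)).comp (evalPair (τ k) (τ (k + j)))) ≤
      coarseError T κ p q (k * h) ((k + j : ℕ) * h) := by
  have hmono : ∀ F G, F ≤ G → Λ F ≤ Λ G := fun F G h => by
    have := hpos (G - F) (sub_nonneg.2 h)
    rw [map_sub] at this
    linarith
  have hst : ∀ i : ℕ, (k : ℝ) * h ≤ (k + i : ℕ) * h := fun i => by
    push_cast
    nlinarith [mul_nonneg (Nat.cast_nonneg (α := ℝ) i) hh]
  have hst' : ∀ i : ℕ, ((k + i : ℕ) : ℝ) * h ≤ (k + (i + 1) : ℕ) * h := fun i => by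
    push_cast
    nlinarith
  have hint : ∀ p ∈ 𝒟, ∀ q : C(X, ℝ), Integrable (fun z : ℝ × X => |p.2 z - q z.2|)
      (occupationMeasure T κ) := fun p hp q =>
    ((h𝒟.integrable p hp).sub (Integrable.of_bound
      (q.continuous.measurable.comp measurable_snd).aestronglyMeasurable ‖q‖
      (Eventually.of_forall fun z => q.norm_coe_le_norm z.2))).abs
  have hzero : ∀ i : ℕ, k + i ≤ N →
      Λ ((stepCost q.1 0 0).comp (evalPair (τ k) (τ (k + i)))) ≤
        ∫ z in Set.Ioc (k * h) ((k + i : ℕ) * h) ×ˢ Set.univ, |q.2 z|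
          ∂(occupationMeasure T κ) := by
    intro i
    induction i with
    | zero =>
      intro _
      have : (stepCost q.1 0 0).comp (evalPair (τ k) (τ (k + 0))) = 0 := by
        ext ω
        rw [stepCost_comp_evalPair]
        simp
      rw [this]
      simp
    | succ i ih =>
      intro hi
      have h1 := ih (by omega)
      have h2 := hΛ (k + i) (by omega) q hq 0 h𝒟.zero_mem
      have h3 : (stepCost q.1 0 0).comp (evalPair (τ k) (τ (k + (i + 1)))) ≤
          (stepCost q.1 0 0).comp (evalPair (τ k) (τ (k + i))) +
          (stepCost q.1 0 h).comp (evalPair (τ (k + i)) (τ (k + i + 1))) := by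
        refine ContinuousMap.le_def.2 fun ω => ?_
        simp only [stepCost_comp_evalPair, ContinuousMap.add_apply, ContinuousMap.zero_apply,
          mul_zero, sub_zero]
        rw [add_comm |_|]
        exact abs_sub_le _ _ _
      have h4 := hmono _ _ h3
      rw [map_add] at h4
      rw [setIntegral_occupationMeasure_add (h𝒟.integrable q hq).abs (hst i) (hst' i)]
      have h5 : stepError T κ q 0 ((k + i : ℕ) * h) ((k + i + 1 : ℕ) * h) =
          ∫ z in Set.Ioc ((k + i : ℕ) * h) ((k + (i + 1) : ℕ) * h) ×ˢ Set.univ, |q.2 z|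
            ∂(occupationMeasure T κ) := by
        simp [stepError, add_assoc]
      rw [← h5]
      exact h4.trans (add_le_add h1 h2)
  have hmain : ∀ i : ℕ, k + i ≤ N →
      Λ ((stepCost p.1 q.1 (i * h)).comp (evalPair (τ k) (τ (k + i)))) ≤
        ∫ z in Set.Ioc (k * h) ((k + i : ℕ) * h) ×ˢ Set.univ, |p.2 z - q.1 z.2|
          ∂(occupationMeasure T κ) +
        (i + 1) * h * ∫ z in Set.Ioc (k * h) ((k + i : ℕ) * h) ×ˢ Set.univ, |q.2 z|
          ∂(occupationMeasure T κ) := by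
    intro i
    induction i with
    | zero =>
      intro _
      have : (stepCost p.1 q.1 ((0 : ℕ) * h)).comp (evalPair (τ k) (τ (k + 0))) = 0 := by
        ext ω
        rw [stepCost_comp_evalPair]
        simp
      rw [this]
      simp
    | succ i ih =>
      intro hi
      have h1 := ih (by omega)
      have h0 := hzero i (by omega)
      have h2 := hΛ (k + i) (by omega) p hp q hq
      have h3 : (stepCost p.1 q.1 ((i + 1 : ℕ) * h)).comp (evalPair (τ k) (τ (k + (i + 1)))) ≤
          (stepCost p.1 q.1 (i * h)).comp (evalPair (τ k) (τ (k + i))) +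
          ((stepCost p.1 q.1 h).comp (evalPair (τ (k + i)) (τ (k + i + 1))) +
          h • (stepCost q.1 0 0).comp (evalPair (τ k) (τ (k + i)))) := by
        refine ContinuousMap.le_def.2 fun ω => ?_
        simp only [stepCost_comp_evalPair, ContinuousMap.add_apply, ContinuousMap.smul_apply,
          smul_eq_mul, ContinuousMap.zero_apply, mul_zero, sub_zero, ← add_assoc]
        rw [← abs_of_nonneg hh, ← abs_mul, abs_of_nonneg hh]
        refine le_trans (le_of_eq ?_) (abs_add_three _ _ _)
        push_cast
        ring_nf
      have h4 := hmono _ _ h3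
      rw [map_add, map_add, map_smul, smul_eq_mul] at h4
      have hPadd := setIntegral_occupationMeasure_add (hint p hp q.1) (hst i) (hst' i)
      have hQadd := setIntegral_occupationMeasure_add (h𝒟.integrable q hq).abs (hst i) (hst' i)
      have h5 : stepError T κ p q ((k + i : ℕ) * h) ((k + i + 1 : ℕ) * h) =
          ∫ z in Set.Ioc ((k + i : ℕ) * h) ((k + (i + 1) : ℕ) * h) ×ˢ Set.univ,
            |p.2 z - q.1 z.2| ∂(occupationMeasure T κ) +
          h * ∫ z in Set.Ioc ((k + i : ℕ) * h) ((k + (i + 1) : ℕ) * h) ×ˢ Set.univ, |q.2 z|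
            ∂(occupationMeasure T κ) := by
        rw [stepError, integral_add (hint p hp q.1).integrableOn
          ((h𝒟.integrable q hq).abs.const_mul _).integrableOn, integral_const_mul, add_assoc]
        congr 2
        push_cast
        ring
      have h6 : 0 ≤ ∫ z in Set.Ioc ((k + i : ℕ) * h) ((k + (i + 1) : ℕ) * h) ×ˢ Set.univ,
          |q.2 z| ∂(occupationMeasure T κ) := integral_nonneg fun _ => abs_nonneg _
      have h7 := mul_le_mul_of_nonneg_left h0 hh
      have h8 := mul_nonneg (mul_nonneg (by positivity : (0 : ℝ) ≤ (i : ℝ) + 1) hh) h6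
      rw [hPadd, hQadd]
      rw [h5] at h2
      push_cast at *
      nlinarith
  refine (hmain j hkj).trans ?_
  rw [coarseError]
  have h6 : 0 ≤ ∫ z in Set.Ioc (k * h) ((k + j : ℕ) * h) ×ˢ Set.univ,
    |q.2 z| ∂(occupationMeasure T κ) := integral_nonneg fun _ => abs_nonneg _
  have h7 : ((j : ℝ) + 1) * h ≤ 2 * (((k + j : ℕ) : ℝ) * h - k * h) := by
    have : (1 : ℝ) ≤ j := by exact_mod_cast hj
    push_cast
    nlinarith
  have := mul_le_mul_of_nonneg_right h7 h6
  linarith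

/-- Existence of a path measure on `X^ℚ` (time in units of `T`). -/
theorem exists_path_measure (h𝒟 : IsTestFamily T κ 𝒟) [T2Space X] [Nonempty X] (hT : 0 < T) :
    ∃ η : Measure (ℚ → X), IsProbabilityMeasure η ∧
      (∀ p k : ℕ, k ≤ 2 ^ p → ∀ f : C(X, ℝ),
        ∫ ω, f (ω (k / 2 ^ p)) ∂η = ∫ x, f x ∂(κ (k * (T / 2 ^ p)))) ∧
      ∀ p k : ℕ, k < 2 ^ p → ∀ P ∈ 𝒟, ∀ Q ∈ 𝒟,
        ∫ ω, stepCost P.1 Q.1 (T / 2 ^ p) (ω (k / 2 ^ p), ω ((k + 1 : ℕ) / 2 ^ p)) ∂η ≤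
          coarseError T κ P Q (k * (T / 2 ^ p)) ((k + 1 : ℕ) * (T / 2 ^ p)) := by
  have hstage : ∀ p : ℕ, ∃ Λ : C(ℚ → X, ℝ) →ₗ[ℝ] ℝ, (∀ F, 0 ≤ F → 0 ≤ Λ F) ∧ Λ 1 = 1 ∧
      (∀ k : ℕ, k ≤ 2 ^ p → ∀ f : C(X, ℝ), Λ (f.comp (evalMap ((k : ℚ) / 2 ^ p))) =
        ∫ x, f x ∂(κ (k * (T / 2 ^ p)))) ∧
      ∀ P ∈ 𝒟, ∀ Q ∈ 𝒟, ∀ k j : ℕ, 1 ≤ j → k + j ≤ 2 ^ p →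
        Λ ((stepCost P.1 Q.1 (j * (T / 2 ^ p))).comp
          (evalPair ((k : ℚ) / 2 ^ p) ((k + j : ℕ) / 2 ^ p))) ≤
          coarseError T κ P Q (k * (T / 2 ^ p)) ((k + j : ℕ) * (T / 2 ^ p)) := by
    intro p
    obtain ⟨Λ, h1, h2, h3, h4⟩ := h𝒟.exists_grid_functional
      (τ := fun k : ℕ => (k : ℚ) / 2 ^ p) (N := 2 ^ p) (t := fun k : ℕ => k * (T / 2 ^ p))
      (fun a b hab => by
        have : (a : ℚ) = b := by
          have h0 : (2 : ℚ) ^ p ≠ 0 := by positivity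
          simpa [div_left_inj' h0] using hab
        exact_mod_cast this)
      (fun a b hab => by
        have : (a : ℝ) ≤ b := by exact_mod_cast hab
        simp only
        gcongr)
      (by simp) (by push_cast; rw [mul_div_cancel₀]; positivity)
    refine ⟨Λ, h1, h2, h3, fun P hP Q hQ k j hj hkj => ?_⟩
    refine h𝒟.functional_coarse_le (τ := fun k : ℕ => (k : ℚ) / 2 ^ p) (N := 2 ^ p)
      (by positivity) h1 (fun k hk P hP Q hQ => ?_) hP hQ hj hkj
    have := h4 k hk P hP Q hQ
    have e : ((k + 1 : ℕ) : ℝ) * (T / 2 ^ p) - k * (T / 2 ^ p) = T / 2 ^ p := by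
      push_cast
      ring
    simp only [e] at this
    exact this
  choose Λ h1 h2 h3 h4 using hstage
  obtain ⟨η, hη, hle⟩ := exists_probabilityMeasure_of_eventually_le Λ h1 h2
  have hq : ∀ k p i : ℕ, ((k * 2 ^ i : ℕ) : ℚ) / 2 ^ (p + i) = k / 2 ^ p := fun k p i => by
    push_cast
    rw [pow_add, mul_div_mul_right _ _ (by positivity)]
  have hr : ∀ k p i : ℕ, ((k * 2 ^ i : ℕ) : ℝ) * (T / 2 ^ (p + i)) = k * (T / 2 ^ p) :=
    fun k p i => by
      push_cast
      rw [pow_add]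
      field_simp
  refine ⟨η, hη, fun p k hk f => ?_, fun p k hk P hP Q hQ => ?_⟩
  · have key : ∀ f : C(X, ℝ), ∀ n ≥ p, Λ n (f.comp (evalMap ((k : ℚ) / 2 ^ p))) =
        ∫ x, f x ∂(κ (k * (T / 2 ^ p))) := by
      intro f n hn
      obtain ⟨i, rfl⟩ := Nat.exists_eq_add_of_le hn
      have := h3 (p + i) (k * 2 ^ i) (by rw [pow_add]; gcongr) f
      rwa [hq, hr] at this
    have a1 := hle (f.comp (evalMap ((k : ℚ) / 2 ^ p))) _
      (eventually_atTop.2 ⟨p, fun n hn => (key f n hn).le⟩)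
    have a2 := hle ((-f).comp (evalMap ((k : ℚ) / 2 ^ p))) _
      (eventually_atTop.2 ⟨p, fun n hn => (key (-f) n hn).le⟩)
    simp only [ContinuousMap.comp_apply, ContinuousMap.neg_apply, integral_neg] at a1 a2
    exact le_antisymm a1 (by linarith!)
  · refine hle ((stepCost P.1 Q.1 (T / 2 ^ p)).comp
      (evalPair ((k : ℚ) / 2 ^ p) ((k + 1 : ℕ) / 2 ^ p))) _
      (eventually_atTop.2 ⟨p, fun n hn => ?_⟩)
    obtain ⟨i, rfl⟩ := Nat.exists_eq_add_of_le hn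
    have := h4 (p + i) P hP Q hQ (k * 2 ^ i) (2 ^ i) Nat.one_le_two_pow (by
      rw [← Nat.succ_mul, pow_add]
      gcongr
      omega)
    have e : k * 2 ^ i + 2 ^ i = (k + 1) * 2 ^ i := by ring
    have e' : ((2 ^ i : ℕ) : ℝ) * (T / 2 ^ (p + i)) = T / 2 ^ p := by
      have := hr 1 p i
      simpa using this
    rwa [e, hq, hr, hq, hr, e'] at this

end IsTestFamily
end Abstract

/-- The index `k` of the dyadic cell `(k T / 2^p, (k + 1) T / 2^p]` containing `r > 0`. -/
def dyadicCell (T : ℝ) (p : ℕ) (r : ℝ) : ℕ := ⌈r / (T / 2 ^ p)⌉₊ - 1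

section DyadicCell

variable {T : ℝ} {p : ℕ} {r : ℝ}

theorem dyadicCell_eq (hT : 0 < T) {k : ℕ}
    (hr : r ∈ Set.Ioc (k * (T / 2 ^ p)) ((k + 1 : ℕ) * (T / 2 ^ p))) : dyadicCell T p r = k := by
  have h : ⌈r / (T / 2 ^ p)⌉₊ = k + 1 := by
    rw [Nat.ceil_eq_iff (by omega), lt_div_iff₀ (by positivity), div_le_iff₀ (by positivity)]
    simpa using hr
  simp [dyadicCell, h]

theorem mem_dyadicCell (hT : 0 < T) (hr : 0 < r) :
    r ∈ Set.Ioc (dyadicCell T p r * (T / 2 ^ p)) ((dyadicCell T p r + 1 : ℕ) * (T / 2 ^ p)) := by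
  have h0 : 0 < ⌈r / (T / 2 ^ p)⌉₊ := Nat.ceil_pos.2 (by positivity)
  have h1 := (Nat.ceil_eq_iff h0.ne').1 rfl
  rw [lt_div_iff₀ (by positivity), div_le_iff₀ (by positivity)] at h1
  rw [dyadicCell, Nat.sub_add_cancel h0]
  exact h1

theorem dyadicCell_zero : dyadicCell T p 0 = 0 := by simp [dyadicCell]

theorem dyadicCell_lt (hT : 0 < T) (hr : r ≤ T) : dyadicCell T p r < 2 ^ p := by
  have h : ⌈r / (T / 2 ^ p)⌉₊ ≤ 2 ^ p := by
    rw [Nat.ceil_le, div_le_iff₀ (by positivity)]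
    push_cast
    rw [mul_div_cancel₀ _ (by positivity)]
    exact hr
  have : 0 < 2 ^ p := by positivity
  rw [dyadicCell]
  omega

theorem measurable_dyadicCell : Measurable (dyadicCell T p) :=
  (measurable_of_countable (fun n : ℕ => n - 1)).comp
    (Nat.measurable_ceil.comp (measurable_id.div_const _))

theorem dyadicCell_div (hT : 0 < T) (hr : 0 < r) {q : ℕ} (hq : q ≤ p) :
    dyadicCell T p r / 2 ^ (p - q) = dyadicCell T q r := by
  symm
  obtain ⟨i, rfl⟩ := Nat.exists_eq_add_of_le hq
  have h := mem_dyadicCell (p := q + i) hT hr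
  set k := dyadicCell T (q + i) r
  have e : T / 2 ^ q = 2 ^ i * (T / 2 ^ (q + i)) := by
    rw [pow_add]
    field_simp
  have hp : 0 < T / 2 ^ (q + i) := by positivity
  apply dyadicCell_eq hT
  simp only [add_tsub_cancel_left, e, ← mul_assoc]
  constructor
  · refine lt_of_le_of_lt ?_ h.1
    gcongr
    exact_mod_cast Nat.div_mul_le_self k (2 ^ i)
  · refine h.2.trans ?_
    gcongr
    have := Nat.lt_div_mul_add (a := k) (b := 2 ^ i) (by positivity)
    have h2 : k + 1 ≤ (k / 2 ^ i + 1) * 2 ^ i := by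
      rw [add_mul, one_mul]
      omega
    exact_mod_cast h2

theorem abs_dyadicCell_mul_sub_le (hT : 0 < T) (hr : 0 ≤ r) :
    |dyadicCell T p r * (T / 2 ^ p) - r| ≤ T / 2 ^ p := by
  rcases hr.eq_or_lt with rfl | hr
  · rw [dyadicCell_zero]
    simp
    positivity
  · have h := mem_dyadicCell (p := p) hT hr
    push_cast at h
    rw [abs_le]
    constructor <;> nlinarith [h.1, h.2]

theorem tendsto_div_two_pow (T : ℝ) : Tendsto (fun p : ℕ => T / 2 ^ p) atTop (𝓝 0) := by
  have := (tendsto_pow_atTop_nhds_zero_of_lt_one (r := (1 / 2 : ℝ)) (by norm_num)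
    (by norm_num)).const_mul T
  simpa [div_eq_mul_inv] using this

theorem tendsto_dyadicCell_mul (hT : 0 < T) (hr : 0 ≤ r) :
    Tendsto (fun p => dyadicCell T p r * (T / 2 ^ p)) atTop (𝓝 r) := by
  rw [tendsto_iff_dist_tendsto_zero]
  exact squeeze_zero (fun _ => dist_nonneg) (fun p => abs_dyadicCell_mul_sub_le hT hr)
    (tendsto_div_two_pow T)

end DyadicCell

section Abstract
set_option linter.unusedSectionVars false

variable {X : Type} [TopologicalSpace X]

/-- The left-point discretisation at level `p` of a path on the dyadics. -/
def gridPath (T : ℝ) (p : ℕ) (r : ℝ) (ω : ℚ → X) : X := ω (dyadicCell T p r / 2 ^ p)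

/-- The step function in time with values `c k` on the `k`-th cell of level `p₀`. -/
def stepFun (T : ℝ) (p₀ : ℕ) (c : ℕ → C(X, ℝ)) (z : ℝ × X) : ℝ := c (dyadicCell T p₀ z.1) z.2

/-- The total deviation at level `p` of the increments of `x` along `ω` from those of the integral
of the step function given by `c`. -/
def pathDeviation (T : ℝ) (p₀ : ℕ) (c : ℕ → C(X, ℝ)) (x : C(X, ℝ)) (p : ℕ) (ω : ℚ → X) : ℝ :=
  ∑ k ∈ Finset.range (2 ^ p), stepCost x (c (k / 2 ^ (p - p₀))) (T / 2 ^ p)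
    (ω (k / 2 ^ p), ω ((k + 1 : ℕ) / 2 ^ p))

variable {T : ℝ} {p₀ : ℕ} {c : ℕ → C(X, ℝ)} {x : C(X, ℝ)} {p : ℕ} {ω : ℚ → X}

theorem abs_increment_sub_sum_le {k l : ℕ} (hkl : k ≤ l) (hl : l ≤ 2 ^ p) :
    |x (ω (l / 2 ^ p)) - x (ω (k / 2 ^ p)) -
      ∑ j ∈ Finset.Ico k l, T / 2 ^ p * c (j / 2 ^ (p - p₀)) (ω (j / 2 ^ p))| ≤
      pathDeviation T p₀ c x p ω := by
  rw [← Finset.sum_Ico_sub (fun j : ℕ => x (ω (j / 2 ^ p))) hkl, ← Finset.sum_sub_distrib]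
  refine (Finset.abs_sum_le_sum_abs _ _).trans ?_
  refine Finset.sum_le_sum_of_subset_of_nonneg (fun j hj => ?_) fun j _ _ => abs_nonneg _
  simp only [Finset.mem_Ico] at hj
  exact Finset.mem_range.2 (by omega)

theorem sum_stepFun_eq_integral (hT : 0 < T) (hp : p₀ ≤ p) (n : ℕ) :
    ∑ j ∈ Finset.range n, T / 2 ^ p * c (j / 2 ^ (p - p₀)) (ω (j / 2 ^ p)) =
      ∫ r in (0 : ℝ)..n * (T / 2 ^ p), stepFun T p₀ c (r, gridPath T p r ω) := by
  have hh : 0 < T / 2 ^ p := by positivity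
  have key : ∀ j : ℕ, ∀ r ∈ Set.uIoc (j * (T / 2 ^ p)) ((j + 1 : ℕ) * (T / 2 ^ p)),
      c (j / 2 ^ (p - p₀)) (ω (j / 2 ^ p)) = stepFun T p₀ c (r, gridPath T p r ω) := by
    intro j r hr
    rw [Set.uIoc_of_le (by push_cast; nlinarith)] at hr
    have hj := dyadicCell_eq hT hr
    have hr0 : 0 < r := lt_of_le_of_lt (by positivity) hr.1
    simp only [stepFun, gridPath, hj]
    rw [← dyadicCell_div hT hr0 hp, hj]
  have := intervalIntegral.sum_integral_adjacent_intervals (n := n) (μ := volume)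
    (a := fun j : ℕ => j * (T / 2 ^ p)) (f := fun r => stepFun T p₀ c (r, gridPath T p r ω))
    (fun j _ => (intervalIntegrable_const (c := c (j / 2 ^ (p - p₀)) (ω (j / 2 ^ p)))).congr
      (fun r hr => key j r hr))
  simp only [Nat.cast_zero, zero_mul] at this
  rw [← this]
  refine Finset.sum_congr rfl fun j _ => ?_
  rw [← intervalIntegral.integral_congr_ae (Eventually.of_forall fun r hr => key j r hr),
    intervalIntegral.integral_const, smul_eq_mul]
  push_cast
  ring

variable [CompactSpace X]

theorem abs_increment_le (hT : 0 < T) {C : ℝ} (hC : ∀ k, ‖c k‖ ≤ C) {W : ℝ}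
    (hW : ∃ᶠ p in atTop, pathDeviation T p₀ c x p ω ≤ W) {p q k l : ℕ} (hk : k ≤ 2 ^ p)
    (hl : l ≤ 2 ^ q) :
    |x (ω (l / 2 ^ q)) - x (ω (k / 2 ^ p))| ≤
      W + C * |l * (T / 2 ^ q) - k * (T / 2 ^ p)| := by
  have main : ∀ n k l : ℕ, k ≤ l → l ≤ 2 ^ n → pathDeviation T p₀ c x n ω ≤ W →
      |x (ω (l / 2 ^ n)) - x (ω (k / 2 ^ n))| ≤ W + C * |l * (T / 2 ^ n) - k * (T / 2 ^ n)| := by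
    intro n k l hkl hl hn
    have h1 := (abs_increment_sub_sum_le (T := T) (p₀ := p₀) (c := c) (x := x) (ω := ω)
      hkl hl).trans hn
    have h2 : |∑ j ∈ Finset.Ico k l, T / 2 ^ n * c (j / 2 ^ (n - p₀)) (ω (j / 2 ^ n))| ≤
        C * |l * (T / 2 ^ n) - k * (T / 2 ^ n)| := by
      refine (Finset.abs_sum_le_sum_abs _ _).trans ?_
      have h3 : ∀ j ∈ Finset.Ico k l,
          |T / 2 ^ n * c (j / 2 ^ (n - p₀)) (ω (j / 2 ^ n))| ≤ T / 2 ^ n * C := fun j _ => by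
        rw [abs_mul, abs_of_pos (by positivity)]
        gcongr
        exact ((c _).norm_coe_le_norm _).trans (hC _)
      refine (Finset.sum_le_card_nsmul _ _ _ h3).trans (le_of_eq ?_)
      rw [← sub_mul, abs_mul, abs_of_pos (by positivity : 0 < T / 2 ^ n), Nat.card_Ico,
        nsmul_eq_mul, Nat.cast_sub hkl, abs_of_nonneg (by simpa using hkl)]
      ring
    set S := ∑ j ∈ Finset.Ico k l, T / 2 ^ n * c (j / 2 ^ (n - p₀)) (ω (j / 2 ^ n))
    have := abs_add_le (x (ω (l / 2 ^ n)) - x (ω (k / 2 ^ n)) - S) S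
    rw [sub_add_cancel] at this
    linarith
  obtain ⟨n, hn, hW⟩ := (frequently_atTop.1 hW) (max p q)
  obtain ⟨i, rfl⟩ := Nat.exists_eq_add_of_le ((le_max_left p q).trans hn)
  obtain ⟨j, hj⟩ := Nat.exists_eq_add_of_le ((le_max_right p q).trans hn)
  have hq : ∀ k p i : ℕ, (k : ℚ) / 2 ^ p = ((k * 2 ^ i : ℕ) : ℚ) / 2 ^ (p + i) := fun k p i => by
    push_cast
    rw [pow_add, mul_div_mul_right _ _ (by positivity)]
  have hr : ∀ k p i : ℕ, (k : ℝ) * (T / 2 ^ p) = ((k * 2 ^ i : ℕ) : ℝ) * (T / 2 ^ (p + i)) :=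
    fun k p i => by
      push_cast
      rw [pow_add]
      field_simp
  rw [hq k p i, hq l q j, hr k p i, hr l q j, ← hj]
  have hk' : k * 2 ^ i ≤ 2 ^ (p + i) := by rw [pow_add]; gcongr
  have hl' : l * 2 ^ j ≤ 2 ^ (p + i) := by rw [hj, pow_add]; gcongr
  rcases le_total (k * 2 ^ i) (l * 2 ^ j) with h | h
  · exact main _ _ _ h hl' hW
  · rw [abs_sub_comm, abs_sub_comm (((l * 2 ^ j : ℕ) : ℝ) * _)]
    exact main _ _ _ h hk' hW

theorem norm_stepFun_le {C : ℝ} (hC : ∀ k, ‖c k‖ ≤ C) (z : ℝ × X) : ‖stepFun T p₀ c z‖ ≤ C :=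
  ((c _).norm_coe_le_norm _).trans (hC _)

theorem measurable_stepFun [MeasurableSpace X] [BorelSpace X] : Measurable (stepFun T p₀ c) := by
  have : Measurable fun z : ℕ × X => c z.1 z.2 :=
    measurable_from_prod_countable_right fun k => (c k).continuous.measurable
  exact this.comp ((measurable_dyadicCell.comp measurable_fst).prodMk measurable_snd)

theorem measurable_gridPath [MeasurableSpace X] :
    Measurable fun z : ℝ × (ℚ → X) => gridPath T p z.1 z.2 := by
  have : Measurable fun z : ℕ × (ℚ → X) => z.2 (z.1 / 2 ^ p) :=
    measurable_from_prod_countable_right fun k => measurable_pi_apply ((k : ℚ) / 2 ^ p)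
  exact this.comp ((measurable_dyadicCell.comp measurable_fst).prodMk measurable_snd)

theorem cauchySeq_gridPath (hT : 0 < T)
    (h : ∀ ε : ℝ, 0 < ε → ∃ p₀ C, ∃ c : ℕ → C(X, ℝ), (∀ k, ‖c k‖ ≤ C) ∧
      ∃ᶠ p in atTop, pathDeviation T p₀ c x p ω ≤ ε) {r : ℝ} (hr : r ∈ Set.Icc 0 T) :
    CauchySeq fun p => x (gridPath T p r ω) := by
  rw [Metric.cauchySeq_iff]
  intro ε hε
  obtain ⟨p₀, C, c, hC, hW⟩ := h (ε / 2) (by positivity)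
  have hC0 : 0 ≤ C := (norm_nonneg _).trans (hC 0)
  obtain ⟨N, hN⟩ := Metric.cauchySeq_iff.1 (tendsto_dyadicCell_mul hT hr.1).cauchySeq
    (ε / (2 * (C + 1))) (by positivity)
  refine ⟨N, fun m hm n hn => ?_⟩
  have h1 := abs_increment_le hT hC hW (dyadicCell_lt (p := n) hT hr.2).le
    (dyadicCell_lt (p := m) hT hr.2).le
  refine lt_of_le_of_lt h1 ?_
  have h2 := hN m hm n hn
  rw [Real.dist_eq, lt_div_iff₀ (by positivity)] at h2
  nlinarith [abs_nonneg (dyadicCell T m r * (T / 2 ^ m) - dyadicCell T n r * (T / 2 ^ n))]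

/-- Passage to the limit in the discretised integral equation. -/
theorem abs_limit_sub_integral_le [MeasurableSpace X] [BorelSpace X] [SecondCountableTopology X]
    (hT : 0 < T) {C : ℝ}
    (hC : ∀ k, ‖c k‖ ≤ C) {W : ℝ} (hW : ∃ᶠ p in atTop, pathDeviation T p₀ c x p ω ≤ W)
    {γ : ℝ → X} (hγ : ∀ r ∈ Set.Icc 0 T, Tendsto (fun p => gridPath T p r ω) atTop (𝓝 (γ r)))
    {t : ℝ} (ht : t ∈ Set.Icc 0 T) :
    |x (γ t) - x (γ 0) - ∫ r in (0 : ℝ)..t, stepFun T p₀ c (r, γ r)| ≤ W := by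
  have hC0 : 0 ≤ C := (norm_nonneg _).trans (hC 0)
  have hmeas : ∀ p, Measurable fun r => stepFun T p₀ c (r, gridPath T p r ω) := fun p =>
    measurable_stepFun.comp (measurable_id.prodMk
      (measurable_gridPath.comp (measurable_id.prodMk measurable_const)))
  have hint : ∀ p a b, IntervalIntegrable (fun r => stepFun T p₀ c (r, gridPath T p r ω))
      volume a b := fun p a b =>
    (intervalIntegrable_const (c := C)).mono_fun (hmeas p).aestronglyMeasurable
      (Eventually.of_forall fun r => (norm_stepFun_le hC _).trans (le_abs_self C))
  have h1 : Tendsto (fun p => ∫ r in (0 : ℝ)..t, stepFun T p₀ c (r, gridPath T p r ω)) atTop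
      (𝓝 (∫ r in (0 : ℝ)..t, stepFun T p₀ c (r, γ r))) := by
    refine intervalIntegral.tendsto_integral_filter_of_dominated_convergence (fun _ => C)
      (Eventually.of_forall fun p => (hmeas p).aestronglyMeasurable)
      (Eventually.of_forall fun p => Eventually.of_forall fun r _ => norm_stepFun_le hC _)
      intervalIntegrable_const (Eventually.of_forall fun r hr => ?_)
    rw [Set.uIoc_of_le ht.1] at hr
    exact ((c _).continuous.tendsto _).comp (hγ r ⟨hr.1.le, hr.2.trans ht.2⟩)
  have h2 : Tendsto (fun p => ∫ r in (0 : ℝ)..dyadicCell T p t * (T / 2 ^ p),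
      stepFun T p₀ c (r, gridPath T p r ω)) atTop
      (𝓝 (∫ r in (0 : ℝ)..t, stepFun T p₀ c (r, γ r))) := by
    have h3 : Tendsto (fun p => ∫ r in t..dyadicCell T p t * (T / 2 ^ p),
        stepFun T p₀ c (r, gridPath T p r ω)) atTop (𝓝 0) := by
      refine squeeze_zero_norm (a := fun p => C * (T / 2 ^ p)) (fun p => ?_) ?_
      · refine (intervalIntegral.norm_integral_le_of_norm_le_const
          fun r _ => norm_stepFun_le hC _).trans ?_
        gcongr
        exact abs_dyadicCell_mul_sub_le hT ht.1
      · simpa using (tendsto_div_two_pow T).const_mul C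
    have h4 := h1.add h3
    rw [add_zero] at h4
    refine h4.congr fun p => ?_
    exact intervalIntegral.integral_add_adjacent_intervals (hint p _ _) (hint p _ _)
  have h5 : Tendsto (fun p => |x (gridPath T p t ω) - x (gridPath T p 0 ω) -
      ∫ r in (0 : ℝ)..dyadicCell T p t * (T / 2 ^ p), stepFun T p₀ c (r, gridPath T p r ω)|) atTop
      (𝓝 |x (γ t) - x (γ 0) - ∫ r in (0 : ℝ)..t, stepFun T p₀ c (r, γ r)|) :=
    ((((x.continuous.tendsto _).comp (hγ t ht)).sub
      ((x.continuous.tendsto _).comp (hγ 0 ⟨le_rfl, hT.le⟩))).sub h2).abs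
  refine le_of_tendsto_of_frequently h5
    ((hW.and_eventually (eventually_ge_atTop p₀)).mono fun p hp => ?_)
  rw [← sum_stepFun_eq_integral hT hp.2, Finset.range_eq_Ico]
  have := (abs_increment_sub_sum_le (T := T) (p₀ := p₀) (c := c) (x := x) (ω := ω)
    (Nat.zero_le _) (dyadicCell_lt (p := p) hT ht.2).le).trans hp.1
  simpa [gridPath, dyadicCell_zero] using this

end Abstract

section Abstract
set_option linter.unusedSectionVars false

theorem exists_tendsto_of_cauchySeq {X : Type} [TopologicalSpace X] [CompactSpace X]
    {x : ℕ → C(X, ℝ)} (hx : ∀ a b, (∀ i, x i a = x i b) → a = b) {u : ℕ → X}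
    (h : ∀ i, CauchySeq fun n => x i (u n)) : ∃ a, Tendsto u atTop (𝓝 a) := by
  choose l hl using fun i => cauchySeq_tendsto_of_complete (h i)
  have hclus : ∀ a, ClusterPt a (map u atTop) → ∀ i, x i a = l i := by
    intro a ha i
    have h1 : ClusterPt (x i a) (map (fun n => x i (u n)) atTop) := by
      rw [← Function.comp_def, ← Filter.map_map]
      exact ha.map (x i).continuous.continuousAt tendsto_map
    exact eq_of_nhds_neBot (h1.mono (hl i))
  obtain ⟨a, -, ha⟩ := isCompact_univ (X := X) (f := map u atTop) (by simp)
  refine ⟨a, isCompact_univ.le_nhds_of_unique_clusterPt (by simp) fun b _ hb => ?_⟩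
  exact hx _ _ fun i => (hclus b hb i).trans (hclus a ha i).symm

variable {X : Type} [TopologicalSpace X] [CompactSpace X] [SecondCountableTopology X]
  [MeasurableSpace X] [BorelSpace X]
  {T : ℝ} {κ : ProbabilityTheory.Kernel ℝ X} [ProbabilityTheory.IsMarkovKernel κ]
variable {𝒟 : Set (C(X, ℝ) × (ℝ × X → ℝ))}

theorem ae_occupationMeasure_mem : ∀ᵐ z ∂(occupationMeasure T κ), z.1 ∈ Set.Ioc 0 T := by
  refine Measure.ae_compProd_of_ae_ae (measurableSet_Ioc.preimage measurable_fst) ?_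
  filter_upwards [ae_restrict_mem measurableSet_Ioc] with r hr
  exact Eventually.of_forall fun _ => hr

theorem sum_setIntegral_occupationMeasure {f : ℝ × X → ℝ}
    (hf : Integrable f (occupationMeasure T κ)) {h : ℝ} (hh : 0 ≤ h) (n : ℕ) :
    ∑ k ∈ Finset.range n,
      ∫ z in Set.Ioc (k * h) ((k + 1 : ℕ) * h) ×ˢ Set.univ, f z ∂(occupationMeasure T κ) =
    ∫ z in Set.Ioc 0 (n * h) ×ˢ Set.univ, f z ∂(occupationMeasure T κ) := by
  induction n with
  | zero => simp
  | succ n ih =>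
    rw [Finset.sum_range_succ, ih, ← setIntegral_occupationMeasure_add hf (by positivity)]
    push_cast
    nlinarith

namespace IsTestFamily

theorem exists_mem_norm_sub_lt (h𝒟 : IsTestFamily T κ 𝒟)
    (hsep : ∀ a b : X, a ≠ b → ∃ P ∈ 𝒟, P.1 a ≠ P.1 b) (f : C(X, ℝ)) {ε : ℝ} (hε : 0 < ε) :
    ∃ P ∈ 𝒟, ‖P.1 - f‖ < ε := by
  let S : Subalgebra ℝ C(X, ℝ) :=
    { carrier := {F | ∃ P ∈ 𝒟, P.1 = F}
      mul_mem' := by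
        rintro _ _ ⟨P, hP, rfl⟩ ⟨Q, hQ, rfl⟩
        obtain ⟨R, hR, h1, -⟩ := h𝒟.comp Bool (fun i => if i then P else Q)
          (by intro i; cases i <;> simpa) (fun v => v true * v false)
          (ContDiff.mul (contDiff_apply ℝ ℝ true) (contDiff_apply ℝ ℝ false))
        exact ⟨R, hR, by ext x; simp [h1]⟩
      add_mem' := by
        rintro _ _ ⟨P, hP, rfl⟩ ⟨Q, hQ, rfl⟩
        exact ⟨_, h𝒟.add_smul_mem hP hQ 1, by simp⟩
      algebraMap_mem' := by
        intro r
        obtain ⟨R, hR, h1, -⟩ := h𝒟.comp Empty (fun i => i.elim) (by simp) (fun _ => r)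
          contDiff_const
        exact ⟨R, hR, by ext x; simp [h1]⟩ }
  obtain ⟨F, hF⟩ := ContinuousMap.exists_mem_subalgebra_near_continuousMap_of_separatesPoints S
    (by
      intro a b hab
      obtain ⟨P, hP, h⟩ := hsep a b hab
      exact ⟨_, ⟨P.1, ⟨P, hP, rfl⟩, rfl⟩, h⟩) f ε hε
  obtain ⟨P, hP, h⟩ := F.2
  exact ⟨P, hP, by rwa [h]⟩

/-- Integrable functions of time and space are approximated by step functions with values in a
separating test family. -/
theorem exists_stepFun_approx (h𝒟 : IsTestFamily T κ 𝒟) [T2Space X] (hT : 0 < T)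
    (hsep : ∀ a b : X, a ≠ b → ∃ P ∈ 𝒟, P.1 a ≠ P.1 b) {B : ℝ × X → ℝ}
    (hB : Integrable B (occupationMeasure T κ)) {ε : ℝ} (hε : 0 < ε) :
    ∃ p₀ : ℕ, ∃ c : ℕ → C(X, ℝ) × (ℝ × X → ℝ), (∀ k, c k ∈ 𝒟) ∧ (∀ k, 2 ^ p₀ ≤ k → c k = 0) ∧
      ∫ z, |B z - stepFun T p₀ (fun k => (c k).1) z| ∂(occupationMeasure T κ) ≤ ε := by
  set ρ := occupationMeasure T κ
  obtain ⟨G, hG, hGint⟩ := hB.exists_boundedContinuous_integral_sub_le (ε := ε / 2) (by positivity)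
  set δ : ℝ := ε / (4 * (ρ.real Set.univ + 1)) with hδ
  have hρ : 0 ≤ ρ.real Set.univ := measureReal_nonneg
  have hδ0 : 0 < δ := by positivity
  let F : C(ℝ, C(X, ℝ)) := G.toContinuousMap.curry
  obtain ⟨η, hη, hF⟩ := Metric.uniformContinuousOn_iff.1
    ((isCompact_Icc (a := 0) (b := T)).uniformContinuousOn_of_continuous F.continuous.continuousOn)
    δ hδ0
  obtain ⟨p₀, hp₀⟩ := (((tendsto_div_two_pow T).eventually (gt_mem_nhds hη))).exists
  choose P hP hPF using fun k : ℕ => h𝒟.exists_mem_norm_sub_lt hsep (F (k * (T / 2 ^ p₀))) hδ0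
  let c : ℕ → C(X, ℝ) × (ℝ × X → ℝ) := fun k => if k < 2 ^ p₀ then P k else 0
  refine ⟨p₀, c, fun k => ?_, fun k hk => if_neg (not_lt.2 hk), ?_⟩
  · by_cases hk : k < 2 ^ p₀
    · simpa [c, hk] using hP k
    · simpa [c, hk] using h𝒟.zero_mem
  have hbound : ∀ᵐ z ∂ρ, |G z - stepFun T p₀ (fun k => (c k).1) z| ≤ 2 * δ := by
    filter_upwards [ae_occupationMeasure_mem] with z hz
    have hlt := dyadicCell_lt (p := p₀) hT hz.2
    have hmem := abs_dyadicCell_mul_sub_le (p := p₀) hT hz.1.le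
    have hcell := (mem_dyadicCell (p := p₀) hT hz.1).1
    set k := dyadicCell T p₀ z.1 with hk
    have h1 : dist (F z.1) (F (k * (T / 2 ^ p₀))) < δ := by
      refine hF _ ⟨hz.1.le, hz.2⟩ _ ⟨by positivity, hcell.le.trans hz.2⟩ ?_
      rw [dist_comm, Real.dist_eq]
      exact hmem.trans_lt hp₀
    have h2 : |F z.1 z.2 - F (k * (T / 2 ^ p₀)) z.2| ≤ δ := by
      rw [← Real.dist_eq]
      exact (ContinuousMap.dist_apply_le_dist z.2).trans h1.le
    have h3 : |(P k).1 z.2 - F (k * (T / 2 ^ p₀)) z.2| ≤ δ :=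
      (((P k).1 - F (k * (T / 2 ^ p₀))).norm_coe_le_norm z.2).trans (hPF k).le
    have h4 : stepFun T p₀ (fun k => (c k).1) z = (P k).1 z.2 := by
      simp only [stepFun, c, ← hk, if_pos hlt]
    have h5 : G z = F z.1 z.2 := rfl
    rw [h4, h5]
    rw [abs_le] at *
    constructor <;> linarith [h2.1, h2.2, h3.1, h3.2]
  have hstep : Integrable (stepFun T p₀ (fun k => (c k).1)) ρ := by
    refine Integrable.of_bound measurable_stepFun.aestronglyMeasurable (‖G‖ + 2 * δ) ?_
    filter_upwards [hbound] with z hz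
    have := G.norm_coe_le_norm z
    rw [Real.norm_eq_abs] at *
    rw [abs_le] at *
    constructor <;> linarith [hz.1, hz.2]
  have h1 : ∫ z, |G z - stepFun T p₀ (fun k => (c k).1) z| ∂ρ ≤ 2 * δ * ρ.real Set.univ := by
    have := integral_mono_ae (hGint.sub hstep).abs (integrable_const (2 * δ)) hbound
    rw [integral_const, smul_eq_mul, mul_comm] at this
    exact this
  have h2 : 2 * δ * ρ.real Set.univ ≤ ε / 2 := by
    have : δ * (4 * (ρ.real Set.univ + 1)) = ε := div_mul_cancel₀ _ (by positivity)
    nlinarith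
  calc ∫ z, |B z - stepFun T p₀ (fun k => (c k).1) z| ∂ρ
      ≤ ∫ z, (‖B z - G z‖ + |G z - stepFun T p₀ (fun k => (c k).1) z|) ∂ρ :=
        integral_mono (hB.sub hstep).abs ((hB.sub hGint).norm.add (hGint.sub hstep).abs)
          fun z => abs_sub_le _ _ _
    _ = ∫ z, ‖B z - G z‖ ∂ρ + ∫ z, |G z - stepFun T p₀ (fun k => (c k).1) z| ∂ρ :=
        integral_add (hB.sub hGint).norm (hGint.sub hstep).abs
    _ ≤ ε := by linarith

theorem sum_coarseError_le (h𝒟 : IsTestFamily T κ 𝒟) (hT : 0 < T) {P : C(X, ℝ) × (ℝ × X → ℝ)}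
    (hP : P ∈ 𝒟) {p₀ : ℕ} {c : ℕ → C(X, ℝ) × (ℝ × X → ℝ)} (hc : ∀ k, c k ∈ 𝒟)
    (hstep : Integrable (stepFun T p₀ (fun k => (c k).1)) (occupationMeasure T κ)) {p : ℕ}
    (hp : p₀ ≤ p) :
    ∑ k ∈ Finset.range (2 ^ p), coarseError T κ P (c (k / 2 ^ (p - p₀))) (k * (T / 2 ^ p))
        ((k + 1 : ℕ) * (T / 2 ^ p)) ≤
      ∫ z, |P.2 z - stepFun T p₀ (fun k => (c k).1) z| ∂(occupationMeasure T κ) +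
      T / 2 ^ p * (2 * ∑ m ∈ Finset.range (2 ^ p₀), ∫ z, |(c m).2 z| ∂(occupationMeasure T κ)) := by
  set ρ := occupationMeasure T κ
  have hh : 0 < T / 2 ^ p := by positivity
  have hPs : Integrable (fun z => |P.2 z - stepFun T p₀ (fun k => (c k).1) z|) ρ :=
    ((h𝒟.integrable P hP).sub hstep).abs
  have hβ : Integrable (fun z => ∑ m ∈ Finset.range (2 ^ p₀), |(c m).2 z|) ρ :=
    integrable_finsetSum _ fun m _ => (h𝒟.integrable _ (hc m)).abs
  have hle : ∀ k ∈ Finset.range (2 ^ p), coarseError T κ P (c (k / 2 ^ (p - p₀)))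
      (k * (T / 2 ^ p)) ((k + 1 : ℕ) * (T / 2 ^ p)) ≤
      ∫ z in Set.Ioc (k * (T / 2 ^ p)) ((k + 1 : ℕ) * (T / 2 ^ p)) ×ˢ Set.univ,
        |P.2 z - stepFun T p₀ (fun k => (c k).1) z| ∂ρ +
      2 * (T / 2 ^ p) * ∫ z in Set.Ioc (k * (T / 2 ^ p)) ((k + 1 : ℕ) * (T / 2 ^ p)) ×ˢ Set.univ,
        ∑ m ∈ Finset.range (2 ^ p₀), |(c m).2 z| ∂ρ := by
    intro k hk
    have e : ((k + 1 : ℕ) : ℝ) * (T / 2 ^ p) - k * (T / 2 ^ p) = T / 2 ^ p := by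
      push_cast
      ring
    rw [coarseError, e]
    refine add_le_add (le_of_eq ?_) (mul_le_mul_of_nonneg_left ?_ (by positivity))
    · refine setIntegral_congr_fun (measurableSet_Ioc.prod MeasurableSet.univ) fun z hz => ?_
      have h0 : 0 < z.1 := lt_of_le_of_lt (by positivity) hz.1.1
      simp only [stepFun, ← dyadicCell_div hT h0 hp, dyadicCell_eq hT hz.1]
    · refine setIntegral_mono_on (h𝒟.integrable _ (hc _)).abs.integrableOn hβ.integrableOn
        (measurableSet_Ioc.prod MeasurableSet.univ) fun z _ => ?_
      refine Finset.single_le_sum (f := fun m => |(c m).2 z|) (fun _ _ => abs_nonneg _)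
        (Finset.mem_range.2 ?_)
      rw [Nat.div_lt_iff_lt_mul (by positivity), ← pow_add, Nat.add_sub_cancel' hp]
      exact Finset.mem_range.1 hk
  refine (Finset.sum_le_sum hle).trans ?_
  rw [Finset.sum_add_distrib, ← Finset.mul_sum, sum_setIntegral_occupationMeasure hPs hh.le,
    sum_setIntegral_occupationMeasure hβ hh.le, ← integral_finsetSum _
      fun m _ => (h𝒟.integrable _ (hc m)).abs]
  have h1 := setIntegral_le_integral (s := Set.Ioc 0 ((2 ^ p : ℕ) * (T / 2 ^ p)) ×ˢ Set.univ) hPs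
    (Eventually.of_forall fun z => abs_nonneg _)
  have h2 := setIntegral_le_integral (s := Set.Ioc 0 ((2 ^ p : ℕ) * (T / 2 ^ p)) ×ˢ Set.univ) hβ
    (Eventually.of_forall fun z => Finset.sum_nonneg fun _ _ => abs_nonneg _)
  have h3 := mul_le_mul_of_nonneg_left h2 hh.le
  linarith

end IsTestFamily
end Abstract

section Abstract
set_option linter.unusedSectionVars false

theorem ae_tendsto_zero_of_lintegral_le {Ω : Type*} [MeasurableSpace Ω] {μ : Measure Ω}
    {f : ℕ → Ω → ENNReal} (hf : ∀ j, Measurable (f j))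
    (h : ∀ j, ∫⁻ ω, f j ω ∂μ ≤ ENNReal.ofReal ((1 / 2) ^ j)) :
    ∀ᵐ ω ∂μ, Tendsto (fun j => f j ω) atTop (𝓝 0) := by
  have h1 : ∫⁻ ω, ∑' j, f j ω ∂μ ≠ ⊤ := by
    rw [lintegral_tsum fun j => (hf j).aemeasurable]
    refine ((ENNReal.tsum_le_tsum h).trans_lt ?_).ne
    rw [← ENNReal.ofReal_tsum_of_nonneg (fun j => by positivity)
      (summable_geometric_of_lt_one (by norm_num) (by norm_num))]
    exact ENNReal.ofReal_lt_top
  filter_upwards [ae_lt_top (Measurable.tsum hf) h1] with ω hω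
  exact ENNReal.tendsto_atTop_zero_of_tsum_ne_top hω.ne

variable {X : Type} [TopologicalSpace X] [CompactSpace X] [SecondCountableTopology X]
  [MeasurableSpace X] [BorelSpace X]
  {T : ℝ} {κ : ProbabilityTheory.Kernel ℝ X} [ProbabilityTheory.IsMarkovKernel κ]
variable {𝒟 : Set (C(X, ℝ) × (ℝ × X → ℝ))}

/-- A measurable version of the pointwise limit of the discretised paths. -/
theorem exists_measurable_limit_gridPath [T2Space X] [Nonempty X] (T : ℝ) :
    ∃ Y : ℝ × (ℚ → X) → X, Measurable Y ∧ ∀ r ω a,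
      Tendsto (fun p => gridPath T p r ω) atTop (𝓝 a) → Y (r, ω) = a := by
  classical
  let := TopologicalSpace.metrizableSpaceMetric X
  set S := {z : ℝ × (ℚ → X) | ∃ a, Tendsto (fun p => gridPath T p z.1 z.2) atTop (𝓝 a)} with hS
  have hSm : MeasurableSet S :=
    measurableSet_exists_tendsto (l := atTop)
      (f := fun (p : ℕ) (z : ℝ × (ℚ → X)) => gridPath T p z.1 z.2) fun p => measurable_gridPath
  let x₀ : X := Classical.arbitrary X
  let Y : ℝ × (ℚ → X) → X := fun z => if h : z ∈ S then h.choose else x₀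
  refine ⟨Y, ?_, fun r ω a ha => ?_⟩
  · refine measurable_of_tendsto_metrizable
      (f := fun p => S.piecewise (fun z => gridPath T p z.1 z.2) fun _ => x₀)
      (fun p => measurable_gridPath.piecewise hSm measurable_const)
      (tendsto_pi_nhds.2 fun z => ?_)
    by_cases hz : z ∈ S
    · simpa [Y, hz] using (show ∃ a, Tendsto (fun p => gridPath T p z.1 z.2) atTop (𝓝 a) from
        hz).choose_spec
    · simp [Y, hz]
  · have h : (r, ω) ∈ S := ⟨a, ha⟩
    simp only [Y, dif_pos h]
    exact tendsto_nhds_unique h.choose_spec ha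

theorem lintegral_process {Ω : Type*} [MeasurableSpace Ω] {η : Measure Ω} [SFinite η]
    {Y : ℝ × Ω → X} (hY : Measurable Y)
    (hmarg : ∀ r ∈ Set.Icc 0 T, η.map (fun ω => Y (r, ω)) = κ r) {K : ℝ × X → ENNReal}
    (hK : Measurable K) :
    ∫⁻ ω, (∫⁻ r in Set.Ioc 0 T, K (r, Y (r, ω))) ∂η = ∫⁻ z, K z ∂(occupationMeasure T κ) := by
  have hY' : Measurable fun z : Ω × ℝ => K (z.2, Y (z.2, z.1)) :=
    hK.comp (measurable_snd.prodMk (hY.comp measurable_swap))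
  rw [lintegral_lintegral_swap hY'.aemeasurable, occupationMeasure, Measure.lintegral_compProd hK]
  refine setLIntegral_congr_fun measurableSet_Ioc fun r hr => ?_
  rw [← hmarg r ⟨hr.1.le, hr.2⟩]
  exact (lintegral_map (hK.comp measurable_prodMk_left) (hY.comp measurable_prodMk_left)).symm

namespace IsTestFamily

theorem integral_pathDeviation_le (h𝒟 : IsTestFamily T κ 𝒟) (hT : 0 < T) {η : Measure (ℚ → X)}
    [IsProbabilityMeasure η]
    (hη : ∀ p k : ℕ, k < 2 ^ p → ∀ P ∈ 𝒟, ∀ Q ∈ 𝒟,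
        ∫ ω, stepCost P.1 Q.1 (T / 2 ^ p) (ω (k / 2 ^ p), ω ((k + 1 : ℕ) / 2 ^ p)) ∂η ≤
          coarseError T κ P Q (k * (T / 2 ^ p)) ((k + 1 : ℕ) * (T / 2 ^ p)))
    {P : C(X, ℝ) × (ℝ × X → ℝ)} (hP : P ∈ 𝒟) {p₀ : ℕ} {c : ℕ → C(X, ℝ) × (ℝ × X → ℝ)}
    (hc : ∀ k, c k ∈ 𝒟)
    (hstep : Integrable (stepFun T p₀ (fun k => (c k).1)) (occupationMeasure T κ)) {p : ℕ}
    (hp : p₀ ≤ p) :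
    ∫ ω, pathDeviation T p₀ (fun k => (c k).1) P.1 p ω ∂η ≤
      ∫ z, |P.2 z - stepFun T p₀ (fun k => (c k).1) z| ∂(occupationMeasure T κ) +
      T / 2 ^ p * (2 * ∑ m ∈ Finset.range (2 ^ p₀), ∫ z, |(c m).2 z| ∂(occupationMeasure T κ)) := by
  refine le_trans ?_ (h𝒟.sum_coarseError_le hT hP hc hstep hp)
  simp only [pathDeviation]
  rw [integral_finsetSum]
  · exact Finset.sum_le_sum fun k hk => hη p k (Finset.mem_range.1 hk) P hP _ (hc _)
  · exact fun k _ => integrable_continuousMap ((stepCost P.1 (c (k / 2 ^ (p - p₀))).1 _).comp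
      (evalPair ((k : ℚ) / 2 ^ p) ((k + 1 : ℕ) / 2 ^ p))) η

theorem lintegral_liminf_pathDeviation_le (h𝒟 : IsTestFamily T κ 𝒟) (hT : 0 < T)
    {η : Measure (ℚ → X)} [IsProbabilityMeasure η]
    (hη : ∀ p k : ℕ, k < 2 ^ p → ∀ P ∈ 𝒟, ∀ Q ∈ 𝒟,
        ∫ ω, stepCost P.1 Q.1 (T / 2 ^ p) (ω (k / 2 ^ p), ω ((k + 1 : ℕ) / 2 ^ p)) ∂η ≤
          coarseError T κ P Q (k * (T / 2 ^ p)) ((k + 1 : ℕ) * (T / 2 ^ p)))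
    {P : C(X, ℝ) × (ℝ × X → ℝ)} (hP : P ∈ 𝒟) {p₀ : ℕ} {c : ℕ → C(X, ℝ) × (ℝ × X → ℝ)}
    (hc : ∀ k, c k ∈ 𝒟)
    (hstep : Integrable (stepFun T p₀ (fun k => (c k).1)) (occupationMeasure T κ)) {ε : ℝ}
    (hε : ∫ z, |P.2 z - stepFun T p₀ (fun k => (c k).1) z| ∂(occupationMeasure T κ) ≤ ε) :
    ∫⁻ ω, liminf (fun p => ENNReal.ofReal (pathDeviation T p₀ (fun k => (c k).1) P.1 p ω)) atTop ∂η
      ≤ ENNReal.ofReal ε := by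
  have hcont : ∀ p, Continuous fun ω : ℚ → X => pathDeviation T p₀ (fun k => (c k).1) P.1 p ω :=
    fun p => by
      unfold pathDeviation
      fun_prop
  refine (lintegral_liminf_le fun p => (hcont p).measurable.ennreal_ofReal).trans ?_
  set K := 2 * ∑ m ∈ Finset.range (2 ^ p₀), ∫ z, |(c m).2 z| ∂(occupationMeasure T κ)
  have hlim : Tendsto (fun p : ℕ => ENNReal.ofReal (ε + T / 2 ^ p * K)) atTop
      (𝓝 (ENNReal.ofReal ε)) := by
    refine ENNReal.tendsto_ofReal ?_
    simpa using ((tendsto_div_two_pow T).mul_const K).const_add ε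
  rw [← hlim.liminf_eq]
  refine liminf_le_liminf (eventually_atTop.2 ⟨p₀, fun p hp => ?_⟩)
  have hint : Integrable (fun ω => pathDeviation T p₀ (fun k => (c k).1) P.1 p ω) η :=
    integrable_continuousMap ⟨_, hcont p⟩ η
  rw [← ofReal_integral_eq_lintegral_ofReal hint
    (Eventually.of_forall fun ω => Finset.sum_nonneg fun _ _ => abs_nonneg _)]
  refine ENNReal.ofReal_le_ofReal ?_
  have := h𝒟.integral_pathDeviation_le hT hη hP hc hstep hp
  linarith!

/-- The superposition principle on a compact space: a curve of marginals satisfying the weak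
equation on a test family is realised by a process solving the equation pathwise. -/
theorem exists_process (h𝒟 : IsTestFamily T κ 𝒟) [T2Space X] [Nonempty X] (hT : 0 < T)
    {P : ℕ → C(X, ℝ) × (ℝ × X → ℝ)} (hP : ∀ i, P i ∈ 𝒟)
    (hsep : ∀ a b, (∀ i, (P i).1 a = (P i).1 b) → a = b) :
    ∃ η : Measure (ℚ → X), IsProbabilityMeasure η ∧ ∃ Y : ℝ × (ℚ → X) → X, Measurable Y ∧
      (∀ r ∈ Set.Icc 0 T, η.map (fun ω => Y (r, ω)) = κ r) ∧
      ∀ᵐ ω ∂η, ∀ i, ∀ t ∈ Set.Icc 0 T, (P i).1 (Y (t, ω)) - (P i).1 (Y (0, ω)) =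
        ∫ r in (0 : ℝ)..t, (P i).2 (r, Y (r, ω)) := by
  obtain ⟨η, hη, hη1, hη2⟩ := h𝒟.exists_path_measure hT
  have hsep' : ∀ a b : X, a ≠ b → ∃ Q ∈ 𝒟, Q.1 a ≠ Q.1 b := by
    intro a b hab
    by_contra! h
    exact hab (hsep a b fun i => h _ (hP i))
  choose p₀ c hc hc0 happ using fun i j : ℕ => h𝒟.exists_stepFun_approx hT hsep'
    (h𝒟.integrable _ (hP i)) (ε := (1 / 2) ^ j) (by positivity)
  have hC : ∀ i j, ∃ C, ∀ k, ‖(c i j k).1‖ ≤ C := fun i j => by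
    refine ⟨∑ m ∈ Finset.range (2 ^ p₀ i j), ‖(c i j m).1‖, fun k => ?_⟩
    by_cases hk : k < 2 ^ p₀ i j
    · exact Finset.single_le_sum (f := fun m => ‖(c i j m).1‖) (fun _ _ => norm_nonneg _)
        (Finset.mem_range.2 hk)
    · rw [hc0 i j k (not_lt.1 hk)]
      simpa using Finset.sum_nonneg fun _ _ => norm_nonneg _
  choose C hC using hC
  have hstep : ∀ i j, Integrable (stepFun T (p₀ i j) fun k => (c i j k).1)
      (occupationMeasure T κ) := fun i j =>
    Integrable.of_bound measurable_stepFun.aestronglyMeasurable (C i j)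
      (Eventually.of_forall fun z => norm_stepFun_le (hC i j) z)
  have hW : ∀ᵐ ω ∂η, ∀ i, Tendsto (fun j => liminf (fun p => ENNReal.ofReal
      (pathDeviation T (p₀ i j) (fun k => (c i j k).1) (P i).1 p ω)) atTop) atTop (𝓝 0) := by
    refine ae_all_iff.2 fun i => ae_tendsto_zero_of_lintegral_le (fun j => ?_) fun j =>
      h𝒟.lintegral_liminf_pathDeviation_le hT hη2 (hP i) (hc i j) (hstep i j) (happ i j)
    refine Measurable.liminf fun p => Measurable.ennreal_ofReal (Continuous.measurable ?_)
    unfold pathDeviation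
    fun_prop
  have hfreq : ∀ ω, ∀ i, Tendsto (fun j => liminf (fun p => ENNReal.ofReal
      (pathDeviation T (p₀ i j) (fun k => (c i j k).1) (P i).1 p ω)) atTop) atTop (𝓝 0) →
      ∀ ε : ℝ, 0 < ε → ∀ᶠ j in atTop,
        ∃ᶠ p in atTop, pathDeviation T (p₀ i j) (fun k => (c i j k).1) (P i).1 p ω ≤ ε := by
    intro ω i h ε hε
    filter_upwards [h.eventually (gt_mem_nhds (ENNReal.ofReal_pos.2 hε))] with j hj
    exact (frequently_lt_of_liminf_lt (by isBoundedDefault) hj).mono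
      fun p hp => ((ENNReal.ofReal_lt_ofReal_iff hε).1 hp).le
  obtain ⟨Y, hY, hYlim⟩ := exists_measurable_limit_gridPath (X := X) T
  have hconv : ∀ᵐ ω ∂η, ∀ r ∈ Set.Icc 0 T,
      Tendsto (fun p => gridPath T p r ω) atTop (𝓝 (Y (r, ω))) := by
    filter_upwards [hW] with ω hω r hr
    obtain ⟨a, ha⟩ := exists_tendsto_of_cauchySeq (x := fun i => (P i).1) hsep fun i =>
      cauchySeq_gridPath hT (fun ε hε => by
        obtain ⟨j, hj⟩ := (hfreq ω i (hω i) ε hε).exists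
        exact ⟨_, _, _, hC i j, hj⟩) hr
    rwa [hYlim r ω a ha]
  have hmarg : ∀ r ∈ Set.Icc 0 T, η.map (fun ω => Y (r, ω)) = κ r := by
    intro r hr
    have hYr : Measurable fun ω => Y (r, ω) := hY.comp measurable_prodMk_left
    have := Measure.isProbabilityMeasure_map (μ := η) hYr.aemeasurable
    refine ext_of_forall_integral_eq_of_IsFiniteMeasure fun f => ?_
    rw [integral_map hYr.aemeasurable f.continuous.measurable.aestronglyMeasurable]
    have h1 : Tendsto (fun p => ∫ ω, f (gridPath T p r ω) ∂η) atTop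
        (𝓝 (∫ ω, f (Y (r, ω)) ∂η)) := by
      refine tendsto_integral_of_dominated_convergence (fun _ => ‖f‖)
        (fun p => (f.continuous.measurable.comp
          (measurable_gridPath.comp measurable_prodMk_left)).aestronglyMeasurable)
        (integrable_const _) (fun p => Eventually.of_forall fun ω => f.norm_coe_le_norm _) ?_
      filter_upwards [hconv] with ω hω
      exact (f.continuous.tendsto _).comp (hω r hr)
    have h2 : Tendsto (fun p => ∫ ω, f (gridPath T p r ω) ∂η) atTop (𝓝 (∫ x, f x ∂(κ r))) := by
      refine (((h𝒟.continuous_integral f.toContinuousMap).tendsto r).comp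
        (tendsto_dyadicCell_mul hT hr.1)).congr fun p => ?_
      exact (hη1 p _ (dyadicCell_lt hT hr.2).le f.toContinuousMap).symm
    exact tendsto_nhds_unique h1 h2
  have he : ∀ᵐ ω ∂η, ∀ i, Tendsto (fun j => ∫⁻ r in Set.Ioc 0 T, ENNReal.ofReal
      |(P i).2 (r, Y (r, ω)) - stepFun T (p₀ i j) (fun k => (c i j k).1) (r, Y (r, ω))|) atTop
      (𝓝 0) := by
    refine ae_all_iff.2 fun i => ae_tendsto_zero_of_lintegral_le (fun j => ?_) fun j => ?_
    · have : Measurable fun z : (ℚ → X) × ℝ => ENNReal.ofReal |(P i).2 (z.2, Y (z.2, z.1)) -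
          stepFun T (p₀ i j) (fun k => (c i j k).1) (z.2, Y (z.2, z.1))| := by
        have hz : Measurable fun z : (ℚ → X) × ℝ => (z.2, Y (z.2, z.1)) :=
          measurable_snd.prodMk (hY.comp measurable_swap)
        exact ((((h𝒟.measurable _ (hP i)).sub measurable_stepFun).comp hz).norm).ennreal_ofReal
      exact this.lintegral_prod_right'
    · have hd : Integrable (fun z => |(P i).2 z - stepFun T (p₀ i j) (fun k => (c i j k).1) z|)
          (occupationMeasure T κ) := ((h𝒟.integrable _ (hP i)).sub (hstep i j)).abs
      rw [lintegral_process (κ := κ) hY hmarg (K := fun z => ENNReal.ofReal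
        |(P i).2 z - stepFun T (p₀ i j) (fun k => (c i j k).1) z|)
        (((h𝒟.measurable _ (hP i)).sub measurable_stepFun).norm).ennreal_ofReal,
        ← ofReal_integral_eq_lintegral_ofReal hd (Eventually.of_forall fun _ => abs_nonneg _)]
      exact ENNReal.ofReal_le_ofReal (happ i j)
  refine ⟨η, hη, Y, hY, hmarg, ?_⟩
  filter_upwards [hW, hconv, he] with ω h1 h2 h3 i t ht
  have hYω : Measurable fun r => (r, Y (r, ω)) :=
    measurable_id.prodMk (hY.comp measurable_prodMk_right)
  refine eq_of_forall_dist_le fun ε hε => ?_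
  rw [Real.dist_eq]
  obtain ⟨j, hj1, hj2⟩ := ((hfreq ω i (h1 i) (ε / 2) (by positivity)).and
    ((h3 i).eventually (gt_mem_nhds (ENNReal.ofReal_pos.2 (half_pos hε))))).exists
  set s : ℝ → ℝ := fun r => stepFun T (p₀ i j) (fun k => (c i j k).1) (r, Y (r, ω)) with hs
  have hsm : Measurable s := measurable_stepFun.comp hYω
  have hBm : Measurable fun r => (P i).2 (r, Y (r, ω)) := (h𝒟.measurable _ (hP i)).comp hYω
  have hsi : IntegrableOn s (Set.Ioc 0 T) :=
    Integrable.of_bound hsm.aestronglyMeasurable (C i j)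
      (Eventually.of_forall fun r => norm_stepFun_le (hC i j) _)
  have hdi : IntegrableOn (fun r => (P i).2 (r, Y (r, ω)) - s r) (Set.Ioc 0 T) := by
    refine ⟨(hBm.sub hsm).aestronglyMeasurable, ?_⟩
    rw [hasFiniteIntegral_iff_norm]
    exact hj2.trans ENNReal.ofReal_lt_top
  have hsub : Set.Ioc 0 t ⊆ Set.Ioc 0 T := Set.Ioc_subset_Ioc_right ht.2
  have k1 := abs_limit_sub_integral_le hT (hC i j) hj1 h2 ht
  have k2 : |∫ r in (0 : ℝ)..t, ((P i).2 (r, Y (r, ω)) - s r)| ≤ ε / 2 := by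
    rw [intervalIntegral.integral_of_le ht.1]
    refine (abs_integral_le_integral_abs).trans ?_
    refine (setIntegral_mono_set hdi.abs (Eventually.of_forall fun _ => abs_nonneg _)
      hsub.eventuallyLE).trans ?_
    rw [← ENNReal.ofReal_le_ofReal_iff (by positivity), ofReal_integral_eq_lintegral_ofReal hdi.abs
      (Eventually.of_forall fun _ => abs_nonneg _)]
    exact hj2.le
  have k3 : ∫ r in (0 : ℝ)..t, (P i).2 (r, Y (r, ω)) =
      (∫ r in (0 : ℝ)..t, ((P i).2 (r, Y (r, ω)) - s r)) + ∫ r in (0 : ℝ)..t, s r := by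
    rw [← intervalIntegral.integral_add]
    · simp
    · exact (intervalIntegrable_iff_integrableOn_Ioc_of_le ht.1).2 (hdi.mono_set hsub)
    · exact (intervalIntegrable_iff_integrableOn_Ioc_of_le ht.1).2 (hsi.mono_set hsub)
  rw [k3]
  rw [abs_le] at *
  constructor <;> linarith [k1.1, k1.2, k2.1, k2.2]

end IsTestFamily
end Abstract

section TestFunctions

variable {n : ℕ} {φ : (Fin n → ℝ) → ℝ}

theorem contDiff_pd (hφ : ContDiff ℝ 2 φ) (i : Fin n) : ContDiff ℝ 1 (pd φ i) :=
  (hφ.fderiv_right (m := 1) (by norm_num)).clm_apply contDiff_const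

theorem continuous_pd2 (hφ : ContDiff ℝ 2 φ) (i j : Fin n) : Continuous (pd2 φ i j) :=
  ((contDiff_pd hφ j).continuous_fderiv (by norm_num)).clm_apply continuous_const

theorem IsC2c.exists_bound (hφ : IsC2c φ) :
    ∃ M : ℝ, 0 ≤ M ∧ ∀ x, |φ x| ≤ M ∧ (∀ i, |pd φ i x| ≤ M) ∧ ∀ i j, |pd2 φ i j x| ≤ M := by
  have h1 : ∀ i, HasCompactSupport (pd φ i) := fun i => hφ.2.fderiv_apply ℝ _
  have h2 : ∀ i j, HasCompactSupport (pd2 φ i j) := fun i j => (h1 j).fderiv_apply ℝ _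
  obtain ⟨A, hA⟩ := hφ.2.exists_bound_of_continuous hφ.1.continuous
  choose B hB using fun i => (h1 i).exists_bound_of_continuous (contDiff_pd hφ.1 i).continuous
  choose C hC using fun i j => (h2 i j).exists_bound_of_continuous (continuous_pd2 hφ.1 i j)
  refine ⟨|A| + ∑ i, |B i| + ∑ i, ∑ j, |C i j|, by positivity, fun x => ⟨?_, fun i => ?_,
    fun i j => ?_⟩⟩
  · have := (hA x).trans (le_abs_self A)
    rw [Real.norm_eq_abs] at this
    have : 0 ≤ ∑ i, |B i| + ∑ i, ∑ j, |C i j| := by positivity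
    linarith
  · have h := (hB i x).trans (le_abs_self _)
    rw [Real.norm_eq_abs] at h
    have h' := Finset.single_le_sum (f := fun i => |B i|) (fun _ _ => abs_nonneg _)
      (Finset.mem_univ i)
    have : 0 ≤ |A| + ∑ i, ∑ j, |C i j| := by positivity
    linarith
  · have h := (hC i j x).trans (le_abs_self _)
    rw [Real.norm_eq_abs] at h
    have h' := Finset.single_le_sum (f := fun j => |C i j|) (fun _ _ => abs_nonneg _)
      (Finset.mem_univ j)
    have h'' := Finset.single_le_sum (f := fun i => ∑ j, |C i j|)
      (fun i _ => Finset.sum_nonneg fun _ _ => abs_nonneg _) (Finset.mem_univ i)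
    have : 0 ≤ |A| + ∑ i, |B i| := by positivity
    linarith

theorem pd_comp_smul (hφ : Differentiable ℝ φ) (c : ℝ) (i : Fin n) (x : Fin n → ℝ) :
    pd (fun y => φ (c • y)) i x = c * pd φ i (c • x) := by
  have h : HasFDerivAt (fun y : Fin n → ℝ => c • y) (c • ContinuousLinearMap.id ℝ _) x :=
    (c • ContinuousLinearMap.id ℝ (Fin n → ℝ)).hasFDerivAt
  have := ((hφ (c • x)).hasFDerivAt.comp x h).fderiv
  simp only [Function.comp_def] at this
  rw [pd, this]
  simp [pd]

theorem pd_const_mul (c : ℝ) (i : Fin n) (x : Fin n → ℝ) :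
    pd (fun y => c * φ y) i x = c * pd φ i x := by
  simp only [pd]
  rw [show (fun y => c * φ y) = c • φ from rfl, fderiv_const_smul_field]
  simp

theorem pd2_comp_smul (hφ : ContDiff ℝ 2 φ) (c : ℝ) (i j : Fin n) (x : Fin n → ℝ) :
    pd2 (fun y => φ (c • y)) i j x = c * (c * pd2 φ i j (c • x)) := by
  have h1 : (fun y => pd (fun z => φ (c • z)) j y) = fun y => c * pd φ j (c • y) :=
    funext fun y => pd_comp_smul (hφ.differentiable (by norm_num)) c j y
  change pd (fun y => pd (fun z => φ (c • z)) j y) i x = _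
  rw [h1, pd_const_mul (φ := fun y => pd φ j (c • y)),
    pd_comp_smul ((contDiff_pd hφ j).differentiable (by norm_num))]
  rfl

/-- A smooth cutoff sequence exhausting `ℝ^n`, whose derivatives tend to zero uniformly. -/
theorem exists_cutoff (n : ℕ) : ∃ (χ : ℕ → (Fin n → ℝ) → ℝ) (M : ℝ), 0 ≤ M ∧
    ∀ k, IsC2c (χ k) ∧ (∀ x, 0 ≤ χ k x ∧ χ k x ≤ 1) ∧
      (∀ x, ‖x‖ ≤ k + 1 → χ k x = 1) ∧ (∀ i x, |pd (χ k) i x| ≤ M / (k + 1)) ∧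
      ∀ i j x, |pd2 (χ k) i j x| ≤ M / (k + 1) := by
  let ψ : ContDiffBump (0 : Fin n → ℝ) := ⟨1, 2, one_pos, one_lt_two⟩
  have hψ : IsC2c (ψ : (Fin n → ℝ) → ℝ) := ⟨ψ.contDiff, ψ.hasCompactSupport⟩
  obtain ⟨M, hM0, hM⟩ := hψ.exists_bound
  refine ⟨fun k x => ψ ((k + 1 : ℝ)⁻¹ • x), M, hM0, fun k => ⟨⟨?_, ?_⟩,
    fun x => ⟨ψ.nonneg, ψ.le_one⟩, fun x hx => ?_, fun i x => ?_, fun i j x => ?_⟩⟩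
  · exact ψ.contDiff.comp (contDiff_const_smul _)
  · exact ψ.hasCompactSupport.comp_homeomorph
      (Homeomorph.smulOfNeZero (k + 1 : ℝ)⁻¹ (by positivity))
  · apply ψ.one_of_mem_closedBall
    rw [mem_closedBall_zero_iff, norm_smul, norm_inv, Real.norm_of_nonneg (by positivity)]
    change _ ≤ (1 : ℝ)
    rw [inv_mul_le_iff₀ (by positivity), mul_one]
    exact hx
  · have hk : (0 : ℝ) < k + 1 := by positivity
    rw [pd_comp_smul (hψ.1.differentiable (by norm_num)), abs_mul, abs_of_pos (by positivity),
      div_eq_inv_mul]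
    gcongr
    exact (hM _).2.1 i
  · have hk : (1 : ℝ) ≤ k + 1 := by simp
    rw [pd2_comp_smul hψ.1, abs_mul, abs_mul, abs_of_pos (by positivity), div_eq_inv_mul]
    gcongr
    refine (mul_le_of_le_one_left (abs_nonneg _) (inv_le_one_of_one_le₀ hk)).trans ?_
    exact (hM _).2.2 i j

/-- Indicators of open sets are limits of test functions. -/
theorem exists_testFunction_tendsto_indicator {U : Set (Fin n → ℝ)} (hU : IsOpen U) :
    ∃ f : ℕ → (Fin n → ℝ) → ℝ, (∀ k, IsC2c (f k)) ∧ (∀ k x, 0 ≤ f k x ∧ f k x ≤ 1) ∧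
      ∀ x, Tendsto (fun k => f k x) atTop (𝓝 (U.indicator 1 x)) := by
  obtain ⟨χ, M, -, hχ⟩ := exists_cutoff n
  obtain ⟨h, hsupp, hcd, hrange⟩ := hU.exists_contDiff_support_eq (n := 2)
  have h01 : ∀ x, 0 ≤ h x ∧ h x ≤ 1 := fun x => hrange ⟨x, rfl⟩
  have hp : ∀ k x, 0 ≤ (1 - h x) ^ k ∧ (1 - h x) ^ k ≤ 1 := fun k x =>
    ⟨pow_nonneg (by linarith [(h01 x).2]) _,
      pow_le_one₀ (by linarith [(h01 x).2]) (by linarith [(h01 x).1])⟩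
  refine ⟨fun k x => χ k x * (1 - (1 - h x) ^ k), fun k => ⟨?_, ?_⟩, fun k x => ⟨?_, ?_⟩,
    fun x => ?_⟩
  · exact (hχ k).1.1.mul (contDiff_const.sub ((contDiff_const.sub hcd).pow k))
  · exact (hχ k).1.2.mul_right
  · exact mul_nonneg ((hχ k).2.1 x).1 (by linarith [(hp k x).2])
  · exact mul_le_one₀ ((hχ k).2.1 x).2 (by linarith [(hp k x).2]) (by linarith [(hp k x).1])
  · have h1 : Tendsto (fun k => χ k x) atTop (𝓝 1) := by
      obtain ⟨N, hN⟩ := exists_nat_ge ‖x‖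
      refine tendsto_const_nhds.congr' (eventually_atTop.2 ⟨N, fun k hk => ?_⟩)
      refine ((hχ k).2.2.1 x ?_).symm
      have : (N : ℝ) ≤ k := by exact_mod_cast hk
      linarith
    by_cases hx : x ∈ U
    · have hx' : 0 < h x := lt_of_le_of_ne (h01 x).1 (Ne.symm (by rwa [← hsupp] at hx))
      have := h1.mul ((tendsto_pow_atTop_nhds_zero_of_lt_one (r := 1 - h x)
        (by linarith [(h01 x).2]) (by linarith)).const_sub 1)
      simpa [Set.indicator_of_mem hx] using this
    · have hx' : h x = 0 := by
        rw [← hsupp] at hx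
        exact Function.notMem_support.1 hx
      simp [hx', Set.indicator_of_notMem hx]

end TestFunctions

section Subprobability

open scoped CompactlySupported

variable {d : ℕ}

instance (μ : SP d) : IsFiniteMeasure μ.1 := ⟨μ.2.trans_lt ENNReal.one_lt_top⟩

theorem SP.continuous_integral {φ : Rd d → ℝ} (hφ : Continuous φ) (hc : HasCompactSupport φ) :
    Continuous fun μ : SP d => ∫ x, φ x ∂μ.1 :=
  continuous_iInf_dom (i := (⟨φ, hφ, hc⟩ : {g : Rd d → ℝ // Continuous g ∧ HasCompactSupport g}))
    continuous_induced_dom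

theorem SP.abs_integral_le {φ : Rd d → ℝ} {M : ℝ} (hM : ∀ x, |φ x| ≤ M) (hM0 : 0 ≤ M)
    (μ : SP d) : |∫ x, φ x ∂μ.1| ≤ M := by
  have h := norm_integral_le_of_norm_le_const (μ := μ.1) (f := φ) (ae_of_all _ hM)
  have h1 : μ.1.real Set.univ ≤ 1 := ENNReal.toReal_le_of_le_ofReal zero_le_one (by simpa using μ.2)
  rw [Real.norm_eq_abs] at h
  nlinarith

theorem IsC2c.integrable {φ : Rd d → ℝ} (hφ : IsC2c φ) (μ : Measure (Rd d)) [IsFiniteMeasure μ] :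
    Integrable φ μ :=
  hφ.1.continuous.integrable_of_hasCompactSupport hφ.2

theorem tendsto_integral_testFunction {U : Set (Rd d)} (hU : IsOpen U) {f : ℕ → Rd d → ℝ}
    (hf : ∀ k, IsC2c (f k)) (h01 : ∀ k x, 0 ≤ f k x ∧ f k x ≤ 1)
    (hlim : ∀ x, Tendsto (fun k => f k x) atTop (𝓝 (U.indicator 1 x)))
    (μ : Measure (Rd d)) [IsFiniteMeasure μ] :
    Tendsto (fun k => ENNReal.ofReal (∫ x, f k x ∂μ)) atTop (𝓝 (μ U)) := by
  have h : Tendsto (fun k => ∫ x, f k x ∂μ) atTop (𝓝 (∫ x, U.indicator 1 x ∂μ)) := by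
    refine tendsto_integral_of_dominated_convergence (fun _ => 1)
      (fun k => ((hf k).integrable μ).aestronglyMeasurable) (integrable_const _)
      (fun k => ae_of_all _ fun x => ?_) (ae_of_all _ hlim)
    rw [Real.norm_eq_abs, abs_of_nonneg (h01 k x).1]
    exact (h01 k x).2
  have h' := ENNReal.tendsto_ofReal h
  rwa [integral_indicator_one hU.measurableSet, ofReal_measureReal] at h'

theorem SP.ext_of_integral_eq {μ ν : SP d}
    (h : ∀ φ : Rd d → ℝ, IsC2c φ → ∫ x, φ x ∂μ.1 = ∫ x, φ x ∂ν.1) : μ = ν := by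
  have hopen : ∀ U : Set (Rd d), IsOpen U → μ.1 U = ν.1 U := fun U hU => by
    obtain ⟨f, hf, h01, hlim⟩ := exists_testFunction_tendsto_indicator hU
    refine tendsto_nhds_unique (tendsto_integral_testFunction hU hf h01 hlim μ.1) ?_
    simp_rw [h _ (hf _)]
    exact tendsto_integral_testFunction hU hf h01 hlim ν.1
  exact Subtype.ext (ext_of_generate_finite {s | IsOpen s} (BorelSpace.measurable_eq)
    isPiSystem_isOpen (fun U hU => hopen U hU) (hopen _ isOpen_univ))

theorem SP.measurable_val : Measurable fun μ : SP d => μ.1 := by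
  refine Measurable.measure_of_isPiSystem (BorelSpace.measurable_eq) isPiSystem_isOpen
    (fun U hU => ?_) ?_
  all_goals
    obtain ⟨f, hf, h01, hlim⟩ := exists_testFunction_tendsto_indicator
      (by first | exact hU | exact isOpen_univ)
    exact measurable_of_tendsto_metrizable
      (fun k => (SP.continuous_integral (hf k).1.continuous (hf k).2).measurable.ennreal_ofReal)
      (tendsto_pi_nhds.2 fun μ => tendsto_integral_testFunction
        (by first | exact hU | exact isOpen_univ) hf h01 hlim μ.1)

variable {g : ℕ → Rd d → ℝ}

theorem GFamily.continuous_Gmap (hg : GFamily d g) : Continuous (Gmap g) :=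
  continuous_pi fun i => SP.continuous_integral (hg.1 i).1.continuous (hg.1 i).2

theorem GFamily.injective_Gmap (hg : GFamily d g) : Function.Injective (Gmap g) := by
  refine fun μ ν h => SP.ext_of_integral_eq fun φ hφ => eq_of_forall_dist_le fun ε hε => ?_
  obtain ⟨i, hi, -⟩ := hg.2.2 φ hφ (ε / 2) (by positivity)
  have key : ∀ ρ : SP d, |∫ x, g i x ∂ρ.1 - ∫ x, φ x ∂ρ.1| ≤ ε / 2 := fun ρ => by
    rw [← integral_sub ((hg.1 i).integrable _) (hφ.integrable _)]
    exact SP.abs_integral_le hi (by positivity) ρ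
  have h1 := abs_le.1 (key μ)
  have h2 := abs_le.1 (key ν)
  have h3 : ∫ x, g i x ∂μ.1 = ∫ x, g i x ∂ν.1 := congrFun h i
  rw [Real.dist_eq, abs_le]
  constructor <;> linarith

theorem exists_subprobability_of_positive {Λ : C_c(Rd d, ℝ) →ₚ[ℝ] ℝ}
    (hΛ : ∀ f : C_c(Rd d, ℝ), (∀ x, f x ≤ 1) → Λ f ≤ 1) :
    ∃ μ : SP d, ∀ f : C_c(Rd d, ℝ), ∫ x, f x ∂μ.1 = Λ f := by
  refine ⟨⟨RealRMK.rieszMeasure Λ, ?_⟩, fun f => RealRMK.integral_rieszMeasure Λ f⟩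
  obtain ⟨χ, M, -, hχ⟩ := exists_cutoff d
  have hball : ∀ k : ℕ, RealRMK.rieszMeasure Λ (Metric.closedBall 0 k) ≤ 1 := fun k => by
    let f : C_c(Rd d, ℝ) := ⟨⟨χ k, (hχ k).1.1.continuous⟩, (hχ k).1.2⟩
    have hfi : Integrable f (RealRMK.rieszMeasure Λ) :=
      f.1.continuous.integrable_of_hasCompactSupport f.2
    have h1 : ∫ x, f x ∂(RealRMK.rieszMeasure Λ) ≤ 1 := by
      rw [RealRMK.integral_rieszMeasure]
      exact hΛ f fun x => ((hχ k).2.1 x).2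
    calc RealRMK.rieszMeasure Λ (Metric.closedBall 0 k)
        = ∫⁻ x, (Metric.closedBall (0 : Rd d) k).indicator 1 x ∂(RealRMK.rieszMeasure Λ) :=
          (lintegral_indicator_one Metric.isClosed_closedBall.measurableSet).symm
      _ ≤ ∫⁻ x, ENNReal.ofReal (f x) ∂(RealRMK.rieszMeasure Λ) := by
          refine lintegral_mono (Set.indicator_le fun x hx => ?_)
          have : f x = 1 := (hχ k).2.2.1 x (by
            rw [mem_closedBall_zero_iff] at hx; linarith)
          simp [this]
      _ = ENNReal.ofReal (∫ x, f x ∂(RealRMK.rieszMeasure Λ)) :=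
          (ofReal_integral_eq_lintegral_ofReal hfi
            (ae_of_all _ fun x => ((hχ k).2.1 x).1)).symm
      _ ≤ 1 := by simpa using ENNReal.ofReal_le_ofReal h1
  rw [← Metric.iUnion_closedBall_nat (0 : Rd d), Monotone.measure_iUnion]
  · exact iSup_le hball
  · exact fun m n h => Metric.closedBall_subset_closedBall (by exact_mod_cast h)

instance : CompactSpace (SP d) := by
  refine ⟨isCompact_iff_ultrafilter_le_nhds.2 fun 𝒰 _ => ?_⟩
  have hlim : ∀ f : C_c(Rd d, ℝ), ∃ l, Tendsto (fun μ : SP d => ∫ x, f x ∂μ.1) 𝒰 (𝓝 l) := by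
    intro f
    obtain ⟨M, hM⟩ := f.2.exists_bound_of_continuous f.1.continuous
    have hM0 : 0 ≤ M := (norm_nonneg _).trans (hM 0)
    obtain ⟨l, -, hl⟩ := (isCompact_Icc (a := -M) (b := M)).ultrafilter_le_nhds
      (𝒰.map fun μ : SP d => ∫ x, f x ∂μ.1) (by
        simp only [Ultrafilter.coe_map, le_principal_iff, mem_map]
        exact univ_mem' fun μ : SP d => abs_le.1 (SP.abs_integral_le hM hM0 μ))
    exact ⟨l, hl⟩
  choose Λ hΛ using hlim
  have hint : ∀ (f : C_c(Rd d, ℝ)) (μ : SP d), Integrable f μ.1 := fun f μ =>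
    f.1.continuous.integrable_of_hasCompactSupport f.2
  let Λ' : C_c(Rd d, ℝ) →ₗ[ℝ] ℝ :=
    { toFun := Λ
      map_add' := fun f h => tendsto_nhds_unique (hΛ (f + h)) (by
        refine ((hΛ f).add (hΛ h)).congr fun μ => ?_
        rw [← integral_add (hint f μ) (hint h μ)]
        rfl)
      map_smul' := fun c f => tendsto_nhds_unique (hΛ (c • f)) (by
        refine ((hΛ f).const_mul c).congr fun μ => ?_
        rw [← integral_const_mul]
        rfl) }
  obtain ⟨μ, hμ⟩ := exists_subprobability_of_positive
    (Λ := PositiveLinearMap.mk₀ Λ' fun f hf => ge_of_tendsto' (hΛ f) fun μ =>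
      integral_nonneg fun x => hf x) (fun f hf => le_of_tendsto' (hΛ f) fun μ => by
        have h1 : μ.1.real Set.univ ≤ 1 :=
          ENNReal.toReal_le_of_le_ofReal zero_le_one (by simpa using μ.2)
        have := integral_mono (hint f μ) (integrable_const 1) hf
        simp only [integral_const, smul_eq_mul, mul_one] at this
        exact this.trans h1)
  refine ⟨μ, Set.mem_univ _, ?_⟩
  rw [nhds_iInf]
  refine le_iInf fun f => ?_
  rw [nhds_induced, ← tendsto_iff_comap]
  have := hΛ ⟨⟨f.1, f.2.1⟩, f.2.2⟩
  rwa [show Λ _ = ∫ x, f.1 x ∂μ.1 from (hμ ⟨⟨f.1, f.2.1⟩, f.2.2⟩).symm] at this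

theorem GFamily.t2Space (hg : GFamily d g) : T2Space (SP d) :=
  T2Space.of_injective_continuous hg.injective_Gmap hg.continuous_Gmap

theorem GFamily.isClosedEmbedding_Gmap (hg : GFamily d g) : IsClosedEmbedding (Gmap g) :=
  hg.continuous_Gmap.isClosedEmbedding hg.injective_Gmap

theorem GFamily.secondCountableTopology (hg : GFamily d g) : SecondCountableTopology (SP d) :=
  hg.isClosedEmbedding_Gmap.isEmbedding.secondCountableTopology

instance : Nonempty (SP d) := ⟨⟨0, by simp⟩⟩

end Subprobability

section Coefficients

open ProbabilityTheory

variable {d : ℕ} {a : ℝ → SP d → Rd d → Fin d → Fin d → ℝ} {b : ℝ → SP d → Rd d → Fin d → ℝ}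

/-- The total size `|b(t,μ,·)| + |a(t,μ,·)|` of the coefficients at a point. -/
def coeffSize (a : ℝ → SP d → Rd d → Fin d → Fin d → ℝ) (b : ℝ → SP d → Rd d → Fin d → ℝ)
    (t : ℝ) (μ : SP d) (x : Rd d) : ℝ :=
  (∑ i, |b t μ x i|) + ∑ i, ∑ j, |a t μ x i j|

/-- The `L¹(μ)`-size of the coefficients. -/
def coeffNorm (a : ℝ → SP d → Rd d → Fin d → Fin d → ℝ) (b : ℝ → SP d → Rd d → Fin d → ℝ)
    (z : ℝ × SP d) : ENNReal :=
  ∫⁻ x, ENNReal.ofReal (coeffSize a b z.1 z.2 x) ∂z.2.1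

/-- The tautological kernel `(t, μ) ↦ μ`. -/
def evalKernel (d : ℕ) : Kernel (ℝ × SP d) (Rd d) :=
  ⟨fun z => z.2.1, SP.measurable_val.comp measurable_snd⟩

instance : IsFiniteKernel (evalKernel d) := ⟨1, ENNReal.one_lt_top, fun z => z.2.2⟩

theorem GoodCoeffs.measurable_a (hab : GoodCoeffs d a b) (i j : Fin d) :
    Measurable fun p : (ℝ × SP d) × Rd d => a p.1.1 p.1.2 p.2 i j :=
  (hab.1 i j).comp (f := fun p : (ℝ × SP d) × Rd d => (p.1.1, p.1.2, p.2)) (by fun_prop)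

theorem GoodCoeffs.measurable_b (hab : GoodCoeffs d a b) (i : Fin d) :
    Measurable fun p : (ℝ × SP d) × Rd d => b p.1.1 p.1.2 p.2 i :=
  (hab.2.1 i).comp (f := fun p : (ℝ × SP d) × Rd d => (p.1.1, p.1.2, p.2)) (by fun_prop)

theorem GoodCoeffs.measurable_coeffSize (hab : GoodCoeffs d a b) :
    Measurable fun p : (ℝ × SP d) × Rd d => coeffSize a b p.1.1 p.1.2 p.2 := by
  refine (Finset.measurable_fun_sum _ fun i _ => (hab.measurable_b i).abs).add
    (Finset.measurable_fun_sum _ fun i _ => Finset.measurable_fun_sum _ fun j _ =>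
      (hab.measurable_a i j).abs)

theorem GoodCoeffs.measurable_coeffNorm (hab : GoodCoeffs d a b) : Measurable (coeffNorm a b) :=
  Measurable.lintegral_kernel_prod_right' (κ := evalKernel d)
    hab.measurable_coeffSize.ennreal_ofReal

theorem GoodCoeffs.measurable_Lop (hab : GoodCoeffs d a b) {φ : Rd d → ℝ} (hφ : ContDiff ℝ 2 φ) :
    Measurable fun p : (ℝ × SP d) × Rd d => Lop a b p.1.1 p.1.2 φ p.2 :=
  (Finset.measurable_fun_sum _ fun i _ => Finset.measurable_fun_sum _ fun j _ =>
    (hab.measurable_a i j).mul ((continuous_pd2 hφ i j).measurable.comp measurable_snd)).add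
    (Finset.measurable_fun_sum _ fun i _ =>
      (hab.measurable_b i).mul ((contDiff_pd hφ i).continuous.measurable.comp measurable_snd))

theorem GoodCoeffs.measurable_integral_Lop (hab : GoodCoeffs d a b) {φ : Rd d → ℝ}
    (hφ : ContDiff ℝ 2 φ) :
    Measurable fun z : ℝ × SP d => ∫ x, Lop a b z.1 z.2 φ x ∂z.2.1 :=
  (StronglyMeasurable.integral_kernel_prod_right' (κ := evalKernel d)
    (hab.measurable_Lop hφ).stronglyMeasurable).measurable

theorem abs_Lop_le {φ : Rd d → ℝ} {M : ℝ} (h1 : ∀ i x, |pd φ i x| ≤ M)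
    (h2 : ∀ i j x, |pd2 φ i j x| ≤ M) (t : ℝ) (μ : SP d) (x : Rd d) :
    |Lop a b t μ φ x| ≤ M * coeffSize a b t μ x := by
  rw [Lop, coeffSize, add_comm, mul_add, Finset.mul_sum, Finset.mul_sum]
  refine (abs_add_le _ _).trans (add_le_add ?_ ?_)
  · refine (Finset.abs_sum_le_sum_abs _ _).trans (Finset.sum_le_sum fun i _ => ?_)
    rw [abs_mul, mul_comm]
    exact mul_le_mul_of_nonneg_right (h1 i x) (abs_nonneg _)
  · refine (Finset.abs_sum_le_sum_abs _ _).trans (Finset.sum_le_sum fun i _ => ?_)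
    rw [Finset.mul_sum]
    refine (Finset.abs_sum_le_sum_abs _ _).trans (Finset.sum_le_sum fun j _ => ?_)
    rw [abs_mul, mul_comm]
    exact mul_le_mul_of_nonneg_right (h2 i j x) (abs_nonneg _)

theorem lintegral_ofReal_abs_Lop_le {φ : Rd d → ℝ} {M : ℝ} (hM : 0 ≤ M)
    (h1 : ∀ i x, |pd φ i x| ≤ M) (h2 : ∀ i j x, |pd2 φ i j x| ≤ M) (z : ℝ × SP d) :
    ∫⁻ x, ENNReal.ofReal |Lop a b z.1 z.2 φ x| ∂z.2.1 ≤ ENNReal.ofReal M * coeffNorm a b z := by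
  rw [coeffNorm, ← lintegral_const_mul' _ _ ENNReal.ofReal_ne_top]
  refine lintegral_mono fun x => ?_
  rw [← ENNReal.ofReal_mul hM]
  exact ENNReal.ofReal_le_ofReal (abs_Lop_le h1 h2 _ _ _)

theorem enorm_integral_Lop_le {φ : Rd d → ℝ} {M : ℝ} (hM : 0 ≤ M)
    (h1 : ∀ i x, |pd φ i x| ≤ M) (h2 : ∀ i j x, |pd2 φ i j x| ≤ M) (z : ℝ × SP d) :
    ‖∫ x, Lop a b z.1 z.2 φ x ∂z.2.1‖ₑ ≤ ENNReal.ofReal M * coeffNorm a b z := by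
  refine (enorm_integral_le_lintegral_enorm _).trans
    (le_trans (le_of_eq ?_) (lintegral_ofReal_abs_Lop_le hM h1 h2 z))
  simp [Real.enorm_eq_ofReal_abs]

theorem GoodCoeffs.integrable_Lop (hab : GoodCoeffs d a b) {φ : Rd d → ℝ} (hφ : IsC2c φ)
    {z : ℝ × SP d} (hz : coeffNorm a b z < ⊤) :
    Integrable (fun x => Lop a b z.1 z.2 φ x) z.2.1 := by
  obtain ⟨M, hM, h⟩ := hφ.exists_bound
  refine ⟨((hab.measurable_Lop hφ.1).comp measurable_prodMk_left).aestronglyMeasurable, ?_⟩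
  rw [hasFiniteIntegral_iff_enorm]
  refine lt_of_le_of_lt (le_trans (le_of_eq ?_) (lintegral_ofReal_abs_Lop_le hM
    (fun i x => (h x).2.1 i) (fun i j x => (h x).2.2 i j) z))
    (ENNReal.mul_lt_top ENNReal.ofReal_lt_top hz)
  simp [Real.enorm_eq_ofReal_abs]

end Coefficients

section CurveKernel

open ProbabilityTheory

theorem measurable_of_continuous_integral {Y X : Type} [TopologicalSpace Y] [MeasurableSpace Y]
    [BorelSpace Y] [TopologicalSpace X] [CompactSpace X] [HasOuterApproxClosed X]
    [MeasurableSpace X] [BorelSpace X] {κ : Y → Measure X} (hκ : ∀ y, IsProbabilityMeasure (κ y))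
    (h : ∀ F : C(X, ℝ), Continuous fun y => ∫ x, F x ∂(κ y)) : Measurable κ := by
  refine Measurable.measure_of_isPiSystem_of_isProbabilityMeasure
    ((BorelSpace.measurable_eq (α := X)).trans borel_eq_generateFrom_isClosed)
    isPiSystem_isClosed fun s hs => ?_
  have hs' : IsClosed s := hs
  refine measurable_of_tendsto_metrizable (f := fun n y => ∫⁻ x, hs'.apprSeq n x ∂(κ y))
    (fun n => ?_) (tendsto_pi_nhds.2 fun y =>
      HasOuterApproxClosed.tendsto_lintegral_apprSeq hs' (κ y))
  have key : ∀ y, ∫⁻ x, hs'.apprSeq n x ∂(κ y)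
      = ENNReal.ofReal (∫ x, (hs'.apprSeq n x : ℝ) ∂(κ y)) := fun y => by
    rw [ofReal_integral_eq_lintegral_ofReal]
    · simp
    · exact integrable_continuousMap
        ⟨fun x => (hs'.apprSeq n x : ℝ), by fun_prop⟩ (κ y)
    · exact ae_of_all _ fun x => NNReal.coe_nonneg _
  simp_rw [key]
  exact (h ⟨fun x => (hs'.apprSeq n x : ℝ), by fun_prop⟩).measurable.ennreal_ofReal

variable {d : ℕ} {T : ℝ} {a : ℝ → SP d → Rd d → Fin d → Fin d → ℝ}
  {b : ℝ → SP d → Rd d → Fin d → ℝ} {g : ℕ → Rd d → ℝ} {Γ : ℝ → Measure (SP d)}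

theorem WeaklyContinuousMeasOn.continuous_integral_projIcc (hT : 0 ≤ T)
    (hΓ : WeaklyContinuousMeasOn Γ (Set.Icc 0 T)) (F : C(SP d, ℝ)) :
    Continuous fun t => ∫ μ, F μ ∂(Γ (Set.projIcc 0 T hT t)) := by
  have hF : ∃ M, ∀ μ, |F μ| ≤ M := ⟨‖F‖, fun μ => F.norm_coe_le_norm μ⟩
  exact ((hΓ F F.continuous hF).comp_continuous
    (continuous_subtype_val.comp continuous_projIcc) fun t => (Set.projIcc 0 T hT t).2)

theorem exists_kernel (hg : GFamily d g) (hT : 0 ≤ T)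
    (hprob : ∀ t ∈ Set.Icc (0:ℝ) T, IsProbabilityMeasure (Γ t))
    (hΓ : WeaklyContinuousMeasOn Γ (Set.Icc 0 T)) :
    ∃ κ : Kernel ℝ (SP d), IsMarkovKernel κ ∧ (∀ t ∈ Set.Icc 0 T, κ t = Γ t) ∧
      ∀ F : C(SP d, ℝ), Continuous fun t => ∫ μ, F μ ∂(κ t) := by
  have := hg.t2Space
  have := hg.secondCountableTopology
  let := TopologicalSpace.metrizableSpaceMetric (SP d)
  have hp : ∀ t, IsProbabilityMeasure (Γ (Set.projIcc 0 T hT t)) :=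
    fun t => hprob _ (Set.projIcc 0 T hT t).2
  refine ⟨⟨fun t => Γ (Set.projIcc 0 T hT t),
    measurable_of_continuous_integral hp (hΓ.continuous_integral_projIcc hT)⟩, ⟨hp⟩, fun t ht => ?_,
    hΓ.continuous_integral_projIcc hT⟩
  change Γ (Set.projIcc 0 T hT t) = Γ t
  rw [Set.projIcc_of_mem hT ht]

end CurveKernel

section CylinderFunctions

open ProbabilityTheory

variable {d : ℕ} {T : ℝ} {a : ℝ → SP d → Rd d → Fin d → Fin d → ℝ}
  {b : ℝ → SP d → Rd d → Fin d → ℝ} {g : ℕ → Rd d → ℝ} {n : ℕ}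

theorem bL_eq_fderiv (f : (Fin n → ℝ) → ℝ) (t : ℝ) (μ : SP d) :
    bL a b g f t μ = fderiv ℝ f (fun l : Fin n => ∫ x, g l x ∂μ.1)
      (fun k => ∫ x, Lop a b t μ (g k) x ∂μ.1) := by
  set D := fderiv ℝ f (fun l : Fin n => ∫ x, g l x ∂μ.1) with hD
  rw [bL]
  conv_rhs => rw [pi_eq_sum_univ' fun k : Fin n => ∫ x, Lop a b t μ (g k) x ∂μ.1]
  rw [map_sum]
  refine Finset.sum_congr rfl fun k _ => ?_
  rw [map_smul, smul_eq_mul, mul_comm, pd]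

theorem GFamily.continuous_coords (hg : GFamily d g) (n : ℕ) :
    Continuous fun μ : SP d => (fun l : Fin n => ∫ x, g l x ∂μ.1) :=
  continuous_pi fun l => SP.continuous_integral (hg.1 l).1.continuous (hg.1 l).2

/-- The pairs `(F, 𝐋F)` for `F` a cylinder function with a `C²` profile. -/
def cylinderFamily (a : ℝ → SP d → Rd d → Fin d → Fin d → ℝ) (b : ℝ → SP d → Rd d → Fin d → ℝ)
    (g : ℕ → Rd d → ℝ) : Set (C(SP d, ℝ) × (ℝ × SP d → ℝ)) :=
  {p | ∃ (n : ℕ) (f : (Fin n → ℝ) → ℝ), ContDiff ℝ 2 f ∧ (∀ μ, p.1 μ = Fof g f μ) ∧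
    ∀ z, p.2 z = bL a b g f z.1 z.2}

theorem GFamily.exists_mem_cylinderFamily (hg : GFamily d g) {f : (Fin n → ℝ) → ℝ}
    (hf : ContDiff ℝ 2 f) :
    ∃ q ∈ cylinderFamily a b g, (∀ μ, q.1 μ = Fof g f μ) ∧ ∀ z, q.2 z = bL a b g f z.1 z.2 :=
  ⟨⟨⟨Fof g f, hf.continuous.comp (hg.continuous_coords n)⟩, fun z => bL a b g f z.1 z.2⟩,
    ⟨n, f, hf, fun _ => rfl, fun _ => rfl⟩, fun _ => rfl, fun _ => rfl⟩

theorem GFamily.measurable_bL (hg : GFamily d g) (hab : GoodCoeffs d a b) {f : (Fin n → ℝ) → ℝ}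
    (hf : ContDiff ℝ 2 f) : Measurable fun z : ℝ × SP d => bL a b g f z.1 z.2 :=
  Finset.measurable_fun_sum _ fun k _ =>
    (((contDiff_pd hf k).continuous.comp (hg.continuous_coords n)).measurable.comp
      measurable_snd).mul (hab.measurable_integral_Lop (hg.1 k).1)

theorem GoodCoeffs.integrable_integral_Lop (hab : GoodCoeffs d a b) {ν : Measure (ℝ × SP d)}
    (hν : ∫⁻ z, coeffNorm a b z ∂ν < ⊤) {φ : Rd d → ℝ} (hφ : IsC2c φ) :
    Integrable (fun z : ℝ × SP d => ∫ x, Lop a b z.1 z.2 φ x ∂z.2.1) ν := by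
  obtain ⟨M, hM, h⟩ := hφ.exists_bound
  refine ⟨(hab.measurable_integral_Lop hφ.1).aestronglyMeasurable, ?_⟩
  rw [hasFiniteIntegral_iff_enorm]
  refine lt_of_le_of_lt (lintegral_mono fun z => enorm_integral_Lop_le hM
    (fun i x => (h x).2.1 i) (fun i j x => (h x).2.2 i j) z) ?_
  rw [lintegral_const_mul' _ _ ENNReal.ofReal_ne_top]
  exact ENNReal.mul_lt_top ENNReal.ofReal_lt_top hν

theorem GFamily.integrable_bL (hg : GFamily d g) (hab : GoodCoeffs d a b)
    {ν : Measure (ℝ × SP d)} (hν : ∫⁻ z, coeffNorm a b z ∂ν < ⊤) {f : (Fin n → ℝ) → ℝ}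
    (hf : ContDiff ℝ 2 f) : Integrable (fun z : ℝ × SP d => bL a b g f z.1 z.2) ν := by
  refine integrable_finsetSum _ fun k _ => ?_
  let F : C(SP d, ℝ) :=
    ⟨_, (contDiff_pd hf k).continuous.comp (hg.continuous_coords n)⟩
  exact (hab.integrable_integral_Lop hν (hg.1 k)).bdd_mul (c := ‖F‖)
    (F.continuous.measurable.comp measurable_snd).aestronglyMeasurable
    (ae_of_all _ fun z => F.norm_coe_le_norm z.2)

theorem exists_isC2b_eq_on_ball {f : (Fin n → ℝ) → ℝ} (hf : ContDiff ℝ 2 f) (R : ℝ) :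
    ∃ f' : (Fin n → ℝ) → ℝ, IsC2b f' ∧ ∀ x, ‖x‖ < R → f' =ᶠ[𝓝 x] f := by
  obtain ⟨χ, _, -, hχ⟩ := exists_cutoff n
  obtain ⟨k, hk⟩ := exists_nat_ge R
  have hc : IsC2c fun x => χ k x * f x := ⟨(hχ k).1.1.mul hf, (hχ k).1.2.mul_right⟩
  obtain ⟨M, -, hM⟩ := hc.exists_bound
  refine ⟨fun x => χ k x * f x, ⟨hc.1, M, hM⟩, fun x hx => ?_⟩
  filter_upwards [continuous_norm.continuousAt.eventually_lt_const hx] with y hy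
  rw [(hχ k).2.2.1 y (by linarith), one_mul]

theorem GFamily.exists_coords_bound (hg : GFamily d g) (n : ℕ) :
    ∃ R : ℝ, ∀ μ : SP d, ‖fun l : Fin n => ∫ x, g l x ∂μ.1‖ < R := by
  obtain ⟨R, hR⟩ := (isCompact_range (hg.continuous_coords n)).isBounded.exists_norm_le
  exact ⟨R + 1, fun μ => (hR _ ⟨μ, rfl⟩).trans_lt (lt_add_one R)⟩

variable {κ : Kernel ℝ (SP d)} [IsMarkovKernel κ] {Γ : ℝ → Measure (SP d)}

theorem lintegral_coeffNorm_occupationMeasure (hab : GoodCoeffs d a b)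
    (hκ : ∀ t ∈ Set.Icc 0 T, κ t = Γ t) (hΓ : IsSPCESolution d T a b g Γ) :
    ∫⁻ z, coeffNorm a b z ∂(occupationMeasure T κ) < ⊤ := by
  rw [occupationMeasure, Measure.lintegral_compProd hab.measurable_coeffNorm]
  refine lt_of_eq_of_lt (setLIntegral_congr_fun measurableSet_Ioc fun t ht => ?_) hΓ.2.2.1
  simp only [hκ t ⟨ht.1.le, ht.2⟩]
  rfl

theorem weak_eq_cylinder (hg : GFamily d g) (hab : GoodCoeffs d a b)
    (hκ : ∀ t ∈ Set.Icc 0 T, κ t = Γ t) (hΓ : IsSPCESolution d T a b g Γ)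
    {f : (Fin n → ℝ) → ℝ} (hf : ContDiff ℝ 2 f) {t : ℝ} (ht : t ∈ Set.Icc 0 T) :
    ∫ μ, Fof g f μ ∂(κ t) - ∫ μ, Fof g f μ ∂(κ 0) =
      ∫ z in Set.Ioc 0 t ×ˢ Set.univ, bL a b g f z.1 z.2 ∂(occupationMeasure T κ) := by
  obtain ⟨R, hR⟩ := hg.exists_coords_bound n
  obtain ⟨f', hf', hff'⟩ := exists_isC2b_eq_on_ball hf R
  have hF : ∀ μ, Fof g f μ = Fof g f' μ := fun μ => (hff' _ (hR μ)).eq_of_nhds.symm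
  have hL : ∀ s μ, bL a b g f s μ = bL a b g f' s μ := fun s μ => by
    rw [bL_eq_fderiv, bL_eq_fderiv, (hff' _ (hR μ)).fderiv_eq]
  rw [setIntegral_occupationMeasure (hg.integrable_bL hab
    (lintegral_coeffNorm_occupationMeasure hab hκ hΓ) hf) le_rfl ht.2]
  simp_rw [hF, hL]
  rw [hκ t ht, hκ 0 ⟨le_rfl, ht.1.trans ht.2⟩, hΓ.2.2.2 n f' hf' t ht,
    intervalIntegral.integral_of_le ht.1]
  refine setIntegral_congr_fun measurableSet_Ioc fun s hs => ?_
  simp only [hκ s ⟨hs.1.le, hs.2.trans ht.2⟩]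

theorem exists_comp_cylinder (hg : GFamily d g) {A : Type} [Fintype A] [DecidableEq A]
    {p : A → C(SP d, ℝ) × (ℝ × SP d → ℝ)} (hp : ∀ α, p α ∈ cylinderFamily a b g)
    {u : (A → ℝ) → ℝ} (hu : ContDiff ℝ 2 u) :
    ∃ q ∈ cylinderFamily a b g, (∀ μ, q.1 μ = u fun α => (p α).1 μ) ∧
      ∀ z, q.2 z = ∑ α, fderiv ℝ u (fun β => (p β).1 z.2) (Pi.single α 1) * (p α).2 z := by
  choose n f hf h1 h2 using hp
  let N := Finset.univ.sup n
  have hN : ∀ α, n α ≤ N := fun α => Finset.le_sup (Finset.mem_univ α)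
  let R : ∀ α, (Fin N → ℝ) →L[ℝ] (Fin (n α) → ℝ) := fun α =>
    ContinuousLinearMap.pi fun i => ContinuousLinearMap.proj (Fin.castLE (hN α) i)
  let v : (Fin N → ℝ) → A → ℝ := fun y α => f α (R α y)
  have hv : ContDiff ℝ 2 v := contDiff_pi.2 fun α => (hf α).comp (R α).contDiff
  obtain ⟨q, hq, hq1, hq2⟩ := hg.exists_mem_cylinderFamily (a := a) (b := b) (hu.comp hv)
  refine ⟨q, hq, fun μ => ?_, fun z => ?_⟩
  · rw [hq1]
    simp_rw [h1]
    rfl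
  · rw [hq2, bL_eq_fderiv]
    have hd : ∀ α, HasFDerivAt (f α) (fderiv ℝ (f α) _)
        (R α fun l => ∫ x, g l x ∂z.2.1) := fun α =>
      ((hf α).differentiable (by norm_num) _).hasFDerivAt
    have hdv := hasFDerivAt_pi.2 fun α => (hd α).comp _ (R α).hasFDerivAt
    have hdu := ((hu.differentiable (by norm_num)
      (v fun l => ∫ x, g l x ∂z.2.1)).hasFDerivAt.comp _ hdv).fderiv
    rw [hdu, ContinuousLinearMap.comp_apply]
    conv_lhs => rw [pi_eq_sum_univ' (ContinuousLinearMap.pi _ _), map_sum]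
    refine Finset.sum_congr rfl fun α _ => ?_
    rw [map_smul, smul_eq_mul, mul_comm, h2, bL_eq_fderiv]
    congr 2
    · simp_rw [h1]
      rfl

theorem isTestFamily_cylinderFamily (hg : GFamily d g) (hab : GoodCoeffs d a b)
    (hκ : ∀ t ∈ Set.Icc 0 T, κ t = Γ t)
    (hcont : ∀ F : C(SP d, ℝ), Continuous fun t => ∫ μ, F μ ∂(κ t))
    (hΓ : IsSPCESolution d T a b g Γ) : IsTestFamily T κ (cylinderFamily a b g) where
  continuous_integral := hcont
  measurable := by
    rintro p ⟨n, f, hf, -, h2⟩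
    rw [show p.2 = _ from funext h2]
    exact hg.measurable_bL hab hf
  integrable := by
    rintro p ⟨n, f, hf, -, h2⟩
    rw [show p.2 = _ from funext h2]
    exact hg.integrable_bL hab (lintegral_coeffNorm_occupationMeasure hab hκ hΓ) hf
  weak_eq := by
    rintro p ⟨n, f, hf, h1, h2⟩ s t hs hst ht
    have hi := hg.integrable_bL hab (lintegral_coeffNorm_occupationMeasure hab hκ hΓ) hf
    have ht' := weak_eq_cylinder hg hab hκ hΓ hf ⟨hs.trans hst, ht⟩
    have hs' := weak_eq_cylinder hg hab hκ hΓ hf ⟨hs, hst.trans ht⟩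
    simp_rw [h1, h2]
    rw [← Set.Ioc_union_Ioc_eq_Ioc hs hst, Set.union_prod, setIntegral_union
      (Set.disjoint_prod.2 (Or.inl (Set.Ioc_disjoint_Ioc_of_le le_rfl)))
      (measurableSet_Ioc.prod MeasurableSet.univ) hi.integrableOn hi.integrableOn] at ht'
    linarith
  comp := fun A _ _ p hp u hu => exists_comp_cylinder hg hp hu

end CylinderFunctions

section Curves

open ProbabilityTheory

variable {d : ℕ} {T : ℝ} {a : ℝ → SP d → Rd d → Fin d → Fin d → ℝ}
  {b : ℝ → SP d → Rd d → Fin d → ℝ} {g : ℕ → Rd d → ℝ} {m : ℝ → SP d}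

theorem intervalIntegrable_integral_Lop (hab : GoodCoeffs d a b) (hm : Measurable m)
    (hA : ∫⁻ r in Set.Ioc 0 T, coeffNorm a b (r, m r) < ⊤) {φ : Rd d → ℝ} (hφ : IsC2c φ) {t : ℝ}
    (ht : t ∈ Set.Icc 0 T) :
    IntervalIntegrable (fun r => ∫ x, Lop a b r (m r) φ x ∂(m r).1) volume 0 t := by
  have hm' : Measurable fun r : ℝ => (r, m r) := measurable_id.prodMk hm
  have h : ∫⁻ z, coeffNorm a b z ∂((volume.restrict (Set.Ioc 0 T)).map fun r => (r, m r)) < ⊤ := by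
    rwa [lintegral_map hab.measurable_coeffNorm hm']
  have := (hab.integrable_integral_Lop h hφ).comp_measurable hm'
  rw [intervalIntegrable_iff_integrableOn_Ioc_of_le ht.1]
  exact IntegrableOn.mono_set (t := Set.Ioc 0 T) this (Set.Ioc_subset_Ioc_right ht.2)

theorem enorm_intervalIntegral_le {h : ℝ → ℝ} {ε : ℝ}
    (hh : ∀ᵐ r, r ∈ Set.Ioc 0 T → ‖h r‖ₑ ≤ ENNReal.ofReal ε * coeffNorm a b (r, m r)) {t : ℝ}
    (ht : t ∈ Set.Icc 0 T) :
    ‖∫ r in (0:ℝ)..t, h r‖ₑ ≤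
      ENNReal.ofReal ε * ∫⁻ r in Set.Ioc 0 T, coeffNorm a b (r, m r) := by
  rw [intervalIntegral.integral_of_le ht.1, ← lintegral_const_mul' _ _ ENNReal.ofReal_ne_top]
  calc _ ≤ ∫⁻ r in Set.Ioc 0 t, ‖h r‖ₑ := enorm_integral_le_lintegral_enorm _
    _ ≤ ∫⁻ r in Set.Ioc 0 T, ‖h r‖ₑ := lintegral_mono_set (Set.Ioc_subset_Ioc_right ht.2)
    _ ≤ _ := lintegral_mono_ae ((ae_restrict_iff' measurableSet_Ioc).2 hh)

theorem ae_coeffNorm_lt_top (hab : GoodCoeffs d a b) (hm : Measurable m)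
    (hA : ∫⁻ r in Set.Ioc 0 T, coeffNorm a b (r, m r) < ⊤) :
    ∀ᵐ r, r ∈ Set.Ioc 0 T → coeffNorm a b (r, m r) < ⊤ :=
  (ae_restrict_iff' measurableSet_Ioc).1
    (ae_lt_top (hab.measurable_coeffNorm.comp (measurable_id.prodMk hm)) hA.ne)

theorem abs_le_of_enorm_le {x ε : ℝ} (hε : 0 ≤ ε) {C : ENNReal} (hC : C < ⊤)
    (h : ‖x‖ₑ ≤ ENNReal.ofReal ε * C) : |x| ≤ ε * C.toReal := by
  rw [← ENNReal.ofReal_toReal hC.ne, ← ENNReal.ofReal_mul hε, Real.enorm_eq_ofReal_abs] at h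
  exact (ENNReal.ofReal_le_ofReal_iff (by positivity)).1 h

theorem enorm_sub_integral_Lop_le (hab : GoodCoeffs d a b) {φ ψ : Rd d → ℝ} (hφ : IsC2c φ)
    (hψ : IsC2c ψ) {ε : ℝ} (hε : 0 ≤ ε) (h : C2Close φ ψ ε) {t : ℝ} {μ : SP d}
    (hμ : coeffNorm a b (t, μ) < ⊤) :
    ‖∫ x, Lop a b t μ φ x ∂μ.1 - ∫ x, Lop a b t μ ψ x ∂μ.1‖ₑ ≤
      ENNReal.ofReal ε * coeffNorm a b (t, μ) := by
  have hd : ∀ {θ : Rd d → ℝ}, IsC2c θ → Differentiable ℝ θ := fun hθ =>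
    hθ.1.differentiable (by norm_num)
  have h1 : ∀ i x, pd (fun y => φ y - ψ y) i x = pd φ i x - pd ψ i x := fun i x => by
    simp only [pd]
    rw [fderiv_fun_sub (hd hφ x) (hd hψ x)]
    rfl
  have h2 : ∀ i j x, pd2 (fun y => φ y - ψ y) i j x = pd2 φ i j x - pd2 ψ i j x :=
    fun i j x => by
      simp only [pd2, h1]
      rw [fderiv_fun_sub ((contDiff_pd hφ.1 j).differentiable (by norm_num) x)
        ((contDiff_pd hψ.1 j).differentiable (by norm_num) x)]
      rfl
  have hL : ∀ x, Lop a b t μ φ x - Lop a b t μ ψ x = Lop a b t μ (fun y => φ y - ψ y) x :=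
    fun x => by
      simp only [Lop, h1, h2, mul_sub, Finset.sum_sub_distrib]
      ring
  rw [← integral_sub (hab.integrable_Lop hφ hμ) (hab.integrable_Lop hψ hμ)]
  simp_rw [hL]
  exact enorm_integral_Lop_le hε (fun i x => by rw [h1]; exact h.2.1 i x)
    (fun i j x => by rw [h2]; exact h.2.2 i j x) (t, μ)

theorem GFamily.nlfpkEq_of_dense (hg : GFamily d g) (hab : GoodCoeffs d a b) (hm : Measurable m)
    (hA : ∫⁻ r in Set.Ioc 0 T, coeffNorm a b (r, m r) < ⊤) {t : ℝ} (ht : t ∈ Set.Icc 0 T)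
    (heq : ∀ i, NLFPKEq d a b m (g i) t) {φ : Rd d → ℝ} (hφ : IsC2c φ) :
    NLFPKEq d a b m φ t := by
  set C := (∫⁻ r in Set.Ioc 0 T, coeffNorm a b (r, m r)).toReal with hC
  have hC0 : 0 ≤ C := ENNReal.toReal_nonneg
  refine eq_of_forall_dist_le fun δ hδ => ?_
  obtain ⟨ε, hε, hεδ⟩ : ∃ ε : ℝ, 0 < ε ∧ ε * (2 + C) ≤ δ :=
    ⟨δ / (2 + C), by positivity, by rw [div_mul_cancel₀ _ (by positivity)]⟩
  obtain ⟨i, hi⟩ := hg.2.2 φ hφ ε hε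
  have key : ∀ ρ : SP d, |∫ x, g i x ∂ρ.1 - ∫ x, φ x ∂ρ.1| ≤ ε := fun ρ => by
    rw [← integral_sub ((hg.1 i).integrable _) (hφ.integrable _)]
    exact SP.abs_integral_le hi.1 hε.le ρ
  have h1 := abs_le.1 (key (m t))
  have h2 := abs_le.1 (key (m 0))
  have h3 := abs_le_of_enorm_le hε.le hA (enorm_intervalIntegral_le (m := m) (h := fun r =>
      ∫ x, Lop a b r (m r) (g i) x ∂(m r).1 - ∫ x, Lop a b r (m r) φ x ∂(m r).1) (by
    filter_upwards [ae_coeffNorm_lt_top hab hm hA] with r hr hr'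
    exact enorm_sub_integral_Lop_le hab (hg.1 i) hφ hε.le hi (hr hr')) ht)
  rw [intervalIntegral.integral_sub (intervalIntegrable_integral_Lop hab hm hA (hg.1 i) ht)
    (intervalIntegrable_integral_Lop hab hm hA hφ ht), ← heq i, ← hC] at h3
  have h3' := abs_le.1 h3
  rw [Real.dist_eq, abs_le]
  constructor <;> nlinarith

theorem nlfpkIntegrable_of_coeffNorm (hA : ∫⁻ r in Set.Ioc 0 T, coeffNorm a b (r, m r) < ⊤) :
    NLFPKIntegrable d T a b m := by
  refine fun i j => lt_of_le_of_lt (lintegral_mono fun r => lintegral_mono fun x =>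
    ENNReal.ofReal_le_ofReal ?_) hA
  have h1 := Finset.single_le_sum (f := fun i => |b r (m r) x i|) (fun _ _ => abs_nonneg _)
    (Finset.mem_univ i)
  have h2 := Finset.single_le_sum (f := fun j => |a r (m r) x i j|) (fun _ _ => abs_nonneg _)
    (Finset.mem_univ j)
  have h3 := Finset.single_le_sum (f := fun i => ∑ j, |a r (m r) x i j|)
    (fun i _ => Finset.sum_nonneg fun _ _ => abs_nonneg _) (Finset.mem_univ i)
  simp only [coeffSize] at *
  linarith

theorem GFamily.isSubprobSolution (hg : GFamily d g) (hab : GoodCoeffs d a b) (hT : 0 ≤ T)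
    (hm : Measurable m) (hA : ∫⁻ r in Set.Ioc 0 T, coeffNorm a b (r, m r) < ⊤)
    (heq : ∀ i, ∀ t ∈ Set.Icc 0 T, NLFPKEq d a b m (g i) t) : IsSubprobSolution d T a b m := by
  refine ⟨?_, nlfpkIntegrable_of_coeffNorm hA,
    fun φ hφ t ht => hg.nlfpkEq_of_dense hab hm hA ht (fun i => heq i t ht) hφ⟩
  rw [hg.isClosedEmbedding_Gmap.isInducing.continuousOn_iff]
  refine continuousOn_pi.2 fun i => ?_
  have h := intervalIntegrable_integral_Lop hab hm hA (hg.1 i) ⟨hT, le_rfl⟩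
  have hc := intervalIntegral.continuousOn_primitive_interval' h Set.left_mem_uIcc
  rw [Set.uIcc_of_le hT] at hc
  refine (hc.const_add (∫ x, g i x ∂(m 0).1)).congr fun t ht => ?_
  have := heq i t ht
  rw [NLFPKEq] at this
  simp only [Function.comp, Gmap]
  linarith

theorem IsSubprobSolution.measure_univ_eq
    (hA : ∫⁻ r in Set.Ioc 0 T, coeffNorm a b (r, m r) < ⊤)
    (hsol : IsSubprobSolution d T a b m) {t : ℝ} (ht : t ∈ Set.Icc 0 T) :
    (m t).1 Set.univ = (m 0).1 Set.univ := by
  obtain ⟨χ, M, hM, hχ⟩ := exists_cutoff d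
  have hlim : ∀ ρ : SP d, Tendsto (fun k => ∫ x, χ k x ∂ρ.1) atTop (𝓝 (ρ.1 Set.univ).toReal) := by
    intro ρ
    have h := tendsto_integral_testFunction isOpen_univ (fun k => (hχ k).1)
      (fun k => (hχ k).2.1) (fun x => by
        obtain ⟨k, hk⟩ := exists_nat_ge ‖x‖
        refine tendsto_const_nhds.congr' ?_
        filter_upwards [eventually_ge_atTop k] with l hl
        have : (k : ℝ) ≤ l := by exact_mod_cast hl
        rw [(hχ l).2.2.1 x (by linarith)]
        simp) ρ.1
    refine ((ENNReal.tendsto_toReal (measure_ne_top ρ.1 _)).comp h).congr fun k => ?_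
    exact ENNReal.toReal_ofReal (integral_nonneg fun x => ((hχ k).2.1 x).1)
  have h0 : Tendsto (fun k : ℕ => M / ((k : ℝ) + 1) *
      (∫⁻ r in Set.Ioc 0 T, coeffNorm a b (r, m r)).toReal) atTop (𝓝 0) := by
    have := (tendsto_one_div_add_atTop_nhds_zero_nat (𝕜 := ℝ)).const_mul M
    simpa [div_eq_mul_inv] using this.mul_const _
  have hz : Tendsto (fun k => ∫ x, χ k x ∂(m t).1 - ∫ x, χ k x ∂(m 0).1) atTop (𝓝 0) := by
    refine squeeze_zero_norm (fun k => ?_) h0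
    rw [hsol.2.2 (χ k) (hχ k).1 t ht, Real.norm_eq_abs]
    refine abs_le_of_enorm_le (by positivity) hA (enorm_intervalIntegral_le
      (ae_of_all _ fun r _ => ?_) ht)
    exact enorm_integral_Lop_le (by positivity) (hχ k).2.2.2.1 (hχ k).2.2.2.2 (r, m r)
  have := tendsto_nhds_unique ((hlim (m t)).sub (hlim (m 0))) hz
  exact (ENNReal.toReal_eq_toReal_iff' (measure_ne_top _ _) (measure_ne_top _ _)).1
    (sub_eq_zero.1 this)

theorem IsSPCESolution.exists_eq_dirac {Γ : ℝ → Measure (SP d)} {μ₀ : SP d}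
    (hΓ : IsSPCESolution d T a b g Γ) (hT : 0 < T) (hab : GoodCoeffs d a b) (hg : GFamily d g)
    (huniq : ∀ μ ν : ℝ → SP d, IsSubprobSolution d T a b μ → μ 0 = μ₀ →
      IsSubprobSolution d T a b ν → ν 0 = μ₀ → ∀ t ∈ Set.Icc (0:ℝ) T, μ t = ν t)
    (hΓ0 : Γ 0 = Measure.dirac μ₀) :
    ∃ m : ℝ → SP d, IsSubprobSolution d T a b m ∧ m 0 = μ₀ ∧
      ∫⁻ r in Set.Ioc 0 T, coeffNorm a b (r, m r) < ⊤ ∧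
      ∀ t ∈ Set.Icc (0:ℝ) T, Γ t = Measure.dirac (m t) := by
  have := hg.t2Space
  have := hg.secondCountableTopology
  obtain ⟨κ, _, hκ, hcont⟩ := exists_kernel hg hT.le hΓ.1 hΓ.2.1
  have h𝒟 := isTestFamily_cylinderFamily hg hab hκ hcont hΓ
  choose P hP hP1 hP2 using fun i : ℕ => hg.exists_mem_cylinderFamily (a := a) (b := b)
    (f := fun y : Fin (i + 1) → ℝ => y (Fin.last i)) (contDiff_apply ℝ ℝ _)
  have hP2' : ∀ i z, (P i).2 z = ∫ x, Lop a b z.1 z.2 (g i) x ∂z.2.1 := fun i z => by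
    rw [hP2, bL_eq_fderiv, (hasFDerivAt_apply (Fin.last i) _).fderiv]
    simp
  have hP1' : ∀ i μ, (P i).1 μ = ∫ x, g i x ∂μ.1 := fun i μ => by
    rw [hP1, Fof]
    simp
  obtain ⟨η, _, Y, hY, hmarg, hpath⟩ := h𝒟.exists_process hT hP fun μ ν h =>
    hg.injective_Gmap (funext fun i => by simpa only [Gmap, hP1'] using h i)
  have hYt : ∀ t, Measurable fun ω => Y (t, ω) := fun t => hY.comp measurable_prodMk_left
  have hYω : ∀ ω, Measurable fun t => Y (t, ω) := fun ω => hY.comp measurable_prodMk_right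
  have h0mem : (0:ℝ) ∈ Set.Icc 0 T := ⟨le_rfl, hT.le⟩
  have hinit : ∀ᵐ ω ∂η, Y (0, ω) = μ₀ := by
    refine ae_of_ae_map (hYt 0).aemeasurable (p := fun μ => μ = μ₀) ?_
    rw [hmarg 0 h0mem, hκ 0 h0mem, hΓ0, ae_dirac_eq]
    exact rfl
  have hfin : ∀ᵐ ω ∂η, ∫⁻ r in Set.Ioc 0 T, coeffNorm a b (r, Y (r, ω)) < ⊤ := by
    refine ae_lt_top ?_ ?_
    · exact Measurable.lintegral_prod_left' (f := fun p : ℝ × (ℚ → SP d) =>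
        coeffNorm a b (p.1, Y p)) (hab.measurable_coeffNorm.comp (measurable_fst.prodMk hY))
    · rw [lintegral_process (κ := κ) hY hmarg hab.measurable_coeffNorm]
      exact (lintegral_coeffNorm_occupationMeasure hab hκ hΓ).ne
  have hsol : ∀ᵐ ω ∂η, IsSubprobSolution d T a b fun t => Y (t, ω) := by
    filter_upwards [hpath, hfin] with ω h1 h2
    refine hg.isSubprobSolution hab hT.le (hYω ω) h2 fun i t ht => ?_
    simpa only [NLFPKEq, hP1', hP2'] using h1 i t ht
  obtain ⟨ω₀, h1, h2, h3⟩ := (hsol.and (hinit.and hfin)).exists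
  refine ⟨fun t => Y (t, ω₀), h1, h2, h3, fun t ht => ?_⟩
  rw [← hκ t ht, ← hmarg t ht, Measure.map_congr (g := fun _ => Y (t, ω₀)) ?_,
    Measure.map_const, measure_univ, one_smul]
  filter_upwards [hsol, hinit] with ω h1' h2'
  exact huniq _ _ h1' h2' h1 h2 t ht

end Curves

/-- Corollary 3.9: uniqueness of subprobability solutions to (NLFPK) with
initial condition `μ₀` implies uniqueness of weakly continuous solutions to (SP-CE) with
initial condition `δ_{μ₀}`; if `μ₀` is a probability measure then, in case of existence,
`Γ_t` is concentrated on probability measures for all `t`. -/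
theorem uniqueness_transfer_NLFPK_to_SPCE (d : ℕ) (T : ℝ) (hT : 0 < T)
    (a : ℝ → SP d → Rd d → Fin d → Fin d → ℝ) (b : ℝ → SP d → Rd d → Fin d → ℝ)
    (hab : GoodCoeffs d a b) (g : ℕ → Rd d → ℝ) (hg : GFamily d g)
    (μ₀ : SP d)
    (huniq : ∀ μ ν : ℝ → SP d, IsSubprobSolution d T a b μ → μ 0 = μ₀ →
      IsSubprobSolution d T a b ν → ν 0 = μ₀ → ∀ t ∈ Set.Icc (0:ℝ) T, μ t = ν t) :
    (∀ Γ Γ' : ℝ → Measure (SP d),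
      IsSPCESolution d T a b g Γ → Γ 0 = Measure.dirac μ₀ →
      IsSPCESolution d T a b g Γ' → Γ' 0 = Measure.dirac μ₀ →
      ∀ t ∈ Set.Icc (0:ℝ) T, Γ t = Γ' t) ∧
    (μ₀.1 Set.univ = 1 → ∀ Γ : ℝ → Measure (SP d),
      IsSPCESolution d T a b g Γ → Γ 0 = Measure.dirac μ₀ →
      ∀ t ∈ Set.Icc (0:ℝ) T, Γ t {ν : SP d | ν.1 Set.univ = 1} = 1) := by
  refine ⟨fun Γ Γ' hΓ h0 hΓ' h0' t ht => ?_, fun hμ₀ Γ hΓ h0 t ht => ?_⟩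
  · obtain ⟨m, hm, hm0, -, hmt⟩ := hΓ.exists_eq_dirac hT hab hg huniq h0
    obtain ⟨m', hm', hm0', -, hmt'⟩ := hΓ'.exists_eq_dirac hT hab hg huniq h0'
    rw [hmt t ht, hmt' t ht, huniq m m' hm hm0 hm' hm0' t ht]
  · obtain ⟨m, hm, hm0, hA, hmt⟩ := hΓ.exists_eq_dirac hT hab hg huniq h0
    rw [hmt t ht]
    refine Measure.dirac_apply_of_mem ?_
    rw [Set.mem_ofPred_eq, hm.measure_univ_eq hA ht, hm0, hμ₀]
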